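/- arXiv:1210.2083 — 3 statements merged into one kernel-verified Lean document; each statement's English description precedes it below -/
import Mathlib

section
/- Let N and L be positive integers. For any ε > 0 and any infinite subset X of the torus 𝕋^N there exists a continuous group homomorphism T : 𝕋^N → 𝕋^L (equivalently, an L×N matrix with integer entries acting by left multiplication) such that the image TX = {Tx : x ∈ X} is ε-dense in 𝕋^L. -/
open scoped BigOperators
open Matrix

/-- The one-dimensional torus `𝕋 = ℝ/ℤ`. -/
abbrev Torus1 := AddCircle (1 : ℝ)

/-- Action of an `L × N` integer matrix on the torus `𝕋^N`, by left multiplication. -/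
noncomputable def torusAct {L N : ℕ} (A : Matrix (Fin L) (Fin N) ℤ) (x : Fin N → Torus1) :
    Fin L → Torus1 :=
  fun i => ∑ j, A i j • x j

/-- `Y` is `ε`-dense in the full torus `𝕋^L`: every point of `𝕋^L` is within distance `ε`
of some element of `Y` in every coordinate. -/
def EpsDense {L : ℕ} (Y : Set (Fin L → Torus1)) (ε : ℝ) : Prop :=
  ∀ t : Fin L → Torus1, ∃ y ∈ Y, ∀ i, dist (y i) (t i) ≤ ε

/-- `Y` is `ε`-dense in a subset `S` of `𝕋^L`. -/
def EpsDenseIn {L : ℕ} (Y S : Set (Fin L → Torus1)) (ε : ℝ) : Prop :=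
  ∀ s ∈ S, ∃ y ∈ Y, ∀ i, dist (y i) (s i) ≤ ε

/-- A subtorus of `𝕋^L`: a nontrivial closed connected (Lie) subgroup. -/
def IsSubtorus {L : ℕ} (T : AddSubgroup (Fin L → Torus1)) : Prop :=
  IsClosed (T : Set (Fin L → Torus1)) ∧ IsConnected (T : Set (Fin L → Torus1)) ∧ T ≠ ⊥

/-- The translate `t + 𝒯` of a subtorus. -/
def translateOf {L : ℕ} (t : Fin L → Torus1) (T : AddSubgroup (Fin L → Torus1)) :
    Set (Fin L → Torus1) :=
  (fun y => t + y) '' (T : Set (Fin L → Torus1))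

/-- Evaluation at an integer `n` of the matrix of polynomials
`A(x) = A 0 + x • A 1 + ⋯ + x^D • A D`. -/
def evalMat {L N D : ℕ} (A : Fin (D + 1) → Matrix (Fin L) (Fin N) ℤ) (n : ℤ) :
    Matrix (Fin L) (Fin N) ℤ :=
  ∑ d : Fin (D + 1), n ^ (d : ℕ) • A d

/-- Condition (a): the columns of the non-constant part `A_*(x)` are `ℚ`-linearly
independent, i.e. the only `w ∈ ℚ^N` with `A_*(x) w ≡ 0` is `w = 0`. -/
def CondA {L N D : ℕ} (A : Fin (D + 1) → Matrix (Fin L) (Fin N) ℤ) : Prop :=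
  ∀ w : Fin N → ℚ,
    (∀ d : Fin (D + 1), d ≠ 0 → ((A d).map ((↑) : ℤ → ℚ)).mulVec w = 0) → w = 0

/-- Condition (b): whenever `v ⬝ A_d w = 0` for all `d = 1, …, D`, also `v ⬝ A_0 w = 0`. -/
def CondB {L N D : ℕ} (A : Fin (D + 1) → Matrix (Fin L) (Fin N) ℤ) : Prop :=
  ∀ (v : Fin L → ℚ) (w : Fin N → ℚ),
    (∀ d : Fin (D + 1), d ≠ 0 → v ⬝ᵥ ((A d).map ((↑) : ℤ → ℚ)).mulVec w = 0) →
    v ⬝ᵥ ((A 0).map ((↑) : ℤ → ℚ)).mulVec w = 0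

/-- `‖A_*‖_∞`: the maximum of the absolute values of the integer coefficients appearing
in the non-constant part of `A`. -/
def starNorm {L N D : ℕ} (A : Fin (D + 1) → Matrix (Fin L) (Fin N) ℤ) : ℕ :=
  (Finset.univ.filter (fun d : Fin (D + 1) => d ≠ 0)).sup fun d =>
    Finset.univ.sup fun p : Fin L × Fin N => (A d p.1 p.2).natAbs

open Filter Topology in
/-- The Cesàro means of the powers of a unit complex number `z` tend to `1` if `z = 1` and to
`0` otherwise. -/
theorem tendsto_cesaro_pow {z : ℂ} (hz : ‖z‖ = 1) :
    Tendsto (fun P : ℕ => (P : ℂ)⁻¹ * ∑ n ∈ Finset.range P, z ^ n) atTop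
      (𝓝 (if z = 1 then 1 else 0)) := by
  split_ifs with h
  · subst h
    refine tendsto_const_nhds.congr' ?_
    filter_upwards [eventually_gt_atTop 0] with P hP
    have : (P : ℂ) ≠ 0 := by exact_mod_cast hP.ne'
    simp [this]
  · have h0 : Tendsto (fun P : ℕ => (P : ℝ)⁻¹ * (2 / ‖z - 1‖)) atTop (𝓝 0) := by
      simpa using (tendsto_inv_atTop_nhds_zero_nat (𝕜 := ℝ)).mul_const (2 / ‖z - 1‖)
    refine squeeze_zero_norm (fun P => ?_) h0
    rw [geom_sum_eq h, norm_mul, norm_inv, norm_div, Complex.norm_natCast]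
    gcongr
    calc ‖z ^ P - 1‖ ≤ ‖z ^ P‖ + ‖(1 : ℂ)‖ := norm_sub_le _ _
      _ = 2 := by rw [norm_pow, hz]; norm_num

/-- The standard character `x ↦ e^{2πix}` of `ℝ/ℤ`, with complex values. -/
noncomputable def torusChar (x : Torus1) : ℂ := (AddCircle.toCircle x : ℂ)

theorem torusChar_ne_zero (x : Torus1) : torusChar x ≠ 0 := Circle.coe_ne_zero _

theorem norm_torusChar (x : Torus1) : ‖torusChar x‖ = 1 := Circle.norm_coe _

theorem norm_torusChar_zpow (x : Torus1) (n : ℤ) : ‖torusChar x ^ n‖ = 1 := by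
  rw [norm_zpow, norm_torusChar, _root_.one_zpow]

theorem torusChar_add (x y : Torus1) : torusChar (x + y) = torusChar x * torusChar y := by
  simp [torusChar, AddCircle.toCircle_add]

theorem torusChar_zsmul (n : ℤ) (x : Torus1) : torusChar (n • x) = torusChar x ^ n := by
  simp [torusChar, AddCircle.toCircle_zsmul]

theorem torusChar_neg (x : Torus1) : torusChar (-x) = (starRingEnd ℂ) (torusChar x) := by
  simp only [torusChar, AddCircle.toCircle_neg, Circle.coe_inv_eq_conj]

theorem torusChar_eq_one_iff (x : Torus1) : torusChar x = 1 ↔ x = 0 := by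
  constructor
  · intro h
    apply AddCircle.injective_toCircle (T := (1 : ℝ)) one_ne_zero
    rw [AddCircle.toCircle_zero]
    exact Circle.ext (by simpa [torusChar] using h)
  · rintro rfl
    simp [torusChar]

theorem continuous_torusChar : Continuous torusChar :=
  continuous_subtype_val.comp AddCircle.continuous_toCircle

/-- Away from `0` the function `‖1 + e^{2πix}‖` is bounded by a constant smaller than `2`. -/
theorem exists_norm_one_add_torusChar_le {ε : ℝ} (hε : 0 < ε) :
    ∃ c : ℝ, 0 ≤ c ∧ c < 2 ∧ ∀ x : Torus1, ε ≤ ‖x‖ → ‖1 + torusChar x‖ ≤ c := by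
  have hlt : ∀ x : Torus1, ε ≤ ‖x‖ → ‖1 + torusChar x‖ < 2 := by
    intro x hx
    have hne : (1 : ℂ) ≠ torusChar x := by
      intro h
      rw [(torusChar_eq_one_iff x).1 h.symm, norm_zero] at hx
      linarith
    have hray : ¬ SameRay ℝ (1 : ℂ) (torusChar x) := by
      intro h
      exact hne ((sameRay_iff_of_norm_eq (by rw [norm_one, norm_torusChar])).1 h)
    have := norm_add_lt_of_not_sameRay hray
    rw [norm_one, norm_torusChar] at this
    linarith
  have hcomp : IsCompact {x : Torus1 | ε ≤ ‖x‖} :=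
    (isClosed_le continuous_const continuous_norm).isCompact
  rcases Set.eq_empty_or_nonempty {x : Torus1 | ε ≤ ‖x‖} with he | hne
  · exact ⟨0, le_rfl, two_pos, fun x hx => absurd (show x ∈ {x : Torus1 | ε ≤ ‖x‖} from hx)
      (by simp [he])⟩
  · obtain ⟨x₀, hx₀, hmax⟩ := hcomp.exists_isMaxOn hne
      (f := fun x => ‖1 + torusChar x‖) (by have := continuous_torusChar; fun_prop)
    exact ⟨‖1 + torusChar x₀‖, norm_nonneg _, hlt x₀ hx₀, fun x hx => hmax hx⟩

/-- The character of `𝕋^L` with frequency vector `m`. -/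
noncomputable def torusMonomial {L : ℕ} (m : Fin L → ℤ) (u : Fin L → Torus1) : ℂ :=
  ∏ l, torusChar (u l) ^ m l

theorem torusMonomial_add {L : ℕ} (m : Fin L → ℤ) (u v : Fin L → Torus1) :
    torusMonomial m (u + v) = torusMonomial m u * torusMonomial m v := by
  simp only [torusMonomial, Pi.add_apply, torusChar_add, mul_zpow, Finset.prod_mul_distrib]

theorem norm_torusMonomial {L : ℕ} (m : Fin L → ℤ) (u : Fin L → Torus1) :
    ‖torusMonomial m u‖ = 1 := by
  simp [torusMonomial, norm_prod, norm_torusChar]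

theorem torusMonomial_neg {L : ℕ} (m : Fin L → ℤ) (u : Fin L → Torus1) :
    torusMonomial m (-u) = (starRingEnd ℂ) (torusMonomial m u) := by
  simp only [torusMonomial, Pi.neg_apply, torusChar_neg, map_prod, map_zpow₀]

/-- The square of an exponential sum along the points `(a_l x)_l`, expanded over pairs. -/
theorem normSq_sum_torusMonomial {L : ℕ} (m : Fin L → ℤ) (S : Finset Torus1) (a : Fin L → ℕ) :
    ((‖∑ x ∈ S, torusMonomial m (fun l => a l • x)‖ ^ 2 : ℝ) : ℂ) =
      ∑ x ∈ S, ∑ y ∈ S, ∏ l, torusChar (m l • (x - y)) ^ a l := by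
  push_cast
  rw [← Complex.mul_conj', map_sum, Finset.sum_mul_sum]
  refine Finset.sum_congr rfl fun x _ => Finset.sum_congr rfl fun y _ => ?_
  rw [← torusMonomial_neg, ← torusMonomial_add]
  refine Finset.prod_congr rfl fun l _ => ?_
  rw [← torusChar_zsmul, ← zpow_natCast, ← torusChar_zsmul]
  congr 1
  simp only [Pi.add_apply, Pi.neg_apply, ← natCast_zsmul, smul_smul, mul_comm, sub_eq_add_neg,
    smul_add, smul_neg]

open Filter Topology in
open scoped Classical in
/-- Mean square over multipliers of an exponential sum: only the pairs with
`m_l (x - y) = 0` for all `l` contribute in the limit. -/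
theorem tendsto_mean_normSq_sum_torusMonomial {L : ℕ} (m : Fin L → ℤ) (S : Finset Torus1) :
    Tendsto (fun P : ℕ => ((P : ℝ)⁻¹) ^ L *
        ∑ a ∈ Fintype.piFinset (fun _ : Fin L => Finset.range P),
          ‖∑ x ∈ S, torusMonomial m (fun l => a l • x)‖ ^ 2) atTop
      (𝓝 (∑ x ∈ S, ∑ y ∈ S, if ∀ l, m l • (x - y) = 0 then 1 else 0)) := by
  have key : Tendsto (fun P : ℕ => ∑ x ∈ S, ∑ y ∈ S, ∏ l,
      ((P : ℂ)⁻¹ * ∑ n ∈ Finset.range P, torusChar (m l • (x - y)) ^ n)) atTop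
      (𝓝 (∑ x ∈ S, ∑ y ∈ S, ∏ l, if torusChar (m l • (x - y)) = 1 then 1 else 0)) :=
    tendsto_finsetSum _ fun x _ => tendsto_finsetSum _ fun y _ => tendsto_finsetProd _ fun l _ =>
      tendsto_cesaro_pow (norm_torusChar _)
  have hre := (Complex.continuous_re.tendsto _).comp key
  convert hre using 1
  · funext P
    rw [Function.comp_apply, ← Complex.ofReal_re (_ * _)]
    congr 1
    rw [Complex.ofReal_mul, Complex.ofReal_sum]
    simp only [normSq_sum_torusMonomial, Finset.prod_mul_distrib, Finset.prod_univ_sum,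
      Finset.prod_const, Finset.card_univ, Fintype.card_fin]
    push_cast
    simp only [Finset.mul_sum]
    rw [Finset.sum_comm]
    refine Finset.sum_congr rfl fun x _ => ?_
    rw [Finset.sum_comm]
  · congr 1
    simp only [torusChar_eq_one_iff, Complex.re_sum]
    refine Finset.sum_congr rfl fun x _ => Finset.sum_congr rfl fun y _ => ?_
    rw [Finset.prod_ite_zero]
    simp [apply_ite Complex.re]

/-- The points of `ℝ/ℤ` annihilated by all the entries of a nonzero integer vector are finitely
many. -/
theorem finite_setOf_forall_zsmul_eq_zero {L : ℕ} {m : Fin L → ℤ} (hm : m ≠ 0) :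
    {u : Torus1 | ∀ l, m l • u = 0}.Finite := by
  obtain ⟨l, hl⟩ := Function.ne_iff.1 hm
  refine (AddCircle.finite_torsion (1 : ℝ) (n := (m l).natAbs)
    (Int.natAbs_pos.2 hl)).subset fun u hu => ?_
  have h := hu l
  rcases Int.natAbs_eq (m l) with h' | h' <;> rw [h'] at h <;> simpa using h

open Filter Topology in
/-- Given finitely many nonzero frequencies, an infinite subset of `ℝ/ℤ` contains a finite set
`S` such that for some multipliers `a` all the exponential sums over `(a_l x)_l`, `x ∈ S`, are
small compared with the size of `S`. -/
theorem exists_sum_torusMonomial_le {L : ℕ} {X : Set Torus1} (hX : X.Infinite)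
    (M : Finset (Fin L → ℤ)) (hM : 0 ∉ M) {δ : ℝ} (hδ : 0 < δ) :
    ∃ S : Finset Torus1, ↑S ⊆ X ∧ S.Nonempty ∧ ∃ a : Fin L → ℕ, ∀ m ∈ M,
      ‖∑ x ∈ S, torusMonomial m (fun l => a l • x)‖ ≤ δ * S.card := by
  classical
  have hU : {u : Torus1 | ∃ m ∈ M, ∀ l, m l • u = 0}.Finite := by
    have : {u : Torus1 | ∃ m ∈ M, ∀ l, m l • u = 0} =
        ⋃ m ∈ M, {u : Torus1 | ∀ l, m l • u = 0} := by
      ext; simp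
    rw [this]
    exact M.finite_toSet.biUnion fun m hm =>
      finite_setOf_forall_zsmul_eq_zero (ne_of_mem_of_not_mem hm hM)
  obtain ⟨k, hk⟩ := exists_nat_gt ((M.card : ℝ) * hU.toFinset.card / δ ^ 2)
  have hk0 : 0 < (k : ℝ) := lt_of_le_of_lt (by positivity) hk
  rw [div_lt_iff₀ (by positivity)] at hk
  obtain ⟨S, hSX, hSk⟩ := hX.exists_subset_card_eq k
  have hS : S.Nonempty := by
    rw [← Finset.card_pos, hSk]; exact_mod_cast hk0
  refine ⟨S, hSX, hS, ?_⟩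
  have hpairs : ∀ m ∈ M, (∑ x ∈ S, ∑ y ∈ S, if ∀ l, m l • (x - y) = 0 then (1 : ℝ) else 0) ≤
      k * hU.toFinset.card := by
    intro m hm
    rw [← hSk, ← nsmul_eq_mul]
    refine Finset.sum_le_card_nsmul _ _ _ fun x _ => ?_
    rw [Finset.sum_boole]
    norm_cast
    refine Finset.card_le_card_of_injOn (fun y => x - y) (fun y hy => ?_)
      (sub_right_injective.injOn)
    simp only [Finset.coe_filter, Set.mem_ofPred_eq] at hy
    simpa using ⟨m, hm, hy.2⟩
  have hlim := tendsto_finsetSum M fun m _ => tendsto_mean_normSq_sum_torusMonomial m S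
  have hlt : (∑ m ∈ M, ∑ x ∈ S, ∑ y ∈ S, if ∀ l, m l • (x - y) = 0 then (1 : ℝ) else 0) <
      (δ * k) ^ 2 := by
    calc _ ≤ M.card • ((k : ℝ) * hU.toFinset.card) := Finset.sum_le_card_nsmul _ _ _ hpairs
      _ = k * ((M.card : ℝ) * hU.toFinset.card) := by rw [nsmul_eq_mul]; ring
      _ < k * (k * δ ^ 2) := by gcongr
      _ = (δ * k) ^ 2 := by ring
  obtain ⟨P, hP, hP0⟩ := ((hlim.eventually (gt_mem_nhds hlt)).and (eventually_gt_atTop 0)).exists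
  have hP0' : (0 : ℝ) < P := by exact_mod_cast hP0
  rw [← Finset.mul_sum, Finset.sum_comm] at hP
  by_contra! hcon
  refine absurd hP (not_lt.2 ?_)
  have hsum : ((Fintype.piFinset (fun _ : Fin L => Finset.range P)).card : ℝ) * (δ * k) ^ 2 ≤
      ∑ a ∈ Fintype.piFinset (fun _ : Fin L => Finset.range P), ∑ m ∈ M,
        ‖∑ x ∈ S, torusMonomial m (fun l => a l • x)‖ ^ 2 := by
    rw [← nsmul_eq_mul]
    refine Finset.card_nsmul_le_sum _ _ _ fun a _ => ?_
    obtain ⟨m, hm, hlt⟩ := hcon a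
    rw [hSk] at hlt
    refine le_trans (by gcongr) (Finset.single_le_sum
      (f := fun m => ‖∑ x ∈ S, torusMonomial m (fun l => a l • x)‖ ^ 2)
      (fun _ _ => by positivity) hm)
  have hcard : (Fintype.piFinset (fun _ : Fin L => Finset.range P)).card = P ^ L := by simp
  rw [hcard, Nat.cast_pow] at hsum
  calc (δ * k) ^ 2 = ((P : ℝ)⁻¹) ^ L * ((P : ℝ) ^ L * (δ * k) ^ 2) := by
        rw [← mul_assoc, ← mul_pow, inv_mul_cancel₀ hP0'.ne', one_pow, one_mul]
    _ ≤ _ := by gcongr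

/-- The trigonometric polynomial `∏ (1 + e(u_l))^{2r} e(-r u_l)`, a constant multiple of
`∏ ((1 + cos 2πu_l) / 2)^r`. -/
noncomputable def torusKernel {L : ℕ} (r : ℕ) (u : Fin L → Torus1) : ℂ :=
  ∏ l, (1 + torusChar (u l)) ^ (2 * r) * torusChar (u l) ^ (-(r : ℤ))

theorem torusKernel_eq_sum {L : ℕ} (r : ℕ) (u : Fin L → Torus1) :
    torusKernel r u = ∑ j ∈ Fintype.piFinset (fun _ : Fin L => Finset.range (2 * r + 1)),
      ((∏ l, (2 * r).choose (j l) : ℕ) : ℂ) * torusMonomial (fun l => (j l : ℤ) - r) u := by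
  have h : ∀ l, (1 + torusChar (u l)) ^ (2 * r) * torusChar (u l) ^ (-(r : ℤ)) =
      ∑ n ∈ Finset.range (2 * r + 1),
        ((2 * r).choose n : ℂ) * torusChar (u l) ^ ((n : ℤ) - r) := by
    intro l
    rw [add_comm, add_pow, Finset.sum_mul]
    refine Finset.sum_congr rfl fun n _ => ?_
    rw [sub_eq_add_neg, zpow_add₀ (torusChar_ne_zero _), zpow_natCast]
    ring
  rw [torusKernel, Finset.prod_congr rfl fun l _ => h l, Finset.prod_univ_sum]
  refine Finset.sum_congr rfl fun j _ => ?_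
  rw [Finset.prod_mul_distrib, torusMonomial]
  push_cast
  rfl

theorem norm_torusKernel_le {L : ℕ} (r : ℕ) {u : Fin L → Torus1} {c : ℝ} {l₀ : Fin L}
    (h : ‖1 + torusChar (u l₀)‖ ≤ c) :
    ‖torusKernel r u‖ ≤ (c ^ 2 / 4) ^ r * (4 ^ r) ^ L := by
  have h2 : ∀ x, ‖1 + torusChar x‖ ≤ 2 := fun x => by
    refine (norm_add_le _ _).trans ?_
    rw [norm_one, norm_torusChar]; norm_num
  calc ‖torusKernel r u‖ = ∏ l, ‖1 + torusChar (u l)‖ ^ (2 * r) := by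
        rw [torusKernel, norm_prod]
        refine Finset.prod_congr rfl fun l _ => ?_
        rw [norm_mul, norm_torusChar_zpow, mul_one, norm_pow]
    _ ≤ ∏ l, (if l = l₀ then (c ^ 2 / 4) ^ r else 1) * 4 ^ r := by
        refine Finset.prod_le_prod (fun _ _ => by positivity) fun l _ => ?_
        split_ifs with hl
        · subst hl
          rw [← mul_pow, div_mul_cancel₀ _ (by norm_num), pow_mul]
          gcongr
        · rw [one_mul, pow_mul]
          gcongr
          have := h2 (u l)
          nlinarith [norm_nonneg (1 + torusChar (u l))]
    _ = (c ^ 2 / 4) ^ r * (4 ^ r) ^ L := by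
        rw [Finset.prod_mul_distrib, Finset.prod_ite_eq' Finset.univ l₀]
        simp

open Filter Topology in
theorem exists_pow_mul_four_pow_lt_centralBinom_pow (L : ℕ) {ρ : ℝ} (h0 : 0 ≤ ρ) (h1 : ρ < 1) :
    ∃ r : ℕ, ρ ^ r * (4 ^ r) ^ L < (((2 * r).choose r : ℕ) : ℝ) ^ L := by
  have ht := (tendsto_pow_const_mul_const_pow_of_lt_one L h0 h1).const_mul (3 ^ L : ℝ)
  rw [mul_zero] at ht
  obtain ⟨r, hr, hr1⟩ := ((ht.eventually (gt_mem_nhds one_pos)).and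
    (eventually_ge_atTop 1)).exists
  refine ⟨r, ?_⟩
  have hr1' : (1 : ℝ) ≤ r := by exact_mod_cast hr1
  have hC : (0 : ℝ) < ((2 * r).choose r : ℕ) := by
    exact_mod_cast Nat.choose_pos (by omega)
  have h4 : (4 : ℝ) ^ r ≤ (2 * r + 1) * ((2 * r).choose r : ℕ) := by
    exact_mod_cast Nat.four_pow_le_two_mul_add_one_mul_central_binom r
  calc ρ ^ r * (4 ^ r) ^ L ≤ ρ ^ r * ((3 * r) * ((2 * r).choose r : ℕ)) ^ L := by
        gcongr
        refine h4.trans ?_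
        gcongr
        linarith
    _ = (3 ^ L * (r ^ L * ρ ^ r)) * (((2 * r).choose r : ℕ) : ℝ) ^ L := by
        rw [mul_pow, mul_pow]; ring
    _ < 1 * (((2 * r).choose r : ℕ) : ℝ) ^ L := by gcongr
    _ = _ := one_mul _

/-- An infinite subset of `ℝ/ℤ` has an `ε`-dense image in `𝕋^L` under some
`x ↦ (a_1 x, …, a_L x)`. -/
theorem exists_epsDense_image_nsmul (L : ℕ) {ε : ℝ} (hε : 0 < ε) {X : Set Torus1}
    (hX : X.Infinite) :
    ∃ a : Fin L → ℕ, EpsDense ((fun x : Torus1 => fun l => a l • x) '' X) ε := by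
  obtain ⟨c, hc0, hc2, hc⟩ := exists_norm_one_add_torusChar_le hε
  obtain ⟨r, hr⟩ := exists_pow_mul_four_pow_lt_centralBinom_pow L (ρ := c ^ 2 / 4)
    (by positivity) (by nlinarith)
  set J := Fintype.piFinset (fun _ : Fin L => Finset.range (2 * r + 1)) with hJ
  set w : (Fin L → ℕ) → ℕ := fun j => ∏ l, (2 * r).choose (j l) with hw
  set j₀ : Fin L → ℕ := fun _ => r with hj₀
  set freq : (Fin L → ℕ) → Fin L → ℤ := fun j l => (j l : ℤ) - r with hfreq
  have hj₀J : j₀ ∈ J := by simp [hJ, hj₀]; omega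
  have hwj₀ : (w j₀ : ℝ) = (((2 * r).choose r : ℕ) : ℝ) ^ L := by simp [hw, hj₀]
  set W : ℝ := ∑ j ∈ J.erase j₀, (w j : ℝ) with hW
  have hW0 : 0 ≤ W := Finset.sum_nonneg fun _ _ => by positivity
  obtain ⟨δ, hδ, hδW⟩ : ∃ δ : ℝ, 0 < δ ∧
      (c ^ 2 / 4) ^ r * (4 ^ r) ^ L + δ * W < (((2 * r).choose r : ℕ) : ℝ) ^ L := by
    have hgap := sub_pos.2 hr
    refine ⟨((((2 * r).choose r : ℕ) : ℝ) ^ L - (c ^ 2 / 4) ^ r * (4 ^ r) ^ L) / (W + 1),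
      by positivity, ?_⟩
    rw [div_mul_eq_mul_div, ← lt_sub_iff_add_lt', div_lt_iff₀ (by positivity)]
    nlinarith
  have hM : (0 : Fin L → ℤ) ∉ (J.erase j₀).image freq := by
    rw [Finset.mem_image]
    rintro ⟨j, hj, hj0⟩
    refine Finset.ne_of_mem_erase hj (funext fun l => ?_)
    have := congrFun hj0 l
    simp only [hfreq, Pi.zero_apply] at this
    simp only [hj₀]
    omega
  obtain ⟨S, hSX, hS, a, ha⟩ := exists_sum_torusMonomial_le hX _ hM hδ
  refine ⟨a, fun t => ?_⟩
  by_contra! hcon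
  have hbad : ∀ x ∈ S, ‖torusKernel r ((fun l => a l • x) + -t)‖ ≤
      (c ^ 2 / 4) ^ r * (4 ^ r) ^ L := by
    intro x hx
    obtain ⟨l, hl⟩ := hcon _ ⟨x, hSX hx, rfl⟩
    refine norm_torusKernel_le r (l₀ := l) (hc _ ?_)
    rw [dist_eq_norm] at hl
    simpa [sub_eq_add_neg] using hl.le
  have hexp : ∑ x ∈ S, torusKernel r ((fun l => a l • x) + -t) =
      (w j₀ : ℂ) * S.card + ∑ j ∈ J.erase j₀, (w j : ℂ) *
        ((∑ x ∈ S, torusMonomial (freq j) (fun l => a l • x)) * torusMonomial (freq j) (-t)) := by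
    simp only [torusKernel_eq_sum]
    rw [Finset.sum_comm, ← Finset.add_sum_erase _ _ hj₀J]
    congr 1
    · have : (fun l => (j₀ l : ℤ) - r) = 0 := by funext l; simp [hj₀]
      rw [this]
      simp [torusMonomial, hw, mul_comm]
    · refine Finset.sum_congr rfl fun j _ => ?_
      rw [← Finset.mul_sum, Finset.sum_mul]
      simp only [torusMonomial_add, hw, hfreq]
  have hrest : ‖∑ j ∈ J.erase j₀, (w j : ℂ) *
      ((∑ x ∈ S, torusMonomial (freq j) (fun l => a l • x)) * torusMonomial (freq j) (-t))‖ ≤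
      δ * W * S.card := by
    refine (norm_sum_le _ _).trans ?_
    rw [hW, Finset.mul_sum, Finset.sum_mul]
    refine Finset.sum_le_sum fun j hj => ?_
    rw [norm_mul, norm_mul, norm_torusMonomial, mul_one, Complex.norm_natCast]
    calc (w j : ℝ) * _ ≤ w j * (δ * S.card) := by
          gcongr
          exact ha _ (Finset.mem_image_of_mem _ hj)
      _ = _ := by ring
  have hmain : ‖∑ x ∈ S, torusKernel r ((fun l => a l • x) + -t)‖ ≤
      S.card * ((c ^ 2 / 4) ^ r * (4 ^ r) ^ L) := by
    refine (norm_sum_le _ _).trans ?_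
    rw [← nsmul_eq_mul]
    exact Finset.sum_le_card_nsmul _ _ _ hbad
  have hScard : (0 : ℝ) < S.card := by exact_mod_cast hS.card_pos
  have htri : ‖(w j₀ : ℂ) * S.card‖ ≤
      S.card * ((c ^ 2 / 4) ^ r * (4 ^ r) ^ L) + δ * W * S.card := by
    rw [eq_sub_of_add_eq hexp.symm]
    exact (norm_sub_le _ _).trans (add_le_add hmain hrest)
  rw [norm_mul, Complex.norm_natCast, Complex.norm_natCast, hwj₀] at htri
  nlinarith

/-- **Theorem 1 (high-dimensional Glasner theorem).** For any `ε > 0` and any infinite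
subset `X ⊆ 𝕋^N` there exists a continuous homomorphism `T : 𝕋^N → 𝕋^L` (given by an
`L × N` integer matrix) such that `T X` is `ε`-dense in `𝕋^L`. -/
theorem statement0 (N L : ℕ) (hN : 0 < N) (hL : 0 < L) (ε : ℝ) (hε : 0 < ε)
    (X : Set (Fin N → Torus1)) (hX : X.Infinite) :
    ∃ T : Matrix (Fin L) (Fin N) ℤ, EpsDense (torusAct T '' X) ε := by
  obtain ⟨j, hj⟩ : ∃ j : Fin N, ((fun x : Fin N → Torus1 => x j) '' X).Infinite := by
    by_contra! h
    refine hX ((Set.Finite.pi' h).subset fun x hx j => ?_)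
    exact ⟨x, hx, rfl⟩
  obtain ⟨a, ha⟩ := exists_epsDense_image_nsmul L hε hj
  refine ⟨fun l i => if i = j then (a l : ℤ) else 0, fun t => ?_⟩
  obtain ⟨_, ⟨_, ⟨x, hx, rfl⟩, rfl⟩, h⟩ := ha t
  refine ⟨_, ⟨x, hx, rfl⟩, fun l => ?_⟩
  simpa [torusAct, ite_smul] using h l
end

section
/- Let A(x) ∈ M_{L×N}(ℤ[x]) with A(x) = A_0 + xA_1 + ⋯ + x^D A_D and non-constant part A_*(x) = xA_1 + ⋯ + x^D A_D. Assume (a) the only w ∈ ℚ^N with A_*(x)w identically zero is w = 0, and (b) for all v ∈ ℚ^L and w ∈ ℚ^N, if v·A_d w = 0 for every d = 1, …, D then v·A_0 w = 0. Then for every infinite subset X ⊂ 𝕋^N there exists a subtorus 𝒯 of 𝕋^L such that for every ε > 0 there exists an integer n for which A(n)X = {A(n)x : x ∈ X} is ε-dense in some translate of 𝒯. -/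
open scoped BigOperators
open Matrix

open Filter Topology

/-- The standard character `t ↦ exp (2πit)` of the circle `ℝ/ℤ`. -/
noncomputable def circleChar (t : Torus1) : ℂ := (AddCircle.toCircle t : ℂ)

lemma circleChar_zero : circleChar 0 = 1 := by simp [circleChar]

lemma circleChar_add (s t : Torus1) : circleChar (s + t) = circleChar s * circleChar t := by
  simp [circleChar, AddCircle.toCircle_add]

lemma norm_circleChar (t : Torus1) : ‖circleChar t‖ = 1 := Circle.norm_coe _

lemma circleChar_neg (t : Torus1) : circleChar (-t) = starRingEnd ℂ (circleChar t) := by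
  rw [circleChar, AddCircle.toCircle_neg, Circle.coe_inv_eq_conj, circleChar]

lemma circleChar_sub (s t : Torus1) :
    circleChar (s - t) = circleChar s * starRingEnd ℂ (circleChar t) := by
  rw [sub_eq_add_neg, circleChar_add, circleChar_neg]

lemma circleChar_eq_one {t : Torus1} : circleChar t = 1 ↔ t = 0 := by
  constructor
  · intro h
    apply AddCircle.injective_toCircle (T := 1) one_ne_zero
    apply Subtype.ext
    simpa [circleChar] using h
  · rintro rfl; exact circleChar_zero

lemma continuous_circleChar : Continuous circleChar :=
  continuous_subtype_val.comp AddCircle.continuous_toCircle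

lemma circleChar_sum {ι : Type*} (s : Finset ι) (f : ι → Torus1) :
    circleChar (∑ i ∈ s, f i) = ∏ i ∈ s, circleChar (f i) := by
  classical
  induction s using Finset.induction_on with
  | empty => simp [circleChar_zero]
  | insert a s ha ih => rw [Finset.sum_insert ha, Finset.prod_insert ha, circleChar_add, ih]

lemma circleChar_nsmul (n : ℕ) (t : Torus1) : circleChar (n • t) = circleChar t ^ n := by
  simp [circleChar, AddCircle.toCircle_nsmul]

/-- The average of `f` over the integers `0, …, M - 1`. -/
noncomputable def intAvg (f : ℤ → ℂ) (M : ℕ) : ℂ :=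
  (M : ℂ)⁻¹ * ∑ n ∈ Finset.range M, f n

/-- `c` is the mean of `f` along a fixed nonprincipal ultrafilter of averages. -/
def HasMean (f : ℤ → ℂ) (c : ℂ) : Prop :=
  Tendsto (intAvg f) (hyperfilter ℕ : Filter ℕ) (𝓝 c)

lemma HasMean.unique {f : ℤ → ℂ} {a b : ℂ} (ha : HasMean f a) (hb : HasMean f b) : a = b :=
  tendsto_nhds_unique ha hb

lemma norm_intAvg_le {f : ℤ → ℂ} {C : ℝ} (hC : 0 ≤ C) (hf : ∀ n, ‖f n‖ ≤ C) (M : ℕ) :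
    ‖intAvg f M‖ ≤ C := by
  rcases Nat.eq_zero_or_pos M with rfl | hM
  · simpa [intAvg] using hC
  · rw [intAvg, norm_mul, norm_inv, Complex.norm_natCast, inv_mul_le_iff₀ (by positivity)]
    refine (norm_sum_le _ _).trans ?_
    refine (Finset.sum_le_sum fun (n : ℕ) _ => hf n).trans ?_
    simp

lemma exists_hasMean {f : ℤ → ℂ} {C : ℝ} (hC : 0 ≤ C) (hf : ∀ n, ‖f n‖ ≤ C) :
    ∃ c, HasMean f c := by
  have hK : IsCompact (Metric.closedBall (0 : ℂ) C) := isCompact_closedBall _ _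
  obtain ⟨c, -, hc⟩ := hK.ultrafilter_le_nhds ((hyperfilter ℕ).map (intAvg f)) (by
    rw [le_principal_iff, Ultrafilter.coe_map, mem_map]
    exact univ_mem' fun M => by simpa using norm_intAvg_le hC hf M)
  exact ⟨c, hc⟩

lemma HasMean.sum {ι : Type*} {s : Finset ι} {f : ι → ℤ → ℂ} {c : ι → ℂ}
    (h : ∀ i ∈ s, HasMean (f i) (c i)) :
    HasMean (fun n => ∑ i ∈ s, f i n) (∑ i ∈ s, c i) := by
  have := tendsto_finsetSum s h
  refine this.congr fun M => ?_
  simp only [intAvg]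
  rw [← Finset.mul_sum, Finset.sum_comm]

lemma HasMean.const_mul {f : ℤ → ℂ} {c : ℂ} (a : ℂ) (h : HasMean f c) :
    HasMean (fun n => a * f n) (a * c) := by
  refine (Tendsto.const_mul a h).congr fun M => ?_
  simp only [intAvg]
  rw [← Finset.mul_sum]; ring

lemma tendsto_intAvg_const (a : ℂ) : Tendsto (intAvg fun _ => a) atTop (𝓝 a) := by
  refine tendsto_const_nhds.congr' ?_
  filter_upwards [eventually_gt_atTop 0] with M hM
  have : (M : ℂ) ≠ 0 := by exact_mod_cast hM.ne'
  simp [intAvg, this]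

lemma HasMean.const (a : ℂ) : HasMean (fun _ => a) a :=
  (tendsto_intAvg_const a).mono_left Nat.hyperfilter_le_atTop

lemma HasMean.shift_one {f : ℤ → ℂ} {C : ℝ} {a : ℂ} (hf : ∀ n, ‖f n‖ ≤ C)
    (h : HasMean f a) : HasMean (fun n => f (n + 1)) a := by
  have h0 : Tendsto (fun M : ℕ => (M : ℂ)⁻¹ * (f M - f 0)) atTop (𝓝 0) := by
    refine squeeze_zero_norm (a := fun M : ℕ => (M : ℝ)⁻¹ * (2 * C)) (fun M => ?_) ?_
    · rw [norm_mul, norm_inv, Complex.norm_natCast]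
      gcongr
      refine (norm_sub_le _ _).trans ?_
      linarith [hf M, hf 0]
    · simpa using (tendsto_inv_atTop_nhds_zero_nat (𝕜 := ℝ)).mul_const (2 * C)
  have := h.add (h0.mono_left Nat.hyperfilter_le_atTop)
  rw [add_zero] at this
  refine this.congr fun M => ?_
  simp only [intAvg]
  rw [← mul_add]
  congr 1
  have e := Finset.sum_range_succ (fun n : ℕ => f n) M
  have e' := Finset.sum_range_succ' (fun n : ℕ => f n) M
  push_cast at e e'
  rw [e] at e'
  linear_combination e'

lemma HasMean.shift {f : ℤ → ℂ} {C : ℝ} {a : ℂ} (hC : 0 ≤ C) (hf : ∀ n, ‖f n‖ ≤ C)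
    (h : HasMean f a) (k : ℤ) : HasMean (fun n => f (n + k)) a := by
  induction k using Int.induction_on with
  | zero => simpa using h
  | succ k ih =>
    have := HasMean.shift_one (fun n => hf (n + k)) ih
    convert this using 3
    ring
  | pred k ih =>
    obtain ⟨b, hb⟩ := exists_hasMean (f := fun n => f (n + (-(k : ℤ) - 1))) hC (fun n => hf _)
    have := HasMean.shift_one (fun n => hf (n + (-(k : ℤ) - 1))) hb
    have e : (fun n : ℤ => f (n + 1 + (-(k : ℤ) - 1))) = fun n => f (n + -(k : ℤ)) := by
      funext n; congr 1; ring
    rw [e] at this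
    rwa [ih.unique this]

lemma HasMean.norm_sq_le {f : ℤ → ℂ} {a b : ℂ} (h : HasMean f a)
    (h2 : HasMean (fun n => ((‖f n‖ ^ 2 : ℝ) : ℂ)) b) : ‖a‖ ^ 2 ≤ ‖b‖ := by
  refine le_of_tendsto_of_tendsto (h.norm.pow 2) h2.norm (Eventually.of_forall fun M => ?_)
  simp only [intAvg]
  rcases Nat.eq_zero_or_pos M with rfl | hM
  · simp
  have hM' : (0 : ℝ) < M := by exact_mod_cast hM
  rw [← Complex.ofReal_sum, norm_mul, norm_mul, norm_inv, Complex.norm_natCast, mul_pow,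
    Complex.norm_of_nonneg (Finset.sum_nonneg fun _ _ => by positivity)]
  have h1 : ‖∑ n ∈ Finset.range M, f n‖ ^ 2 ≤ M * ∑ n ∈ Finset.range M, ‖f n‖ ^ 2 := by
    refine (pow_le_pow_left₀ (norm_nonneg _) (norm_sum_le _ _) 2).trans ?_
    simpa using sq_sum_le_card_mul_sum_sq (s := Finset.range M) (f := fun n : ℕ => ‖f n‖)
  calc (M : ℝ)⁻¹ ^ 2 * ‖∑ n ∈ Finset.range M, f n‖ ^ 2
      ≤ (M : ℝ)⁻¹ ^ 2 * (M * ∑ n ∈ Finset.range M, ‖f n‖ ^ 2) := by gcongr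
    _ = (M : ℝ)⁻¹ * ∑ n ∈ Finset.range M, ‖f n‖ ^ 2 := by field_simp

lemma HasMean.exists_lt {g : ℤ → ℝ} {a : ℂ} {η : ℝ} (h : HasMean (fun n => (g n : ℂ)) a)
    (ha : ‖a‖ < η) : ∃ n, g n < η := by
  by_contra! hg
  have h1 : Tendsto (fun M => (intAvg (fun n => (g n : ℂ)) M).re) (hyperfilter ℕ : Filter ℕ)
    (𝓝 a.re) := (Complex.continuous_re.tendsto _).comp h
  have h2 : η ≤ a.re := by
    refine ge_of_tendsto h1 ?_
    have hev : ∀ᶠ M : ℕ in atTop, 0 < M := eventually_gt_atTop 0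
    filter_upwards [Nat.hyperfilter_le_atTop hev] with M hM
    have hM' : (0 : ℝ) < M := by exact_mod_cast hM
    have e : intAvg (fun n => (g n : ℂ)) M
        = (((M : ℝ)⁻¹ * ∑ n ∈ Finset.range M, g n : ℝ) : ℂ) := by
      simp [intAvg]
    rw [e, Complex.ofReal_re, le_inv_mul_iff₀ hM']
    calc (M : ℝ) * η = ∑ n ∈ Finset.range M, η := by simp
      _ ≤ _ := Finset.sum_le_sum fun n _ => hg n
  linarith [Complex.re_le_norm a]

/-- The exponential means of the circle-valued sequence `u` have size at most `δ`. -/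
def SmallMean (δ : ℝ) (u : ℤ → Torus1) : Prop :=
  ∃ c, HasMean (fun n => circleChar (u n)) c ∧ ‖c‖ ≤ δ

/-- If the pairwise differences of the sequences `u i` have small exponential means, then the
mean square of `∑ i, exp (2πi u_i)` is close to the diagonal contribution. -/
lemma exists_hasMean_norm_sq_sum_le {k : ℕ} {δ : ℝ} {u : Fin k → ℤ → Torus1}
    (hu : ∀ i j, i ≠ j → SmallMean δ (fun n => u i n - u j n)) (hδ : 0 ≤ δ) :
    ∃ c, HasMean (fun n => ((‖∑ i, circleChar (u i n)‖ ^ 2 : ℝ) : ℂ)) c ∧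
      ‖c‖ ≤ k + k ^ 2 * δ := by
  have hu' : ∀ i j, ∃ c, HasMean (fun n => circleChar (u i n - u j n)) c ∧
      ‖c‖ ≤ (if i = j then 1 else 0) + δ := by
    intro i j
    by_cases hij : i = j
    · subst hij
      exact ⟨1, by simpa [circleChar_zero] using HasMean.const 1, by simpa using hδ⟩
    · simpa [hij, SmallMean] using hu i j hij
  choose c hc hcδ using hu'
  refine ⟨∑ i, ∑ j, c i j, ?_, ?_⟩
  · have := HasMean.sum (s := Finset.univ) fun i _ =>
      HasMean.sum (s := Finset.univ) fun j _ => hc i j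
    convert this using 2 with n
    rw [Complex.ofReal_pow, ← Complex.mul_conj', map_sum, Finset.sum_mul_sum]
    simp only [circleChar_sub]
  · calc ‖∑ i, ∑ j, c i j‖ ≤ ∑ i, ∑ j, ‖c i j‖ :=
        (norm_sum_le _ _).trans (Finset.sum_le_sum fun i _ => norm_sum_le _ _)
      _ ≤ ∑ i : Fin k, ∑ j : Fin k, ((if i = j then 1 else 0) + δ) :=
        Finset.sum_le_sum fun i _ => Finset.sum_le_sum fun j _ => hcδ i j
      _ = k + k ^ 2 * δ := by
        simp [Finset.sum_add_distrib]; ring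

/-- `u` is a polynomial sequence of degree at most `D` whose iterated differences of order `D`
(with steps `h₁, …, h_D`) are constantly `(h₁ ⋯ h_D) • θ`. -/
def IsPolySeq : ℕ → Torus1 → (ℤ → Torus1) → Prop
  | 0, θ, u => ∀ n, u n = θ
  | D + 1, θ, u => ∀ h : ℤ, IsPolySeq D (h • θ) (fun n => u (n + h) - u n)

lemma IsPolySeq.add {D : ℕ} : ∀ {θ θ' : Torus1} {u v : ℤ → Torus1}, IsPolySeq D θ u →
    IsPolySeq D θ' v → IsPolySeq D (θ + θ') (fun n => u n + v n) := by
  induction D with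
  | zero => intro θ θ' u v hu hv n; simp [hu n, hv n]
  | succ D ih =>
    intro θ θ' u v hu hv h
    rw [smul_add]
    convert ih (hu h) (hv h) using 2
    exact add_sub_add_comm _ _ _ _

lemma isPolySeq_zero (D : ℕ) : IsPolySeq D 0 (fun _ => 0) := by
  induction D with
  | zero => intro n; rfl
  | succ D ih => intro h; simpa using ih

lemma IsPolySeq.sum {D : ℕ} {ι : Type*} {s : Finset ι} {θ : ι → Torus1} {u : ι → ℤ → Torus1}
    (h : ∀ i ∈ s, IsPolySeq D (θ i) (u i)) :
    IsPolySeq D (∑ i ∈ s, θ i) (fun n => ∑ i ∈ s, u i n) := by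
  classical
  induction s using Finset.induction_on with
  | empty => simpa using isPolySeq_zero D
  | insert a s ha ih =>
    simp only [Finset.sum_insert ha]
    exact (h a (by simp)).add (ih fun i hi => h i (by simp [hi]))

lemma IsPolySeq.succ {D : ℕ} : ∀ {θ : Torus1} {u : ℤ → Torus1}, IsPolySeq D θ u →
    IsPolySeq (D + 1) 0 u := by
  induction D with
  | zero => intro θ u hu h n; simp [hu n, hu (n + h)]
  | succ D ih =>
    intro θ u hu h
    rw [smul_zero]
    exact ih (hu h)

lemma IsPolySeq.of_lt {D E : ℕ} {θ : Torus1} {u : ℤ → Torus1} (hu : IsPolySeq D θ u)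
    (h : D < E) : IsPolySeq E 0 u := by
  induction E, h using Nat.le_induction with
  | base => exact hu.succ
  | succ E _ ih => exact ih.succ

lemma isPolySeq_pow_zsmul (d : ℕ) (α : Torus1) :
    IsPolySeq d (d.factorial • α) (fun n => n ^ d • α) := by
  induction d using Nat.strong_induction_on generalizing α with
  | _ d ih =>
    rcases d with _ | d
    · intro n; simp
    · intro h
      have key : ∀ n : ℤ, (n + h) ^ (d + 1) • α - n ^ (d + 1) • α =
          ∑ j ∈ Finset.range d, n ^ j • ((h ^ (d + 1 - j) * (d + 1).choose j) • α) +
            n ^ d • ((h * (d + 1 : ℕ)) • α) := by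
        intro n
        rw [← sub_smul, add_pow, Finset.sum_range_succ, Finset.sum_range_succ]
        simp only [smul_smul, ← Finset.sum_smul, ← add_smul]
        congr 1
        simp [mul_assoc]
      simp only [key]
      have hs := IsPolySeq.sum (D := d) (s := Finset.range d) (θ := fun _ => 0)
        (u := fun j n => n ^ j • ((h ^ (d + 1 - j) * (d + 1).choose j) • α)) fun j hj =>
        (ih j (by have := Finset.mem_range.1 hj; omega) _).of_lt (Finset.mem_range.1 hj)
      have := hs.add (ih d (by omega) ((h * (d + 1 : ℕ)) • α))
      convert this using 1
      rw [Finset.sum_const_zero, zero_add, Nat.factorial_succ, ← natCast_zsmul, ← natCast_zsmul,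
        smul_smul, smul_smul]
      congr 1
      push_cast; ring

/-- A soft Weyl inequality: polynomial sequences whose leading coefficient is not torsion of small
order have small exponential means. -/
lemma exists_smallMean_of_isPolySeq (D : ℕ) : ∀ δ : ℝ, 0 < δ → ∃ Q : ℕ, ∀ (θ : Torus1)
    (u : ℤ → Torus1), IsPolySeq (D + 1) θ u →
    (∀ q : ℤ, q ≠ 0 → |q| ≤ Q → q • θ ≠ 0) → SmallMean δ u := by
  induction D with
  | zero =>
    intro δ hδ
    refine ⟨1, fun θ u hu hθ => ?_⟩
    have hb : ∀ n, ‖circleChar (u n)‖ ≤ 1 := fun n => (norm_circleChar _).le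
    obtain ⟨c, hc⟩ := exists_hasMean zero_le_one hb
    refine ⟨c, hc, ?_⟩
    have h1 := hc.shift zero_le_one hb 1
    have h2 : HasMean (fun n => circleChar (u (n + 1))) (circleChar θ * c) := by
      convert hc.const_mul (circleChar θ) using 2 with n
      rw [← circleChar_add, sub_eq_iff_eq_add.1 (hu 1 n), one_smul]
    have h3 := h1.unique h2
    have h4 : circleChar θ ≠ 1 := by
      rw [Ne, circleChar_eq_one]
      simpa using hθ 1 one_ne_zero (by simp)
    have h5 : (circleChar θ - 1) * c = 0 := by linear_combination -h3
    rcases mul_eq_zero.1 h5 with h | h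
    · exact absurd (sub_eq_zero.1 h) h4
    · simpa [h] using hδ.le
  | succ D ih =>
    intro δ hδ
    obtain ⟨Q, hQ⟩ := ih (δ ^ 2 / 2) (by positivity)
    obtain ⟨H, hH⟩ := exists_nat_gt (2 / δ ^ 2)
    have hH0 : (0 : ℝ) < H := lt_trans (by positivity) hH
    refine ⟨Q * H, fun θ u hu hθ => ?_⟩
    have hb : ∀ n, ‖circleChar (u n)‖ ≤ 1 := fun n => (norm_circleChar _).le
    obtain ⟨c, hc⟩ := exists_hasMean zero_le_one hb
    refine ⟨c, hc, ?_⟩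
    have hpair : ∀ i j : Fin H, i ≠ j →
        SmallMean (δ ^ 2 / 2) (fun n => u (n + (i : ℕ)) - u (n + (j : ℕ))) := by
      intro i j hij
      have hne : ((i : ℕ) : ℤ) - (j : ℕ) ≠ 0 := by
        intro h; apply hij; apply Fin.ext; omega
      obtain ⟨a, ha, ha'⟩ := hQ _ _ (hu (((i : ℕ) : ℤ) - (j : ℕ))) (by
        intro q hq hqQ
        rw [smul_smul]
        apply hθ _ (mul_ne_zero hq hne)
        rw [abs_mul]
        push_cast
        have : |((i : ℕ) : ℤ) - (j : ℕ)| ≤ H := by rw [abs_le]; omega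
        exact mul_le_mul hqQ this (abs_nonneg _) (by positivity))
      refine ⟨a, ?_, ha'⟩
      have := ha.shift zero_le_one (fun n => (norm_circleChar _).le) (j : ℕ)
      convert this using 5 with n
      ring
    obtain ⟨b, hb1, hb2⟩ := exists_hasMean_norm_sq_sum_le hpair (by positivity)
    have hsum := HasMean.sum (s := Finset.univ) fun (i : Fin H) _ =>
      hc.shift zero_le_one hb (i : ℕ)
    have hcs := hsum.norm_sq_le hb1
    simp only [Finset.sum_const, Finset.card_univ, Fintype.card_fin, nsmul_eq_mul, norm_mul,
      Complex.norm_natCast, mul_pow] at hcs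
    have h1 : (H : ℝ) ^ 2 * ‖c‖ ^ 2 ≤ H + H ^ 2 * (δ ^ 2 / 2) := hcs.trans hb2
    have h2 : (H : ℝ) ≤ H ^ 2 * (δ ^ 2 / 2) := by
      rw [div_lt_iff₀ (by positivity)] at hH
      nlinarith
    have h3 : (H : ℝ) ^ 2 * ‖c‖ ^ 2 ≤ H ^ 2 * δ ^ 2 := by nlinarith
    have h4 := le_of_mul_le_mul_left h3 (by positivity)
    exact le_of_sq_le_sq h4 hδ.le

/-- The pairing `m · t = ∑ l, m l • t l` of an integer vector with a point of the torus. -/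
def torusPairing {L : ℕ} (m : Fin L → ℤ) (t : Fin L → Torus1) : Torus1 := ∑ l, m l • t l

lemma norm_one_add_circleChar_div_two_le (t : Torus1) : ‖(1 + circleChar t) / 2‖ ≤ 1 := by
  rw [norm_div, Complex.norm_two, div_le_one two_pos]
  refine (norm_add_le _ _).trans ?_
  rw [norm_circleChar, norm_one]; norm_num

lemma norm_one_add_circleChar_div_two_lt {t : Torus1} (ht : t ≠ 0) :
    ‖(1 + circleChar t) / 2‖ < 1 := by
  refine lt_of_le_of_ne (norm_one_add_circleChar_div_two_le t) fun h => ht ?_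
  rw [norm_div, Complex.norm_two, div_eq_one_iff_eq two_ne_zero] at h
  rw [← circleChar_eq_one]
  have h1 : ‖(1 : ℂ) + circleChar t‖ = ‖(1 : ℂ)‖ + ‖circleChar t‖ := by
    rw [h, norm_circleChar, norm_one]; norm_num
  have h2 := (sameRay_iff_norm_add.2 h1).eq_of_norm_eq (by simp [norm_circleChar])
  exact h2.symm

lemma exists_norm_one_add_circleChar_div_two_le {ε : ℝ} (hε : 0 < ε) :
    ∃ ρ : ℝ, 0 ≤ ρ ∧ ρ < 1 ∧ ∀ t : Torus1, ε < ‖t‖ → ‖(1 + circleChar t) / 2‖ ≤ ρ := by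
  have hK : IsCompact {t : Torus1 | ε ≤ ‖t‖} := (isClosed_le continuous_const continuous_norm).isCompact
  have hcont : Continuous fun t : Torus1 => ‖(1 + circleChar t) / 2‖ := by
    have := continuous_circleChar
    fun_prop
  by_cases hne : {t : Torus1 | ε ≤ ‖t‖}.Nonempty
  · obtain ⟨t₀, ht₀, hmax⟩ := hK.exists_isMaxOn hne hcont.continuousOn
    refine ⟨_, norm_nonneg _, norm_one_add_circleChar_div_two_lt (t := t₀) ?_,
      fun t ht => hmax (le_of_lt ht : ε ≤ ‖t‖)⟩
    rintro rfl
    simp only [Set.mem_ofPred_eq, norm_zero] at ht₀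
    linarith
  · refine ⟨0, le_rfl, one_pos, fun t ht => (hne ⟨t, ?_⟩).elim⟩
    exact le_of_lt ht

/-- The trigonometric polynomial `∏ l, ((1 + exp (2πi t_l)) / 2) ^ r` has nonnegative
coefficients. -/
lemma prod_one_add_circleChar_pow {L : ℕ} (r : ℕ) (t : Fin L → Torus1) :
    ∑ j ∈ Fintype.piFinset (fun _ : Fin L => Finset.range (r + 1)),
      ((∏ l, ((r.choose (j l) : ℝ) / 2 ^ r) : ℝ) : ℂ) *
        circleChar (torusPairing (fun l => (j l : ℤ)) t) =
      ∏ l, ((1 + circleChar (t l)) / 2) ^ r := by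
  have h : ∀ l, ((1 + circleChar (t l)) / 2) ^ r = ∑ j ∈ Finset.range (r + 1),
      (((r.choose j : ℝ) / 2 ^ r : ℝ) : ℂ) * circleChar (t l) ^ j := by
    intro l
    rw [div_pow, add_comm, add_pow, Finset.sum_div]
    refine Finset.sum_congr rfl fun j _ => ?_
    push_cast
    rw [one_pow]; ring
  simp_rw [h]
  rw [Finset.prod_univ_sum]
  refine Finset.sum_congr rfl fun j _ => ?_
  rw [Finset.prod_mul_distrib, Complex.ofReal_prod, torusPairing, circleChar_sum]
  congr 1
  refine Finset.prod_congr rfl fun l _ => ?_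
  rw [natCast_zsmul, circleChar_nsmul]

/-- There is a trigonometric polynomial with nonnegative coefficients whose square modulus away
from the origin is smaller than its mean square. -/
lemma exists_trigPoly_norm_sq_le (L : ℕ) {ε : ℝ} (hε : 0 < ε) :
    ∃ (J : Finset (Fin L → ℕ)) (β : (Fin L → ℕ) → ℝ) (κ : ℝ), (∀ j, 0 ≤ β j) ∧
      κ < ∑ j ∈ J, β j ^ 2 ∧ ∀ t : Fin L → Torus1, (∃ l, ε < ‖t l‖) →
        ‖∑ j ∈ J, (β j : ℂ) * circleChar (torusPairing (fun l => (j l : ℤ)) t)‖ ^ 2 ≤ κ := by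
  obtain ⟨ρ, hρ0, hρ1, hρ⟩ := exists_norm_one_add_circleChar_div_two_le hε
  have hlim := (tendsto_pow_const_mul_const_pow_of_abs_lt_one L
    (r := ρ) (by rwa [abs_of_nonneg hρ0])).comp (tendsto_add_atTop_nat 1)
  obtain ⟨r, hr⟩ := (hlim.eventually_lt_const (by
    show (0 : ℝ) < 1 / 2; norm_num)).exists_forall_of_atTop
  obtain ⟨r, hr, hr1⟩ : ∃ r : ℕ, (((r + 1 : ℕ) : ℝ) ^ L * ρ ^ (r + 1)) < 1 ∧ 1 ≤ r :=
    ⟨r + 1, by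
      have := hr (r + 1) (by omega)
      simp only [Function.comp] at this
      linarith, by omega⟩
  set J := Fintype.piFinset (fun _ : Fin L => Finset.range (r + 1)) with hJ
  refine ⟨J, fun j => ∏ l, ((r.choose (j l) : ℝ) / 2 ^ r), (ρ ^ r) ^ 2,
    fun j => Finset.prod_nonneg fun l _ => by positivity, ?_, fun t ht => ?_⟩
  · have hsum : ∑ j ∈ J, ∏ l, ((r.choose (j l) : ℝ) / 2 ^ r) = 1 := by
      have := prod_one_add_circleChar_pow (L := L) r 0
      simp only [torusPairing, Pi.zero_apply, smul_zero, Finset.sum_const_zero, circleChar_zero,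
        mul_one] at this
      have e : ((1 : ℂ) + 1) / 2 = 1 := by norm_num
      simp only [e, one_pow, Finset.prod_const_one] at this
      exact_mod_cast this
    have hcs := sq_sum_le_card_mul_sum_sq (s := J)
      (f := fun j => ∏ l, ((r.choose (j l) : ℝ) / 2 ^ r))
    rw [hsum] at hcs
    have hcard : (J.card : ℝ) = ((r + 1 : ℕ) : ℝ) ^ L := by
      rw [hJ, Fintype.card_piFinset]; simp
    rw [hcard] at hcs
    have hpos : (0 : ℝ) < ((r + 1 : ℕ) : ℝ) ^ L := by positivity
    have h1 : (ρ ^ r) ^ 2 ≤ ρ ^ (r + 1) := by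
      rw [← pow_mul]
      exact pow_le_pow_of_le_one hρ0 hρ1.le (by omega)
    have h2 : ((r + 1 : ℕ) : ℝ) ^ L * (ρ ^ r) ^ 2 < 1 :=
      lt_of_le_of_lt (mul_le_mul_of_nonneg_left h1 hpos.le) hr
    rw [one_pow] at hcs
    have h3 := h2.trans_le hcs
    exact lt_of_mul_lt_mul_left h3 hpos.le
  · obtain ⟨l, hl⟩ := ht
    rw [prod_one_add_circleChar_pow, Finset.prod_pow, norm_pow]
    gcongr
    rw [norm_prod, ← Finset.mul_prod_erase _ _ (Finset.mem_univ l)]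
    refine (mul_le_of_le_one_right (norm_nonneg _) ?_).trans (hρ _ hl)
    exact Finset.prod_le_one (fun _ _ => norm_nonneg _)
      fun i _ => norm_one_add_circleChar_div_two_le _

section TorusPairing

variable {L : ℕ}

lemma torusPairing_add_left (m m' : Fin L → ℤ) (t : Fin L → Torus1) :
    torusPairing (m + m') t = torusPairing m t + torusPairing m' t := by
  simp [torusPairing, add_smul, Finset.sum_add_distrib]

lemma torusPairing_zero_left (t : Fin L → Torus1) : torusPairing 0 t = 0 := by
  simp [torusPairing]

lemma torusPairing_smul_left (k : ℤ) (m : Fin L → ℤ) (t : Fin L → Torus1) :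
    torusPairing (k • m) t = k • torusPairing m t := by
  simp [torusPairing, mul_smul, Finset.smul_sum]

lemma torusPairing_sum_left {ι : Type*} (s : Finset ι) (m : ι → Fin L → ℤ) (t : Fin L → Torus1) :
    torusPairing (∑ i ∈ s, m i) t = ∑ i ∈ s, torusPairing (m i) t := by
  classical
  induction s using Finset.induction_on with
  | empty => simp [torusPairing_zero_left]
  | insert a s ha ih => rw [Finset.sum_insert ha, Finset.sum_insert ha, torusPairing_add_left, ih]

lemma torusPairing_add_right (m : Fin L → ℤ) (s t : Fin L → Torus1) :
    torusPairing m (s + t) = torusPairing m s + torusPairing m t := by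
  simp [torusPairing, Finset.sum_add_distrib]

lemma torusPairing_neg_right (m : Fin L → ℤ) (t : Fin L → Torus1) :
    torusPairing m (-t) = -torusPairing m t := by
  simp [torusPairing]

lemma torusPairing_sub_right (m : Fin L → ℤ) (s t : Fin L → Torus1) :
    torusPairing m (s - t) = torusPairing m s - torusPairing m t := by
  rw [sub_eq_add_neg, torusPairing_add_right, torusPairing_neg_right, sub_eq_add_neg]

lemma torusPairing_sub_left (m m' : Fin L → ℤ) (t : Fin L → Torus1) :
    torusPairing (m - m') t = torusPairing m t - torusPairing m' t := by
  simp [torusPairing, sub_smul, Finset.sum_sub_distrib]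

lemma torusPairing_single (l : Fin L) (t : Fin L → Torus1) :
    torusPairing (Pi.single l 1) t = t l := by
  rw [torusPairing, Finset.sum_eq_single l] <;> simp +contextual

lemma continuous_torusPairing (m : Fin L → ℤ) : Continuous (torusPairing m) := by
  unfold torusPairing
  fun_prop

lemma torusPairing_torusAct {N : ℕ} (m : Fin L → ℤ) (B : Matrix (Fin L) (Fin N) ℤ)
    (x : Fin N → Torus1) : torusPairing m (torusAct B x) = torusPairing (m ᵥ* B) x := by
  simp only [torusPairing, torusAct, vecMul, dotProduct, Finset.smul_sum, Finset.sum_smul,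
    smul_smul]
  exact Finset.sum_comm

lemma torusPairing_torusAct_evalMat {N D : ℕ} (A : Fin (D + 1) → Matrix (Fin L) (Fin N) ℤ)
    (m : Fin L → ℤ) (n : ℤ) (x : Fin N → Torus1) :
    torusPairing m (torusAct (evalMat A n) x) =
      ∑ d : Fin (D + 1), n ^ (d : ℕ) • torusPairing (m ᵥ* A d) x := by
  rw [torusPairing_torusAct, evalMat, Matrix.vecMul_sum, torusPairing_sum_left]
  refine Finset.sum_congr rfl fun d _ => ?_
  rw [Matrix.vecMul_smul, torusPairing_smul_left]

lemma torusPairing_coe (m : Fin L → ℤ) (v : Fin L → ℝ) :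
    torusPairing m (fun l => (v l : Torus1)) = ((∑ l, m l * v l : ℝ) : Torus1) := by
  simp only [torusPairing]
  rw [← QuotientAddGroup.mk'_apply, map_sum]
  refine Finset.sum_congr rfl fun l _ => ?_
  rw [← zsmul_eq_mul, map_zsmul]; rfl

/-- The closed subgroup of the torus annihilated by a group of integer vectors. -/
def torusAnnihilator (H : Submodule ℤ (Fin L → ℤ)) : AddSubgroup (Fin L → Torus1) where
  carrier := {t | ∀ m ∈ H, torusPairing m t = 0}
  zero_mem' := fun m _ => by simp [torusPairing]
  add_mem' := fun hs ht m hm => by rw [torusPairing_add_right, hs m hm, ht m hm, add_zero]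
  neg_mem' := fun ht m hm => by rw [torusPairing_neg_right, ht m hm, neg_zero]

lemma mem_torusAnnihilator {H : Submodule ℤ (Fin L → ℤ)} {t : Fin L → Torus1} :
    t ∈ torusAnnihilator H ↔ ∀ m ∈ H, torusPairing m t = 0 := Iff.rfl

lemma free_quotient_of_saturated {H : Submodule ℤ (Fin L → ℤ)}
    (hH : ∀ (k : ℤ) (m : Fin L → ℤ), k ≠ 0 → k • m ∈ H → m ∈ H) :
    Module.Free ℤ ((Fin L → ℤ) ⧸ H) := by
  have : Module.IsTorsionFree ℤ ((Fin L → ℤ) ⧸ H) := by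
    refine .of_smul_eq_zero fun k q hkq => ?_
    obtain ⟨m, rfl⟩ := Submodule.Quotient.mk_surjective H q
    rw [← Submodule.Quotient.mk_smul, Submodule.Quotient.mk_eq_zero] at hkq
    rw [Submodule.Quotient.mk_eq_zero]
    by_cases hk : k = 0
    · exact Or.inl hk
    · exact Or.inr (hH k m hk hkq)
  infer_instance

lemma sum_mul_apply_single {R : Type*} [AddCommGroup R] (f : (Fin L → ℤ) →ₗ[ℤ] R)
    (m : Fin L → ℤ) : ∑ l, m l • f (Pi.single l 1) = f m := by
  conv_rhs => rw [pi_eq_sum_univ' m, map_sum]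
  refine Finset.sum_congr rfl fun l _ => ?_
  rw [← map_smul]

/-- A point annihilated by a saturated group of integer vectors lifts to a real vector orthogonal
to that group. -/
lemma exists_real_lift {H : Submodule ℤ (Fin L → ℤ)}
    (hH : ∀ (k : ℤ) (m : Fin L → ℤ), k ≠ 0 → k • m ∈ H → m ∈ H) {t : Fin L → Torus1}
    (ht : t ∈ torusAnnihilator H) :
    ∃ v : Fin L → ℝ, (∀ m ∈ H, ∑ l, (m l : ℝ) * v l = 0) ∧ ∀ l, (v l : Torus1) = t l := by
  have := free_quotient_of_saturated hH
  let χ : (Fin L → ℤ) →ₗ[ℤ] Torus1 :=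
    { toFun := fun m => torusPairing m t
      map_add' := fun m m' => torusPairing_add_left m m' t
      map_smul' := fun k m => torusPairing_smul_left k m t }
  let χ' : ((Fin L → ℤ) ⧸ H) →ₗ[ℤ] Torus1 := H.liftQ χ ht
  let π : ℝ →ₗ[ℤ] Torus1 :=
    (QuotientAddGroup.mk' (AddSubgroup.zmultiples (1 : ℝ))).toIntLinearMap
  have hπ : Function.Surjective π := QuotientAddGroup.mk'_surjective _
  obtain ⟨g, hg⟩ := Module.projective_lifting_property π χ' hπ
  refine ⟨fun l => g (H.mkQ (Pi.single l 1)), fun m hm => ?_, fun l => ?_⟩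
  · have h1 := sum_mul_apply_single (g ∘ₗ H.mkQ) m
    have h2 : H.mkQ m = 0 := by simpa using hm
    simpa [h2] using h1
  · have h1 := LinearMap.congr_fun hg (H.mkQ (Pi.single l 1))
    have h2 : χ' (H.mkQ (Pi.single l 1)) = t l := torusPairing_single l t
    rw [h2] at h1
    exact h1

lemma torusAnnihilator_ne_bot {H : Submodule ℤ (Fin L → ℤ)}
    (hH : ∀ (k : ℤ) (m : Fin L → ℤ), k ≠ 0 → k • m ∈ H → m ∈ H) (hne : H ≠ ⊤) :
    torusAnnihilator H ≠ ⊥ := by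
  have := free_quotient_of_saturated hH
  obtain ⟨m, hm⟩ : ∃ m, m ∉ H := by
    by_contra! h
    exact hne (Submodule.eq_top_iff'.2 h)
  have hm' : H.mkQ m ≠ 0 := by simpa using hm
  obtain ⟨g, hg⟩ : ∃ g : ((Fin L → ℤ) ⧸ H) →ₗ[ℤ] ℤ, g (H.mkQ m) ≠ 0 := by
    by_contra! h
    exact hm' ((Module.forall_dual_apply_eq_zero_iff ℤ _).1 h)
  set f := g ∘ₗ H.mkQ with hf
  set c : ℝ := (f m : ℝ) with hc
  have hc0 : c ≠ 0 := by rw [hc]; exact_mod_cast hg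
  have key : ∀ m', torusPairing m' (fun l => ((f (Pi.single l 1) / (2 * c) : ℝ) : Torus1)) =
      ((f m' / (2 * c) : ℝ) : Torus1) := by
    intro m'
    rw [torusPairing_coe, ← sum_mul_apply_single f m']
    congr 1
    push_cast
    rw [Finset.sum_div]
    refine Finset.sum_congr rfl fun l _ => ?_
    simp [mul_div_assoc]
  intro hbot
  have hmem : (fun l => ((f (Pi.single l 1) / (2 * c) : ℝ) : Torus1)) ∈ torusAnnihilator H := by
    intro m' hm'
    have : f m' = 0 := by
      have h0 : H.mkQ m' = 0 := by simpa using hm'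
      rw [hf, LinearMap.comp_apply, h0, map_zero]
    rw [key, this]; simp
  rw [hbot, AddSubgroup.mem_bot] at hmem
  have h1 := key m
  rw [hmem] at h1
  have h2 : ((f m : ℝ) / (2 * c)) = 1 / 2 := by rw [← hc]; field_simp
  rw [h2] at h1
  have h3 : (((1 / 2 : ℝ)) : Torus1) = 0 := by rw [← h1]; simp [torusPairing]
  rw [AddCircle.coe_eq_zero_iff] at h3
  obtain ⟨n, hn⟩ := h3
  have h4 : (2 * n : ℤ) = 1 := by
    have : (2 * n : ℝ) = 1 := by
      simp only [zsmul_eq_mul, mul_one] at hn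
      rw [hn]; norm_num
    exact_mod_cast this
  omega

lemma isSubtorus_torusAnnihilator {H : Submodule ℤ (Fin L → ℤ)}
    (hH : ∀ (k : ℤ) (m : Fin L → ℤ), k ≠ 0 → k • m ∈ H → m ∈ H) (hne : H ≠ ⊤) :
    IsSubtorus (torusAnnihilator H) := by
  refine ⟨?_, ?_, torusAnnihilator_ne_bot hH hne⟩
  · have : ((torusAnnihilator H : AddSubgroup _) : Set (Fin L → Torus1)) =
        ⋂ m ∈ H, torusPairing m ⁻¹' {0} := by
      ext t; simp [mem_torusAnnihilator]
    rw [this]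
    exact isClosed_biInter fun m _ => isClosed_singleton.preimage (continuous_torusPairing m)
  · have : ((torusAnnihilator H : AddSubgroup _) : Set (Fin L → Torus1)) =
        (fun (v : Fin L → ℝ) l => (v l : Torus1)) ''
          {v | ∀ m ∈ H, ∑ l, (m l : ℝ) * v l = 0} := by
      ext t
      constructor
      · intro ht
        obtain ⟨v, hv, hvt⟩ := exists_real_lift hH ht
        exact ⟨v, hv, funext hvt⟩
      · rintro ⟨v, hv, rfl⟩ m hm
        show torusPairing m (fun l => (v l : Torus1)) = 0
        rw [torusPairing_coe, hv m hm]; simp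
    rw [this]
    have hconv : Convex ℝ {v : Fin L → ℝ | ∀ m ∈ H, ∑ l, (m l : ℝ) * v l = 0} := by
      intro v hv w hw a b _ _ _ m hm
      have : ∑ l, (m l : ℝ) * (a • v + b • w) l =
          a * ∑ l, (m l : ℝ) * v l + b * ∑ l, (m l : ℝ) * w l := by
        rw [Finset.mul_sum, Finset.mul_sum, ← Finset.sum_add_distrib]
        refine Finset.sum_congr rfl fun l _ => ?_
        simp; ring
      rw [this, hv m hm, hw m hm]; simp
    refine (hconv.isConnected ⟨0, fun m _ => by simp⟩).image _ (Continuous.continuousOn ?_)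
    exact continuous_pi fun l => (AddCircle.continuous_mk' 1).comp (continuous_apply l)

end TorusPairing

/-- An integer vector vanishing on the common rational kernel of finitely many integer vectors has
a nonzero multiple which is an integer combination of them. -/
lemma exists_smul_eq_sum_of_ker_le {N : ℕ} {ι : Type*} [Fintype ι] (R : ι → Fin N → ℤ)
    (r : Fin N → ℤ)
    (h : ∀ w : Fin N → ℚ, (∀ i, ∑ j, (R i j : ℚ) * w j = 0) → ∑ j, (r j : ℚ) * w j = 0) :
    ∃ k : ℤ, k ≠ 0 ∧ ∃ c : ι → ℤ, k • r = ∑ i, c i • R i := by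
  let φ : (Fin N → ℤ) → ((Fin N → ℚ) →ₗ[ℚ] ℚ) := fun s =>
    ∑ j, (s j : ℚ) • (LinearMap.proj j : (Fin N → ℚ) →ₗ[ℚ] ℚ)
  have hφ : ∀ s w, φ s w = ∑ j, (s j : ℚ) * w j := fun s w => by simp [φ]
  have hφs : ∀ s j, φ s (Pi.single j 1) = s j := fun s j => by
    rw [hφ, Finset.sum_eq_single j] <;> simp +contextual
  have hspan : φ r ∈ Submodule.span ℚ (Set.range fun i => φ (R i)) := by
    refine mem_span_of_iInf_ker_le_ker fun w hw => ?_
    rw [LinearMap.mem_ker, hφ]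
    refine h w fun i => ?_
    rw [Submodule.mem_iInf] at hw
    rw [← hφ]; exact hw i
  obtain ⟨c, hc⟩ := (Submodule.mem_span_range_iff_exists_fun ℚ).1 hspan
  obtain ⟨b, hb⟩ := IsLocalization.exist_integer_multiples_of_finite (nonZeroDivisors ℤ) c
  choose a ha using hb
  refine ⟨b, nonZeroDivisors.ne_zero b.2, a, funext fun j => ?_⟩
  have h1 := LinearMap.congr_fun hc (Pi.single j 1)
  rw [hφs, LinearMap.sum_apply] at h1
  simp only [LinearMap.smul_apply, hφs, smul_eq_mul] at h1
  simp only [eq_intCast, zsmul_eq_mul] at ha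
  have h2 : (((b : ℤ) * r j : ℤ) : ℚ) = ((∑ i, a i * R i j : ℤ) : ℚ) := by
    push_cast
    rw [← h1, Finset.mul_sum]
    refine Finset.sum_congr rfl fun i _ => ?_
    rw [ha, mul_assoc]
  have h3 : (b : ℤ) * r j = ∑ i, a i * R i j := by exact_mod_cast h2
  simpa using h3

section Ultrafilter

variable {N : ℕ}

/-- The integer vectors `r` such that `x ↦ r · x` is constant along the ultrafilter `U`. -/
def constSubmodule (U : Ultrafilter (Fin N → Torus1)) : Submodule ℤ (Fin N → ℤ) where
  carrier := {r | ∃ c, ∀ᶠ x in U, torusPairing r x = c}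
  zero_mem' := ⟨0, Eventually.of_forall torusPairing_zero_left⟩
  add_mem' := by
    rintro r s ⟨a, ha⟩ ⟨b, hb⟩
    refine ⟨a + b, ?_⟩
    filter_upwards [ha, hb] with x hx hy
    rw [torusPairing_add_left, hx, hy]
  smul_mem' := by
    rintro k r ⟨a, ha⟩
    refine ⟨k • a, ?_⟩
    filter_upwards [ha] with x hx
    rw [torusPairing_smul_left, hx]

lemma mem_constSubmodule {U : Ultrafilter (Fin N → Torus1)} {r : Fin N → ℤ} :
    r ∈ constSubmodule U ↔ ∃ c, ∀ᶠ x in U, torusPairing r x = c := Iff.rfl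

lemma finite_zsmul_eq {k : ℤ} (hk : k ≠ 0) (c : Torus1) : {u : Torus1 | k • u = c}.Finite := by
  have h0 : {u : Torus1 | k • u = 0}.Finite := by
    refine (AddCircle.finite_torsion (1 : ℝ) (Int.natAbs_pos.2 hk)).subset fun u hu => ?_
    exact natAbs_nsmul_eq_zero.2 hu
  by_cases hne : ∃ u₀ : Torus1, k • u₀ = c
  · obtain ⟨u₀, rfl⟩ := hne
    refine (h0.image (fun u => u + u₀)).subset fun u hu => ⟨u - u₀, ?_, by simp⟩
    have hu' : k • u = k • u₀ := hu
    show k • (u - u₀) = 0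
    rw [smul_sub, hu', sub_self]
  · convert Set.finite_empty
    ext u
    simpa using fun h => hne ⟨u, h⟩

lemma mem_constSubmodule_of_zsmul_mem {U : Ultrafilter (Fin N → Torus1)} {k : ℤ}
    {r : Fin N → ℤ} (hk : k ≠ 0) (h : k • r ∈ constSubmodule U) : r ∈ constSubmodule U := by
  obtain ⟨c, hc⟩ := h
  have h1 : ∀ᶠ x in U, ∃ u ∈ {u : Torus1 | k • u = c}, torusPairing r x = u := by
    filter_upwards [hc] with x hx
    exact ⟨_, by rwa [torusPairing_smul_left] at hx, rfl⟩
  obtain ⟨u, -, hu⟩ := (Ultrafilter.eventually_exists_mem_iff (finite_zsmul_eq hk c)).1 h1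
  exact ⟨u, hu⟩

lemma mem_constSubmodule_of_ker_le {U : Ultrafilter (Fin N → Torus1)} {ι : Type*} [Fintype ι]
    {R : ι → Fin N → ℤ} {r : Fin N → ℤ} (hR : ∀ i, R i ∈ constSubmodule U)
    (h : ∀ w : Fin N → ℚ, (∀ i, ∑ j, (R i j : ℚ) * w j = 0) → ∑ j, (r j : ℚ) * w j = 0) :
    r ∈ constSubmodule U := by
  obtain ⟨k, hk, c, hc⟩ := exists_smul_eq_sum_of_ker_le R r h
  refine mem_constSubmodule_of_zsmul_mem hk ?_
  rw [hc]
  exact Submodule.sum_mem _ fun i _ => Submodule.smul_mem _ _ (hR i)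

lemma exists_eventually_eq_of_constSubmodule_eq_top {U : Ultrafilter (Fin N → Torus1)}
    (h : ∀ j, Pi.single j 1 ∈ constSubmodule U) : ∃ y, ∀ᶠ x : Fin N → Torus1 in U, x = y := by
  choose y hy using h
  refine ⟨y, ?_⟩
  filter_upwards [eventually_all.2 hy] with x hx
  ext j
  rw [← hx j, torusPairing_single]

variable {L D : ℕ}

/-- The integer vectors `m` such that all non-constant coefficients of the polynomial
`n ↦ m · A(n) x` are constant in `x` along the ultrafilter `U`. -/
def constCoeffSubmodule (A : Fin (D + 1) → Matrix (Fin L) (Fin N) ℤ)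
    (U : Ultrafilter (Fin N → Torus1)) : Submodule ℤ (Fin L → ℤ) where
  carrier := {m | ∀ d, d ≠ 0 → m ᵥ* A d ∈ constSubmodule U}
  zero_mem' := fun d _ => by rw [Matrix.zero_vecMul]; exact Submodule.zero_mem _
  add_mem' := fun ha hb d hd => by
    rw [Matrix.add_vecMul]; exact Submodule.add_mem _ (ha d hd) (hb d hd)
  smul_mem' := fun k m hm d hd => by
    rw [Matrix.smul_vecMul]; exact Submodule.smul_mem _ _ (hm d hd)

variable {A : Fin (D + 1) → Matrix (Fin L) (Fin N) ℤ} {U : Ultrafilter (Fin N → Torus1)}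

lemma mem_constCoeffSubmodule {m : Fin L → ℤ} :
    m ∈ constCoeffSubmodule A U ↔ ∀ d, d ≠ 0 → m ᵥ* A d ∈ constSubmodule U := Iff.rfl

lemma mem_constCoeffSubmodule_of_zsmul_mem {k : ℤ} {m : Fin L → ℤ} (hk : k ≠ 0)
    (h : k • m ∈ constCoeffSubmodule A U) : m ∈ constCoeffSubmodule A U := fun d hd => by
  have := h d hd
  rw [Matrix.smul_vecMul] at this
  exact mem_constSubmodule_of_zsmul_mem hk this

lemma constCoeffSubmodule_ne_top (ha : CondA A) (hU : ∀ y, ¬ ∀ᶠ x : Fin N → Torus1 in U, x = y) :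
    constCoeffSubmodule A U ≠ ⊤ := by
  intro htop
  obtain ⟨y, hy⟩ := exists_eventually_eq_of_constSubmodule_eq_top (U := U) fun j => by
    refine mem_constSubmodule_of_ker_le
      (R := fun p : {d : Fin (D + 1) // d ≠ 0} × Fin L => Pi.single p.2 1 ᵥ* A p.1) ?_ ?_
    · rintro ⟨⟨d, hd⟩, l⟩
      have : Pi.single l 1 ∈ constCoeffSubmodule A U := htop ▸ Submodule.mem_top
      exact this d hd
    · intro w hw
      have : w = 0 := by
        refine ha w fun d hd => funext fun l => ?_
        have := hw ⟨⟨d, hd⟩, l⟩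
        simpa [Matrix.mulVec, dotProduct] using this
      simp [this]
  exact hU y hy

lemma vecMul_zero_mem_constSubmodule (hb : CondB A) {m : Fin L → ℤ}
    (hm : m ∈ constCoeffSubmodule A U) : m ᵥ* A 0 ∈ constSubmodule U := by
  have key : ∀ (d : Fin (D + 1)) (w : Fin N → ℚ),
      (fun l => (m l : ℚ)) ⬝ᵥ ((A d).map ((↑) : ℤ → ℚ)).mulVec w =
        ∑ j, ((m ᵥ* A d) j : ℚ) * w j := by
    intro d w
    rw [Matrix.dotProduct_mulVec]
    simp [Matrix.vecMul, dotProduct]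
  refine mem_constSubmodule_of_ker_le
    (R := fun d : {d : Fin (D + 1) // d ≠ 0} => m ᵥ* A d) (fun d => hm d d.2) fun w hw => ?_
  rw [← key]
  refine hb _ w fun d hd => ?_
  rw [key]
  exact hw ⟨d, hd⟩

lemma exists_maximal_nonconst_coeff {m : Fin L → ℤ} (hm : m ∉ constCoeffSubmodule A U) :
    ∃ d : ℕ, ∃ hd : d + 1 < D + 1, m ᵥ* A ⟨d + 1, hd⟩ ∉ constSubmodule U ∧
      ∀ d' : Fin (D + 1), d + 1 < (d' : ℕ) → m ᵥ* A d' ∈ constSubmodule U := by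
  classical
  rw [mem_constCoeffSubmodule] at hm
  push Not at hm
  obtain ⟨d₀, hd₀, hd₀'⟩ := hm
  let S : Finset (Fin (D + 1)) :=
    Finset.univ.filter fun d => d ≠ 0 ∧ m ᵥ* A d ∉ constSubmodule U
  have hS : S.Nonempty := ⟨d₀, by simp [S, hd₀, hd₀']⟩
  have hmem := S.max'_mem hS
  simp only [S, Finset.mem_filter, Finset.mem_univ, true_and] at hmem
  obtain ⟨e, he⟩ := Nat.exists_eq_succ_of_ne_zero (Fin.val_ne_of_ne hmem.1)
  have hlt := (S.max' hS).2
  refine ⟨e, by omega, ?_, fun d' hd' => ?_⟩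
  · have heq : (⟨e + 1, by omega⟩ : Fin (D + 1)) = S.max' hS := Fin.ext he.symm
    rw [heq]
    exact hmem.2
  · by_contra hcon
    have h1 : d' ≤ S.max' hS := S.le_max' d' (by
      simp only [S, Finset.mem_filter, Finset.mem_univ, true_and]
      exact ⟨fun h => by simp [h] at hd', hcon⟩)
    have h2 : (d' : ℕ) ≤ (S.max' hS : ℕ) := h1
    simp only [S, ne_eq] at he h2
    omega

/-- Along an ultrafilter one can select finitely many points such that, for `m` in a given finite
set, `n ↦ m · A(n) x` does not depend on the selected point `x` or these sequences are pairwise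
nearly uncorrelated. -/
lemma exists_points (hb : CondB A) {X : Set (Fin N → Torus1)} (hX : X ∈ U)
    (F : Finset (Fin L → ℤ)) {δ : ℝ} (hδ : 0 < δ) :
    ∃ x : ℕ → Fin N → Torus1, (∀ i, x i ∈ X) ∧
      (∀ m ∈ F, m ∈ constCoeffSubmodule A U → ∀ n i j,
        torusPairing m (torusAct (evalMat A n) (x i)) =
          torusPairing m (torusAct (evalMat A n) (x j))) ∧
      (∀ m ∈ F, m ∉ constCoeffSubmodule A U → ∀ i j, i ≠ j → SmallMean δ fun n =>
        torusPairing m (torusAct (evalMat A n) (x i)) -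
          torusPairing m (torusAct (evalMat A n) (x j))) := by
  have hval : ∀ r, ∃ c, r ∈ constSubmodule U → ∀ᶠ x in U, torusPairing r x = c := fun r => by
    by_cases hr : r ∈ constSubmodule U
    · obtain ⟨c, hc⟩ := hr
      exact ⟨c, fun _ => hc⟩
    · exact ⟨0, fun h => (hr h).elim⟩
  choose c hc using hval
  choose! e he hne hlt using fun m (hm : m ∉ constCoeffSubmodule A U) =>
    exists_maximal_nonconst_coeff hm
  choose Q hQ using fun D => exists_smallMean_of_isPolySeq D δ hδ
  let P : (Fin N → Torus1) → Prop := fun x => x ∈ X ∧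
    ∀ m ∈ F, ∀ d, m ᵥ* A d ∈ constSubmodule U → torusPairing (m ᵥ* A d) x = c (m ᵥ* A d)
  let r : (Fin N → Torus1) → (Fin N → Torus1) → Prop := fun x y =>
    ∀ m ∈ F, ∀ hm : m ∉ constCoeffSubmodule A U, ∀ q ∈ Finset.Icc (-(Q (e m) : ℤ)) (Q (e m)),
      q ≠ 0 → q • ((e m + 1).factorial • (torusPairing (m ᵥ* A ⟨e m + 1, he m hm⟩) x -
        torusPairing (m ᵥ* A ⟨e m + 1, he m hm⟩) y)) ≠ 0
  have hP : ∀ᶠ x in U, P x := by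
    refine (show ∀ᶠ x in U, x ∈ X from hX).and ?_
    rw [eventually_all_finset]
    intro m _
    rw [eventually_all]
    intro d
    rw [eventually_imp_distrib_left]
    exact hc _
  have hr : ∀ x, ∀ᶠ y in U, r x y := by
    intro x
    rw [eventually_all_finset]
    intro m _
    rw [eventually_all]
    intro hm
    rw [eventually_all_finset]
    intro q _
    rw [eventually_imp_distrib_left]
    intro hq
    rw [Ultrafilter.eventually_not]
    intro hev
    refine hne m hm (mem_constSubmodule_of_zsmul_mem (k := q * ((e m + 1).factorial : ℤ))
      (mul_ne_zero hq (by exact_mod_cast Nat.factorial_ne_zero _)) ⟨(q * ((e m + 1).factorial : ℤ)) •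
        torusPairing (m ᵥ* A ⟨e m + 1, he m hm⟩) x, ?_⟩)
    filter_upwards [hev] with y hy
    rw [← natCast_zsmul, smul_smul, smul_sub, sub_eq_zero] at hy
    rw [torusPairing_smul_left, hy]
  have hsymm : Std.Symm r := ⟨fun x y h m hmF hm q hq hq0 => by
    rw [← neg_sub, smul_neg, smul_neg, neg_ne_zero]
    exact h m hmF hm q hq hq0⟩
  obtain ⟨x, hxP, hxr⟩ := exists_seq_of_forall_finset_exists' P r fun s _ =>
    (hP.and ((eventually_all_finset s).2 fun x _ => hr x)).exists
  refine ⟨x, fun i => (hxP i).1, fun m hmF hm n i j => ?_, fun m hmF hm i j hij => ?_⟩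
  · have hconst : ∀ i d, torusPairing (m ᵥ* A d) (x i) = c (m ᵥ* A d) := fun i d => by
      refine (hxP i).2 m hmF d ?_
      by_cases hd : d = 0
      · rw [hd]; exact vecMul_zero_mem_constSubmodule hb hm
      · exact hm d hd
    simp only [torusPairing_torusAct_evalMat, hconst]
  · set D' : Fin (D + 1) := ⟨e m + 1, he m hm⟩ with hD'
    set ψ : Fin (D + 1) → Torus1 := fun d =>
      torusPairing (m ᵥ* A d) (x i) - torusPairing (m ᵥ* A d) (x j) with hψ
    have hsum : ∀ n : ℤ, torusPairing m (torusAct (evalMat A n) (x i)) -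
        torusPairing m (torusAct (evalMat A n) (x j)) =
          ∑ d : Fin (D + 1), n ^ (d : ℕ) • ψ d := fun n => by
      simp only [torusPairing_torusAct_evalMat, hψ, smul_sub, Finset.sum_sub_distrib]
    simp only [hsum]
    refine hQ (e m) ((e m + 1).factorial • ψ D') _ ?_ fun q hq hqQ => ?_
    · have hterm : ∀ d ∈ (Finset.univ : Finset (Fin (D + 1))), IsPolySeq (e m + 1)
          (if d = D' then (e m + 1).factorial • ψ D' else 0) (fun n => n ^ (d : ℕ) • ψ d) := by
        intro d _
        rcases lt_trichotomy (d : ℕ) (e m + 1) with h | h | h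
        · rw [if_neg (by rintro rfl; simp [hD'] at h)]
          exact (isPolySeq_pow_zsmul _ _).of_lt h
        · have hd : d = D' := Fin.ext h
          rw [if_pos hd, hd]
          exact isPolySeq_pow_zsmul _ _
        · rw [if_neg (by rintro rfl; simp [hD'] at h)]
          have h0 : ψ d = 0 := by
            have hmem := hlt m hm d h
            simp only [hψ]
            rw [(hxP i).2 m hmF d hmem, (hxP j).2 m hmF d hmem, sub_self]
          simpa [h0] using isPolySeq_zero (e m + 1)
      simpa using IsPolySeq.sum hterm
    · exact hxr hij m hmF hm q (Finset.mem_Icc.2 (abs_le.1 hqQ)) hq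

end Ultrafilter

/-- An infinite set belongs to an ultrafilter which is not principal. -/
lemma exists_nonprincipal_ultrafilter {α : Type*} {X : Set α} (hX : X.Infinite) :
    ∃ U : Ultrafilter α, X ∈ U ∧ ∀ y, ¬ ∀ᶠ x : α in U, x = y := by
  have := hX.to_subtype
  refine ⟨(hyperfilter X).map Subtype.val, ?_, fun y h => ?_⟩
  · rw [Ultrafilter.mem_map]
    exact univ_mem' fun x => x.2
  · have h1 : ∀ᶠ x : X in hyperfilter X, (x : α) = y := h
    have hfin : {x : X | (x : α) = y}.Finite :=
      Set.Subsingleton.finite fun a ha b hb => Subtype.ext (ha.trans hb.symm)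
    exact notMem_hyperfilter_of_finite hfin h1

/-- Simultaneous smallness of finitely many exponential sums for a suitable integer. -/
lemma exists_forall_norm_sum_lt {ι : Type*} (F : Finset ι) {k : ℕ} {τ : ℝ} (hτ : 0 < τ)
    (hk : 2 * (F.card + 1) / τ ^ 2 < k) {u : ι → Fin k → ℤ → Torus1}
    (hu : ∀ m ∈ F, ∀ i j, i ≠ j →
      SmallMean (τ ^ 2 / (2 * (F.card + 1))) (fun n => u m i n - u m j n)) :
    ∃ n, ∀ m ∈ F, ‖∑ i, circleChar (u m i n)‖ < k * τ := by
  have hF : (0 : ℝ) < F.card + 1 := by positivity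
  have hk0 : (0 : ℝ) < k := lt_trans (by positivity) hk
  choose! c hc hcb using fun m (hm : m ∈ F) =>
    exists_hasMean_norm_sq_sum_le (hu m hm) (by positivity)
  have hmean := HasMean.sum hc
  have hbound : ‖∑ m ∈ F, c m‖ < (k * τ) ^ 2 := by
    have h1 : ‖∑ m ∈ F, c m‖ ≤ F.card * (k + k ^ 2 * (τ ^ 2 / (2 * (F.card + 1)))) := by
      refine (norm_sum_le _ _).trans ((Finset.sum_le_sum hcb).trans_eq ?_)
      rw [Finset.sum_const, nsmul_eq_mul]
    have h2 : (F.card + 1) * (k + k ^ 2 * (τ ^ 2 / (2 * (F.card + 1)))) < (k * τ) ^ 2 := by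
      rw [div_lt_iff₀ (by positivity)] at hk
      have e : ((F.card : ℝ) + 1) * (k + k ^ 2 * (τ ^ 2 / (2 * (F.card + 1)))) =
          (F.card + 1) * k + k ^ 2 * τ ^ 2 / 2 := by field_simp
      rw [e]
      nlinarith
    have h3 : (0 : ℝ) < k + k ^ 2 * (τ ^ 2 / (2 * (F.card + 1))) := by positivity
    linarith
  simp only [← Complex.ofReal_sum] at hmean
  obtain ⟨n, hn⟩ := hmean.exists_lt hbound
  refine ⟨n, fun m hm => ?_⟩
  have h1 := Finset.single_le_sum (f := fun m => ‖∑ i, circleChar (u m i n)‖ ^ 2)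
    (fun _ _ => by positivity) hm
  exact lt_of_pow_lt_pow_left₀ 2 (by positivity) (h1.trans_lt hn)

/-- The sum over points `z i` of the square modulus of a trigonometric polynomial with nonnegative
coefficients, bounded below through its exponential sums. -/
lemma le_sum_norm_sq_trigPoly {L k : ℕ} {τ : ℝ} (J : Finset (Fin L → ℕ))
    {β : (Fin L → ℕ) → ℝ} (hβ : ∀ j, 0 ≤ β j) (z : Fin k → Fin L → Torus1)
    (h : ∀ j ∈ J, ∀ j' ∈ J, j ≠ j' → -(k * τ) ≤
      (∑ i, circleChar (torusPairing ((fun l => (j l : ℤ)) - fun l => (j' l : ℤ)) (z i))).re)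
    (hτ : 0 ≤ τ) :
    k * (∑ j ∈ J, β j ^ 2 - τ * (∑ j ∈ J, β j) ^ 2) ≤
      ∑ i, ‖∑ j ∈ J, (β j : ℂ) * circleChar (torusPairing (fun l => (j l : ℤ)) (z i))‖ ^ 2 := by
  have hexp : ∑ i, ‖∑ j ∈ J, (β j : ℂ) *
      circleChar (torusPairing (fun l => (j l : ℤ)) (z i))‖ ^ 2 =
      ∑ j ∈ J, ∑ j' ∈ J, β j * β j' * (∑ i, circleChar
        (torusPairing ((fun l => (j l : ℤ)) - fun l => (j' l : ℤ)) (z i))).re := by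
    have hi : ∀ i, ‖∑ j ∈ J, (β j : ℂ) *
        circleChar (torusPairing (fun l => (j l : ℤ)) (z i))‖ ^ 2 =
        ∑ j ∈ J, ∑ j' ∈ J, β j * β j' * (circleChar
          (torusPairing ((fun l => (j l : ℤ)) - fun l => (j' l : ℤ)) (z i))).re := by
      intro i
      rw [← Complex.ofReal_re (‖_‖ ^ 2), Complex.ofReal_pow, ← Complex.mul_conj', map_sum,
        Finset.sum_mul_sum, Complex.re_sum]
      refine Finset.sum_congr rfl fun j _ => ?_
      rw [Complex.re_sum]
      refine Finset.sum_congr rfl fun j' _ => ?_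
      rw [torusPairing_sub_left, circleChar_sub, map_mul, Complex.conj_ofReal,
        mul_mul_mul_comm, ← Complex.ofReal_mul, Complex.re_ofReal_mul]
    simp_rw [hi, Complex.re_sum, Finset.mul_sum]
    rw [Finset.sum_comm]
    exact Finset.sum_congr rfl fun j _ => Finset.sum_comm
  rw [hexp]
  calc k * (∑ j ∈ J, β j ^ 2 - τ * (∑ j ∈ J, β j) ^ 2)
      = ∑ j ∈ J, ∑ j' ∈ J, β j * β j' * ((if j = j' then (k : ℝ) else 0) - k * τ) := by
        simp only [mul_sub, Finset.sum_sub_distrib, mul_ite, mul_zero, Finset.sum_ite_eq]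
        rw [pow_two (∑ j ∈ J, β j), Finset.sum_mul_sum]
        congr 1
        · rw [Finset.mul_sum]
          refine Finset.sum_congr rfl fun j hj => ?_
          rw [if_pos hj]; ring
        · simp only [Finset.mul_sum]
          exact Finset.sum_congr rfl fun j _ => Finset.sum_congr rfl fun j' _ => by ring
    _ ≤ _ := by
        refine Finset.sum_le_sum fun j hj => Finset.sum_le_sum fun j' hj' => ?_
        refine mul_le_mul_of_nonneg_left ?_ (mul_nonneg (hβ j) (hβ j'))
        by_cases hjj : j = j'
        · subst hjj
          have : (0 : ℝ) ≤ k * τ := by positivity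
          simp only [sub_self, torusPairing_zero_left, circleChar_zero]
          simpa using this
        · rw [if_neg hjj, zero_sub]
          exact h j hj j' hj' hjj

/-- **Sufficiency of conditions (a) and (b).** If `A(x)` satisfies conditions (a) and (b),
then for every infinite `X ⊆ 𝕋^N` there is a subtorus `𝒯` of `𝕋^L` such that for every
`ε > 0` there is an integer `n` with `A(n) X` `ε`-dense in some translate of `𝒯`. -/
theorem statement2 (L N D : ℕ) (hL : 0 < L) (hN : 0 < N) (hD : 0 < D)
    (A : Fin (D + 1) → Matrix (Fin L) (Fin N) ℤ)
    (ha : CondA A) (hb : CondB A) :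
    ∀ X : Set (Fin N → Torus1), X.Infinite →
      ∃ T : AddSubgroup (Fin L → Torus1), IsSubtorus T ∧
        ∀ ε : ℝ, 0 < ε → ∃ n : ℤ, ∃ t : Fin L → Torus1,
          EpsDenseIn (torusAct (evalMat A n) '' X) (translateOf t T) ε := by
  intro X hX
  obtain ⟨U, hXU, hU⟩ := exists_nonprincipal_ultrafilter hX
  set H := constCoeffSubmodule A U with hH
  refine ⟨torusAnnihilator H, isSubtorus_torusAnnihilator
    (fun k m hk => mem_constCoeffSubmodule_of_zsmul_mem hk) (constCoeffSubmodule_ne_top ha hU),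
    fun ε hε => ?_⟩
  classical
  obtain ⟨J, β, κ, hβ, hκ, hsmall⟩ := exists_trigPoly_norm_sq_le L hε
  obtain ⟨τ, hτ, hτ'⟩ : ∃ τ : ℝ, 0 < τ ∧
      κ < ∑ j ∈ J, β j ^ 2 - τ * (∑ j ∈ J, β j) ^ 2 := by
    have hg : 0 < ∑ j ∈ J, β j ^ 2 - κ := sub_pos.2 hκ
    have hB : 0 < (∑ j ∈ J, β j) ^ 2 + 1 := by positivity
    refine ⟨(∑ j ∈ J, β j ^ 2 - κ) / ((∑ j ∈ J, β j) ^ 2 + 1), div_pos hg hB, ?_⟩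
    have h1 := div_mul_cancel₀ (∑ j ∈ J, β j ^ 2 - κ) hB.ne'
    have h2 := div_pos hg hB
    linarith
  set F : Finset (Fin L → ℤ) := ((J ×ˢ J).image fun p =>
    (fun l => (p.1 l : ℤ)) - fun l => (p.2 l : ℤ)) with hF
  set F' := F.filter (· ∉ H) with hF'
  obtain ⟨k, hk⟩ := exists_nat_gt (2 * ((F'.card : ℝ) + 1) / τ ^ 2)
  have hk0 : (0 : ℝ) < k := lt_trans (by positivity) hk
  obtain ⟨x, hxX, hconst, hindep⟩ := exists_points (A := A) hb hXU F
    (δ := τ ^ 2 / (2 * (F'.card + 1))) (by positivity)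
  obtain ⟨n, hn⟩ := exists_forall_norm_sum_lt F' hτ hk
    (u := fun m i n => torusPairing m (torusAct (evalMat A n) (x (i : ℕ))))
    fun m hm i j hij => hindep m (Finset.mem_filter.1 hm).1 (Finset.mem_filter.1 hm).2 i j
      (fun h => hij (Fin.ext h))
  refine ⟨n, torusAct (evalMat A n) (x 0), ?_⟩
  rintro _ ⟨y, hy, rfl⟩
  by_contra! hfar
  set s := torusAct (evalMat A n) (x 0) + y with hs
  let z : Fin k → Fin L → Torus1 := fun i => torusAct (evalMat A n) (x (i : ℕ)) - s
  have hz : ∀ i, ∃ l, ε < ‖z i l‖ := fun i => by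
    obtain ⟨l, hl⟩ := hfar _ ⟨x i, hxX i, rfl⟩
    exact ⟨l, by rwa [dist_eq_norm] at hl⟩
  have hupper := Finset.sum_le_sum fun (i : Fin k) (_ : i ∈ Finset.univ) => hsmall (z i) (hz i)
  have hlower := le_sum_norm_sq_trigPoly J hβ z (τ := τ) (fun j hj j' hj' _ => ?_) hτ.le
  · have h1 := hlower.trans hupper
    simp only [Finset.sum_const, Finset.card_univ, Fintype.card_fin, nsmul_eq_mul] at h1
    linarith [le_of_mul_le_mul_left h1 hk0]
  · set m : Fin L → ℤ := (fun l => (j l : ℤ)) - fun l => (j' l : ℤ) with hm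
    have hmF : m ∈ F := Finset.mem_image.2 ⟨(j, j'), Finset.mem_product.2 ⟨hj, hj'⟩, rfl⟩
    by_cases hmH : m ∈ H
    · have hz0 : ∀ i, torusPairing m (z i) = 0 := fun i => by
        simp only [z, hs]
        rw [torusPairing_sub_right, torusPairing_add_right, hconst m hmF hmH n i 0,
          hy m hmH, add_zero, sub_self]
      simp only [hz0, circleChar_zero]
      have : (0 : ℝ) ≤ k * τ := by positivity
      simp
      linarith
    · have h1 := hn m (Finset.mem_filter.2 ⟨hmF, hmH⟩)
      have h2 : ∑ i, circleChar (torusPairing m (z i)) =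
          (∑ i : Fin k, circleChar (torusPairing m (torusAct (evalMat A n) (x (i : ℕ))))) *
            starRingEnd ℂ (circleChar (torusPairing m s)) := by
        rw [Finset.sum_mul]
        refine Finset.sum_congr rfl fun i _ => ?_
        rw [← circleChar_sub, ← torusPairing_sub_right]
      have h3 : ‖∑ i, circleChar (torusPairing m (z i))‖ < k * τ := by
        rw [h2, norm_mul, RCLike.norm_conj, norm_circleChar, mul_one]
        exact h1
      have h4 := (abs_le.1 (Complex.abs_re_le_norm (∑ i, circleChar (torusPairing m (z i))))).1
      linarith
end

section
/- Let A(x) ∈ M_{L×N}(ℤ[x]) have degree at most D and satisfy: (a) the only w ∈ ℚ^N with A_*(x)w identically zero is w = 0, and (b) for all v ∈ ℚ^L and w ∈ ℚ^N, if v·A_d w = 0 for every d = 1, …, D then v·A_0 w = 0. Then there exist positive constants C, c_1 and c_2 depending only on N, L and D such that the following holds for every ε > 0: any set X of k distinct points in 𝕋^N with k > C · ‖A_*‖_∞^{c_1} · (1/ε)^{c_2} admits a positive integer n, a subtorus 𝒯 of 𝕋^L, and a translate of 𝒯 in which A(n)X is ε-dense. -/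
open scoped BigOperators
open Matrix

/-- The inclusion of `ℤⁿ` into `ℚⁿ`. -/
def ratVec {n : ℕ} (w : Fin n → ℤ) : Fin n → ℚ := fun i => (w i : ℚ)

lemma ratVec_injective {n : ℕ} : Function.Injective (ratVec (n := n)) := by
  intro v w h
  funext i
  have := congrFun h i
  simpa [ratVec] using this

lemma ratVec_vecMul {m n : ℕ} (v : Fin m → ℤ) (P : Matrix (Fin m) (Fin n) ℤ) :
    ratVec (v ᵥ* P) = ratVec v ᵥ* P.map ((↑) : ℤ → ℚ) := by
  funext i
  simp [ratVec, Matrix.vecMul, dotProduct]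

/-- The torsion of `ℤⁿ` modulo the span of a set of bounded vectors has bounded exponent. -/
lemma exists_smul_mem_span {n : ℕ} (S : Set (Fin n → ℤ)) (B : ℕ) (hB : 1 ≤ B)
    (hS : ∀ s ∈ S, ∀ i, |s i| ≤ (B : ℤ)) :
    ∃ m : ℕ, 0 < m ∧ m ≤ n.factorial * B ^ n ∧ ∀ w : Fin n → ℤ,
      ratVec w ∈ Submodule.span ℚ (ratVec '' S) → (m : ℤ) • w ∈ Submodule.span ℤ S := by
  classical
  obtain ⟨b, hbS, hbspan, hbli⟩ := exists_linearIndependent ℚ (ratVec '' S)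
  set E : Set (Fin n → ℤ) := Set.range fun i => Pi.single i 1 with hE
  have hbt : b ⊆ ratVec '' (S ∪ E) :=
    hbS.trans (Set.image_mono Set.subset_union_left)
  obtain ⟨u, hut, hbu, htu, huli⟩ :=
    exists_linearIndepOn_extension (v := (id : (Fin n → ℚ) → _)) (s := b) hbli hbt
  have hli : LinearIndependent ℚ (Subtype.val : u → (Fin n → ℚ)) := huli
  have hsp : ⊤ ≤ Submodule.span ℚ (Set.range (Subtype.val : u → (Fin n → ℚ))) := by
    rw [Subtype.range_coe, ← (Pi.basisFun ℚ (Fin n)).span_eq, Submodule.span_le]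
    rintro _ ⟨i, rfl⟩
    have : ratVec (Pi.single i 1 : Fin n → ℤ) ∈ id '' (ratVec '' (S ∪ E)) := by
      rw [Set.image_id]
      exact ⟨_, Or.inr ⟨i, rfl⟩, rfl⟩
    have h2 := htu this
    rw [Set.image_id] at h2
    have h3 : ratVec (Pi.single i 1 : Fin n → ℤ) = (Pi.basisFun ℚ (Fin n)) i := by
      funext j
      by_cases h : j = i
      · subst h; simp [ratVec]
      · simp [ratVec, h]
    rwa [h3] at h2
  let bas := Module.Basis.mk hli hsp
  have : Fintype u := FiniteDimensional.fintypeBasisIndex bas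
  have hcard : Fintype.card u = n := by
    rw [← Module.finrank_eq_card_basis bas]; simp
  let e : Fin n ≃ u := (Fintype.equivFinOfCardEq hcard).symm
  let bs := bas.reindex e.symm
  have hbs : ∀ i, bs i = (e i : Fin n → ℚ) := by
    intro i; simp [bs, bas]
  have hch : ∀ i, ∃ p : Fin n → ℤ, p ∈ S ∪ E ∧ ratVec p = (e i : Fin n → ℚ) := fun i =>
    hut (e i).2
  choose P hPS hPe using hch
  have hPli : LinearIndependent ℚ ((Matrix.of P).map ((↑) : ℤ → ℚ)).row := by
    have := bs.linearIndependent
    convert this using 1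
    funext i
    rw [hbs, ← hPe]; rfl
  have hdetQ : ((Matrix.of P).map ((↑) : ℤ → ℚ)).det ≠ 0 := by
    rw [Matrix.linearIndependent_rows_iff_isUnit, Matrix.isUnit_iff_isUnit_det] at hPli
    exact hPli.ne_zero
  have hdetcast : ((Matrix.of P).map ((↑) : ℤ → ℚ)).det = (((Matrix.of P).det : ℤ) : ℚ) := by
    have := (Int.castRingHom ℚ).map_det (Matrix.of P)
    simpa using this.symm
  have hdet : (Matrix.of P).det ≠ 0 := by
    intro h; rw [hdetcast, h] at hdetQ; simp at hdetQ
  refine ⟨(Matrix.of P).det.natAbs, Int.natAbs_pos.mpr hdet, ?_, ?_⟩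
  · have hle := Matrix.det_le (A := Matrix.of P) (abv := AbsoluteValue.abs) (x := (B : ℤ)) (by
      intro i j
      change |P i j| ≤ _
      rcases hPS i with h | ⟨k, hk⟩
      · exact hS _ h j
      · rw [← hk]
        by_cases h : j = k
        · subst h; simp; exact_mod_cast hB
        · simp [h])
    simp only [AbsoluteValue.abs_apply, Fintype.card_fin, nsmul_eq_mul] at hle
    zify
    exact_mod_cast hle
  · intro w hw
    rw [← hbspan] at hw
    have hb' : b = bs '' {i | (e i : Fin n → ℚ) ∈ b} := by
      ext x
      constructor
      · intro hx
        exact ⟨e.symm ⟨x, hbu hx⟩, by simpa using hx, by rw [hbs]; simp⟩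
      · rintro ⟨i, hi, rfl⟩
        rw [hbs]; exact hi
    rw [hb', bs.mem_span_image] at hw
    set z := w ᵥ* (Matrix.of P).adjugate with hz
    have hzP : z ᵥ* (Matrix.of P) = (Matrix.of P).det • w := by
      rw [hz, Matrix.vecMul_vecMul, Matrix.adjugate_mul, Matrix.vecMul_smul, Matrix.vecMul_one]
    have hz0 : ∀ i, (e i : Fin n → ℚ) ∉ b → z i = 0 := by
      intro i hi
      have hc : bs.repr (ratVec w) i = 0 := by
        by_contra hne
        exact hi (hw (Finsupp.mem_support_iff.mpr hne))
      have h1 : ratVec w = ∑ i, (bs.repr (ratVec w) i) • ratVec (P i) := by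
        conv_lhs => rw [← bs.sum_repr (ratVec w)]
        refine Finset.sum_congr rfl fun i _ => ?_
        rw [hbs, hPe]
      have h2 : ratVec z = 
          fun i => ((Matrix.of P).det : ℚ) * bs.repr (ratVec w) i := by
        have h3 : (((Matrix.of P).det : ℤ) : ℚ) • ratVec w = ratVec z ᵥ* (Matrix.of P).map (↑) := by
          rw [← ratVec_vecMul, hzP]; funext i; simp [ratVec]
        have hinj : Function.Injective
            (fun v : Fin n → ℚ => v ᵥ* (Matrix.of P).map ((↑) : ℤ → ℚ)) :=
          Matrix.vecMul_injective_iff.mpr hPli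
        apply hinj
        simp only
        rw [← h3]
        have h4 : ∀ c : Fin n → ℚ, c ᵥ* (Matrix.of P).map ((↑) : ℤ → ℚ)
            = ∑ i, c i • ratVec (P i) := by
          intro c; funext j; simp [Matrix.vecMul, dotProduct, ratVec]
        rw [h4]
        conv_lhs => rw [h1, Finset.smul_sum]
        refine Finset.sum_congr rfl fun i _ => ?_
        rw [smul_smul]
      have h5 := congrFun h2 i
      simpa [ratVec, hc] using h5
    have hmem : (Matrix.of P).det • w ∈ Submodule.span ℤ S := by
      rw [← hzP, Matrix.vecMul_eq_sum]
      refine Submodule.sum_mem _ fun i _ => ?_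
      by_cases hi : (e i : Fin n → ℚ) ∈ b
      · refine Submodule.smul_mem _ _ (Submodule.subset_span ?_)
        obtain ⟨s, hs, hse⟩ := hbS hi
        have : s = P i := ratVec_injective (by rw [hse, hPe])
        exact Set.mem_of_eq_of_mem this.symm hs
      · rw [hz0 i hi, zero_smul]; exact Submodule.zero_mem _
    rcases Int.natAbs_eq (Matrix.of P).det with h | h
    · rw [← h]; exact hmem
    · have : ((Matrix.of P).det.natAbs : ℤ) = -(Matrix.of P).det := by omega
      rw [this, neg_smul]; exact Submodule.neg_mem _ hmem

/-- A vector orthogonal to the annihilator of a set of vectors lies in their span. -/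
lemma mem_span_of_forall_dotProduct {n : ℕ} (S : Set (Fin n → ℚ)) (u : Fin n → ℚ)
    (h : ∀ w : Fin n → ℚ, (∀ s ∈ S, s ⬝ᵥ w = 0) → u ⬝ᵥ w = 0) : u ∈ Submodule.span ℚ S := by
  by_contra hu
  obtain ⟨f, hfu, hf⟩ := Submodule.exists_le_ker_of_notMem hu
  have hfw : ∀ v : Fin n → ℚ, f v = v ⬝ᵥ fun i => f (Pi.single i 1) := by
    intro v
    conv_lhs => rw [← (Pi.basisFun ℚ (Fin n)).sum_repr v]
    simp [dotProduct]
  refine hfu ?_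
  rw [hfw]
  refine h _ fun s hs => ?_
  rw [← hfw]
  exact hf (Submodule.subset_span hs)

section

open Filter Topology ComplexConjugate

/-- The standard character `x ↦ exp (2πix)` of the circle. -/
noncomputable def expT (x : Torus1) : ℂ := (AddCircle.toCircle x : ℂ)

lemma expT_add (x y : Torus1) : expT (x + y) = expT x * expT y := by
  simp [expT, AddCircle.toCircle_add]

@[simp] lemma expT_zero : expT 0 = 1 := by simp [expT]

@[simp] lemma norm_expT (x : Torus1) : ‖expT x‖ = 1 := Circle.norm_coe _

lemma expT_neg (x : Torus1) : expT (-x) = conj (expT x) := by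
  rw [expT, AddCircle.toCircle_neg, Circle.coe_inv_eq_conj, expT]

lemma expT_sub (x y : Torus1) : expT (x - y) = expT x * conj (expT y) := by
  rw [sub_eq_add_neg, expT_add, expT_neg]

lemma expT_nsmul (n : ℕ) (x : Torus1) : expT (n • x) = expT x ^ n := by
  simp [expT, AddCircle.toCircle_nsmul]

lemma expT_eq_one_iff (x : Torus1) : expT x = 1 ↔ x = 0 := by
  constructor
  · intro h
    have h1 : AddCircle.toCircle x = AddCircle.toCircle (0 : Torus1) := by
      ext; simpa [expT] using h
    exact AddCircle.injective_toCircle one_ne_zero h1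
  · rintro rfl; simp

/-- The properties of a shift-invariant mean on bounded sequences that are used below. -/
structure IsMean (m : (ℕ → ℂ) →ₗ[ℂ] ℂ) : Prop where
  norm_le : ∀ (f : ℕ → ℂ) (C : ℝ), (∀ n, ‖f n‖ ≤ C) → ‖m f‖ ≤ C
  shift : ∀ (f : ℕ → ℂ) (C : ℝ), (∀ n, ‖f n‖ ≤ C) → m (fun n => f (n + 1)) = m f
  nonneg : ∀ (f : ℕ → ℂ) (C : ℝ), (∀ n, ‖f n‖ ≤ C) → (∀ n, 0 ≤ (f n).re) → 0 ≤ (m f).re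
  map_conj : ∀ (f : ℕ → ℂ) (C : ℝ), (∀ n, ‖f n‖ ≤ C) → m (fun n => conj (f n)) = conj (m f)
  map_one : m (fun _ => 1) = 1

/-- Cesàro averages of a sequence. -/
noncomputable def cesaro (f : ℕ → ℂ) (N : ℕ) : ℂ := (N : ℂ)⁻¹ * ∑ n ∈ Finset.range N, f n

lemma norm_cesaro_le {f : ℕ → ℂ} {C : ℝ} (hf : ∀ n, ‖f n‖ ≤ C) (N : ℕ) : ‖cesaro f N‖ ≤ C := by
  have hC : 0 ≤ C := (norm_nonneg _).trans (hf 0)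
  rcases Nat.eq_zero_or_pos N with rfl | hN
  · simpa [cesaro] using hC
  · have h1 : ‖∑ n ∈ Finset.range N, f n‖ ≤ N * C := by
      refine (norm_sum_le_of_le _ fun n _ => hf n).trans ?_
      simp
    have hN' : (0 : ℝ) < N := by exact_mod_cast hN
    rw [cesaro, norm_mul, norm_inv, Complex.norm_natCast, inv_mul_le_iff₀ hN']
    exact h1

lemma exists_isMean : ∃ m : (ℕ → ℂ) →ₗ[ℂ] ℂ, IsMean m := by
  classical
  let U : Ultrafilter ℕ := hyperfilter ℕ
  have hadd : ∀ f g, cesaro (f + g) = fun N => cesaro f N + cesaro g N := by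
    intro f g; funext N; simp [cesaro, Finset.sum_add_distrib, mul_add]
  have hsmul : ∀ (c : ℂ) f, cesaro (c • f) = fun N => c * cesaro f N := by
    intro c f; funext N; simp only [cesaro, Pi.smul_apply, smul_eq_mul, ← Finset.mul_sum]; ring
  let p : Submodule ℂ (ℕ → ℂ) :=
    { carrier := {f | ∃ l, Tendsto (cesaro f) U (𝓝 l)}
      add_mem' := by
        rintro f g ⟨l, hl⟩ ⟨l', hl'⟩
        exact ⟨l + l', by rw [hadd]; exact hl.add hl'⟩
      zero_mem' := ⟨0, by
        have : cesaro 0 = fun _ => 0 := by funext N; simp [cesaro]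
        rw [this]; exact tendsto_const_nhds⟩
      smul_mem' := by
        rintro c f ⟨l, hl⟩
        exact ⟨c * l, by rw [hsmul]; exact hl.const_mul c⟩ }
  choose lim hlim using fun f : p => f.2
  let m₀ : p →ₗ[ℂ] ℂ :=
    { toFun := lim
      map_add' := by
        intro f g
        refine tendsto_nhds_unique (hlim (f + g)) ?_
        have := (hlim f).add (hlim g)
        rw [Submodule.coe_add, hadd]; exact this
      map_smul' := by
        intro c f
        refine tendsto_nhds_unique (hlim (c • f)) ?_
        have := (hlim f).const_mul c
        rw [Submodule.coe_smul, hsmul]; exact this }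
  obtain ⟨m, hm⟩ := LinearMap.exists_extend m₀
  have key : ∀ (f : ℕ → ℂ) (C : ℝ), (∀ n, ‖f n‖ ≤ C) → Tendsto (cesaro f) U (𝓝 (m f)) := by
    intro f C hf
    have hfp : f ∈ p := by
      obtain ⟨l, -, hl⟩ := (isCompact_closedBall (0 : ℂ) C).ultrafilter_le_nhds
        (U.map (cesaro f)) (by
          rw [le_principal_iff]
          refine Ultrafilter.mem_map.mpr (Filter.univ_mem' fun N => ?_)
          simpa using norm_cesaro_le hf N)
      exact ⟨l, hl⟩
    have h1 : m f = lim ⟨f, hfp⟩ := by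
      exact LinearMap.congr_fun hm ⟨f, hfp⟩
    rw [h1]
    exact hlim ⟨f, hfp⟩
  have hUtop : (U : Filter ℕ) ≤ atTop := by
    simpa [U, Nat.cofinite_eq_atTop] using hyperfilter_le_cofinite (α := ℕ)
  refine ⟨m, ⟨?_, ?_, ?_, ?_, ?_⟩⟩
  · intro f C hf
    exact le_of_tendsto (key f C hf).norm (Eventually.of_forall fun N => norm_cesaro_le hf N)
  · intro f C hf
    have h1 := key (fun n => f (n + 1)) C fun n => hf _
    have h2 := key f C hf
    have h3 : Tendsto (fun N : ℕ => (N : ℂ)⁻¹ * (f N - f 0)) U (𝓝 0) := by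
      refine Tendsto.mono_left ?_ hUtop
      refine squeeze_zero_norm (a := fun N : ℕ => (N : ℝ)⁻¹ * (2 * C)) (fun N => ?_) ?_
      · rw [norm_mul, norm_inv, Complex.norm_natCast]
        refine mul_le_mul_of_nonneg_left ?_ (by positivity)
        refine (norm_sub_le _ _).trans ?_
        linarith [hf N, hf 0]
      · simpa using tendsto_inv_atTop_nhds_zero_nat (𝕜 := ℝ) |>.mul_const (2 * C)
    have h4 := h2.add h3
    rw [add_zero] at h4
    refine tendsto_nhds_unique h1 (h4.congr fun N => ?_)
    simp only [cesaro]
    rw [← mul_add]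
    congr 1
    have := Finset.sum_range_succ f N
    rw [Finset.sum_range_succ'] at this
    linear_combination -this
  · intro f C hf h0
    have h1 := (Complex.continuous_re.tendsto _).comp (key f C hf)
    refine ge_of_tendsto h1 (Eventually.of_forall fun N => ?_)
    have : cesaro f N = ((N : ℝ)⁻¹ : ℝ) * ∑ n ∈ Finset.range N, f n := by simp [cesaro]
    simp only [Function.comp, this, Complex.re_ofReal_mul, Complex.re_sum]
    exact mul_nonneg (by positivity) (Finset.sum_nonneg fun n _ => h0 n)
  · intro f C hf
    have h1 := key (fun n => conj (f n)) C fun n => by simpa using hf n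
    have h2 := (Complex.continuous_conj.tendsto _).comp (key f C hf)
    refine tendsto_nhds_unique h1 (h2.congr fun N => ?_)
    simp [cesaro]
  · have h1 := key (fun _ => 1) 1 fun n => by simp
    refine tendsto_nhds_unique h1 ?_
    refine Tendsto.mono_left ?_ hUtop
    refine tendsto_const_nhds.congr' ?_
    filter_upwards [eventually_gt_atTop 0] with N hN
    have : (N : ℂ) ≠ 0 := by exact_mod_cast hN.ne'
    simp [cesaro, this]

namespace IsMean

variable {m : (ℕ → ℂ) →ₗ[ℂ] ℂ}

lemma shift_nat (hm : IsMean m) {f : ℕ → ℂ} {C : ℝ} (hf : ∀ n, ‖f n‖ ≤ C) (h : ℕ) :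
    m (fun n => f (n + h)) = m f := by
  induction h with
  | zero => rfl
  | succ k ih =>
    rw [← ih, ← hm.shift (fun n => f (n + k)) C fun n => hf _]
    congr 1
    funext n
    congr 1
    ring

lemma map_sum_fun {ι : Type*} (s : Finset ι) (f : ι → ℕ → ℂ) :
    m (fun n => ∑ i ∈ s, f i n) = ∑ i ∈ s, m (f i) := by
  rw [← map_sum]; congr 1; funext n; simp

lemma map_const_mul (c : ℂ) (f : ℕ → ℂ) : m (fun n => c * f n) = c * m f := by
  rw [← smul_eq_mul c (m f), ← map_smul]; rfl

/-- The van der Corput inequality for a shift-invariant mean. -/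
lemma van_der_corput (hm : IsMean m) {f : ℕ → ℂ} (hf : ∀ n, ‖f n‖ ≤ 1) (H : ℕ) :
    (H : ℝ) ^ 2 * ‖m f‖ ^ 2 ≤ ∑ h ∈ Finset.range H, ∑ h' ∈ Finset.range H,
      ‖m fun n => f (n + h) * conj (f (n + h'))‖ := by
  set g : ℕ → ℂ := fun n => ∑ h ∈ Finset.range H, f (n + h) with hg
  have hgb : ∀ n, ‖g n‖ ≤ H := fun n =>
    (norm_sum_le_of_le _ fun h _ => hf (n + h)).trans (by simp)
  set c : ℂ := H * m f with hc
  have hmg : m g = c := by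
    rw [hg, map_sum_fun, hc]
    simp [hm.shift_nat hf]
  set F : ℕ → ℂ := fun n => (g n - c) * conj (g n - c) with hF
  have hFb : ∀ n, ‖F n‖ ≤ ((H : ℝ) + ‖c‖) * (H + ‖c‖) := by
    intro n
    have : ‖g n - c‖ ≤ H + ‖c‖ := (norm_sub_le _ _).trans (by linarith [hgb n])
    rw [hF, norm_mul, RCLike.norm_conj]
    gcongr
  have hF0 : ∀ n, 0 ≤ (F n).re := by
    intro n
    simp only [hF, Complex.mul_conj, Complex.ofReal_re]
    exact Complex.normSq_nonneg _
  have h1 := hm.nonneg F _ hFb hF0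
  have hF' : F = (fun n => g n * conj (g n)) - (fun n => conj c * g n) -
      (fun n => c * conj (g n)) + (fun _ => (c * conj c) * 1) := by
    funext n; simp [hF]; ring
  have h2 : m F = m (fun n => g n * conj (g n)) - c * conj c := by
    rw [hF', map_add, map_sub, map_sub, map_const_mul, map_const_mul, map_const_mul,
      hm.map_one, hm.map_conj g _ hgb, hmg]
    ring
  have h3 : m (fun n => g n * conj (g n)) = ∑ h ∈ Finset.range H, ∑ h' ∈ Finset.range H,
      m fun n => f (n + h) * conj (f (n + h')) := by
    rw [← Finset.sum_congr rfl fun h _ => map_sum_fun _ _, ← map_sum_fun]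
    congr 1
    funext n
    simp [hg, Finset.sum_mul_sum]
  have h4 : ‖m (fun n => g n * conj (g n))‖ ≤ ∑ h ∈ Finset.range H, ∑ h' ∈ Finset.range H,
      ‖m fun n => f (n + h) * conj (f (n + h'))‖ := by
    rw [h3]
    exact norm_sum_le_of_le _ fun h _ => norm_sum_le _ _
  have h5 : (c * conj c).re = (H : ℝ) ^ 2 * ‖m f‖ ^ 2 := by
    rw [Complex.mul_conj, Complex.ofReal_re, Complex.normSq_eq_norm_sq, hc, norm_mul,
      Complex.norm_natCast, mul_pow]
  rw [h2, Complex.sub_re, h5] at h1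
  linarith [Complex.re_le_norm (m (fun n => g n * conj (g n)))]

end IsMean

/-- A polynomial of degree at most `D` with coefficients in the circle. -/
noncomputable def polyT (D : ℕ) (θ : ℕ → Torus1) (n : ℕ) : Torus1 :=
  ∑ d ∈ Finset.range (D + 1), (n ^ d) • θ d

/-- The coefficients of the translate of a polynomial with coefficients in the circle. -/
noncomputable def shiftCoeff (D : ℕ) (θ : ℕ → Torus1) (h j : ℕ) : Torus1 :=
  ∑ d ∈ Finset.range (D + 1), (h ^ (d - j) * d.choose j) • θ d

lemma polyT_add (D : ℕ) (θ : ℕ → Torus1) (n h : ℕ) :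
    polyT D θ (n + h) = polyT D (shiftCoeff D θ h) n := by
  simp only [polyT, shiftCoeff, Finset.smul_sum]
  rw [Finset.sum_comm]
  refine Finset.sum_congr rfl fun d hd => ?_
  have hd' : d + 1 ≤ D + 1 := by simpa using hd
  rw [add_pow, Finset.sum_smul]
  rw [← Finset.sum_subset (Finset.range_mono hd')]
  · refine Finset.sum_congr rfl fun j _ => ?_
    rw [smul_smul, mul_assoc]
    rfl
  · intro j _ hj
    rw [Nat.choose_eq_zero_of_lt (by simpa using hj)]
    simp

lemma shiftCoeff_top (D : ℕ) (θ : ℕ → Torus1) (h : ℕ) : shiftCoeff D θ h D = θ D := by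
  rw [shiftCoeff, Finset.sum_range_succ, Finset.sum_eq_zero]
  · simp
  · intro d hd
    rw [Nat.choose_eq_zero_of_lt (by simpa using hd)]
    simp

lemma shiftCoeff_succ (D : ℕ) (θ : ℕ → Torus1) (h : ℕ) :
    shiftCoeff (D + 1) θ h D = θ D + (h * (D + 1)) • θ (D + 1) := by
  rw [shiftCoeff, Finset.sum_range_succ]
  have := shiftCoeff_top D θ h
  rw [shiftCoeff] at this
  rw [this]
  simp

namespace IsMean

variable {m : (ℕ → ℂ) →ₗ[ℂ] ℂ}

/-- Fourier expansion of a periodic factor of modulus at most one. -/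
lemma exists_twist {q : ℕ} (hq : 0 < q) {f : ℕ → ℂ} (hf : ∀ n, ‖f n‖ ≤ 1)
    (hper : ∀ n, f n = f (n % q)) (g : ℕ → ℂ) :
    ∃ ζ : Torus1, q • ζ = 0 ∧
      ‖m fun n => f n * g n‖ ≤ q * ‖m fun n => expT (n • ζ) * g n‖ := by
  have : NeZero q := ⟨hq.ne'⟩
  have hqC : (q : ℂ) ≠ 0 := by exact_mod_cast hq.ne'
  let T : ZMod q → ℝ := fun a => ‖m fun n => expT (n • ZMod.toAddCircle a) * g n‖
  obtain ⟨a₀, -, ha₀⟩ := Finset.exists_max_image Finset.univ T ⟨0, Finset.mem_univ _⟩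
  refine ⟨ZMod.toAddCircle a₀, ?_, ?_⟩
  · rw [← map_nsmul]; simp
  have hψ : ∀ x : ZMod q, ZMod.stdAddChar x = expT (ZMod.toAddCircle x) := fun x => rfl
  have hfe : ∀ n, f n = ∑ r : ZMod q, ∑ a : ZMod q,
      (f r.val / q * expT (ZMod.toAddCircle (-(a * r)))) * expT (n • ZMod.toAddCircle a) := by
    intro n
    have h1 : ∀ r : ZMod q, ∑ a : ZMod q,
        (f r.val / q * expT (ZMod.toAddCircle (-(a * r)))) * expT (n • ZMod.toAddCircle a)
        = f r.val / q * if (n : ZMod q) - r = 0 then (q : ℂ) else 0 := by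
      intro r
      have h2 := AddChar.sum_mulShift ((n : ZMod q) - r) (ZMod.isPrimitive_stdAddChar q)
      rw [ZMod.card] at h2
      push_cast at h2
      rw [← h2, Finset.mul_sum]
      refine Finset.sum_congr rfl fun a _ => ?_
      rw [mul_assoc, ← expT_add, ← map_nsmul, ← map_add, hψ]
      congr 4
      rw [nsmul_eq_mul]
      ring
    rw [Finset.sum_congr rfl fun r _ => h1 r, Finset.sum_eq_single (n : ZMod q)]
    · rw [ZMod.val_natCast, ← hper]
      simp [hqC]
    · intro r _ hr
      rw [if_neg (sub_ne_zero.mpr hr.symm), mul_zero]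
    · simp
  have hmf : m (fun n => f n * g n) = ∑ r : ZMod q, ∑ a : ZMod q,
      (f r.val / q * expT (ZMod.toAddCircle (-(a * r)))) *
        m (fun n => expT (n • ZMod.toAddCircle a) * g n) := by
    simp only [← map_const_mul]
    rw [← Finset.sum_congr rfl fun r _ => map_sum_fun _ _, ← map_sum_fun]
    congr 1
    funext n
    rw [hfe n, Finset.sum_mul]
    refine Finset.sum_congr rfl fun r _ => ?_
    rw [Finset.sum_mul]
    exact Finset.sum_congr rfl fun a _ => by ring
  rw [hmf]
  refine (norm_sum_le_of_le _ fun r _ => norm_sum_le_of_le (f := fun a => _)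
    (n := fun _ => (1 / q : ℝ) * T a₀) _ fun a _ => ?_).trans ?_
  · rw [norm_mul, norm_mul, norm_expT, norm_div, Complex.norm_natCast, mul_one]
    have := hf r.val
    have h3 := ha₀ a (Finset.mem_univ _)
    gcongr
  · simp only [Finset.sum_const, Finset.card_univ, ZMod.card, nsmul_eq_mul]
    have hqR : (q : ℝ) ≠ 0 := by exact_mod_cast hq.ne'
    refine le_of_eq ?_
    change (q : ℝ) * (q * (1 / q * T a₀)) = q * T a₀
    field_simp

/-- A large value of the mean of a polynomial phase forces a small common denominator of the
nonconstant coefficients. -/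
theorem exists_denominator (hm : IsMean m) (D : ℕ) : ∃ c k : ℕ, 0 < c ∧
    ∀ (θ : ℕ → Torus1) (R : ℕ), 0 < R →
      1 / (R : ℝ) ≤ ‖m fun n => expT (polyT (D + 1) θ n)‖ →
      ∃ q : ℕ, 0 < q ∧ q ≤ c * R ^ k ∧ ∀ d, 1 ≤ d → d ≤ D + 1 → q • θ d = 0 := by
  induction D with
  | zero =>
    refine ⟨1, 0, one_pos, fun θ R hR h => ⟨1, one_pos, by simp, ?_⟩⟩
    have hs := hm.shift (fun n => expT (polyT 1 θ n)) 1 fun n => by simp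
    have h1 : (fun n => expT (polyT 1 θ (n + 1))) =
        fun n => expT (θ 1) * expT (polyT 1 θ n) := by
      funext n
      rw [← expT_add]
      congr 1
      simp [polyT, Finset.sum_range_succ, add_smul]
      abel
    rw [zero_add] at h
    rw [h1, map_const_mul] at hs
    have hne : m (fun n => expT (polyT 1 θ n)) ≠ 0 := by
      intro h0
      rw [h0, norm_zero] at h
      have : (0 : ℝ) < 1 / R := by positivity
      linarith
    have h2 : expT (θ 1) = 1 := mul_right_cancel₀ hne (by rw [hs, one_mul])
    intro d h1 h2'
    obtain rfl : d = 1 := by omega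
    rw [one_smul]
    exact (expT_eq_one_iff _).mp h2
  | succ D ih =>
    obtain ⟨c, k, hc, ih⟩ := ih
    set c₀ := c * 2 ^ k * (D + 2) * 4 with hc₀
    set k₀ := 2 * k + 2 with hk₀
    refine ⟨c₀ * (c * c₀ ^ k), k₀ + (1 + k₀) * k, by positivity, fun θ R hR h => ?_⟩
    have hR' : (0 : ℝ) < R := by exact_mod_cast hR
    set f : ℕ → ℂ := fun n => expT (polyT (D + 1 + 1) θ n) with hf
    have hf1 : ∀ n, ‖f n‖ ≤ 1 := fun n => by simp [hf]
    -- two shifts whose difference polynomial correlates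
    obtain ⟨a, ha, b, hb, hab, hlarge⟩ : ∃ a < 4 * R ^ 2, ∃ b < 4 * R ^ 2, a ≠ b ∧
        1 / ((2 * R ^ 2 : ℕ) : ℝ) ≤ ‖m fun n => f (n + a) * conj (f (n + b))‖ := by
      by_contra! hcon
      have hv := hm.van_der_corput hf1 (4 * R ^ 2)
      have hle : ∑ a ∈ Finset.range (4 * R ^ 2), ∑ b ∈ Finset.range (4 * R ^ 2),
          ‖m fun n => f (n + a) * conj (f (n + b))‖ ≤
          ∑ a ∈ Finset.range (4 * R ^ 2), ∑ b ∈ Finset.range (4 * R ^ 2),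
          (1 / ((2 * R ^ 2 : ℕ) : ℝ) + if a = b then 1 else 0) := by
        refine Finset.sum_le_sum fun a ha => Finset.sum_le_sum fun b hb => ?_
        by_cases hab : a = b
        · rw [if_pos hab]
          have : ‖m fun n => f (n + a) * conj (f (n + b))‖ ≤ 1 :=
            hm.norm_le _ 1 fun n => by simp [hf]
          have h0 : (0 : ℝ) ≤ 1 / ((2 * R ^ 2 : ℕ) : ℝ) := by positivity
          linarith
        · rw [if_neg hab, add_zero]
          exact (hcon a (by simpa using ha) b (by simpa using hb) hab).le
      have hsum : ∑ a ∈ Finset.range (4 * R ^ 2), ∑ b ∈ Finset.range (4 * R ^ 2),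
          (1 / ((2 * R ^ 2 : ℕ) : ℝ) + if a = b then (1 : ℝ) else 0) = 12 * (R : ℝ) ^ 2 := by
        simp only [Finset.sum_add_distrib, Finset.sum_const, Finset.card_range, nsmul_eq_mul,
          Finset.sum_ite_eq]
        rw [Finset.sum_congr rfl fun a ha => if_pos ha]
        simp only [Finset.sum_const, Finset.card_range, nsmul_eq_mul]
        push_cast
        field_simp
        ring
      have hlow : (1 : ℝ) / R ^ 2 ≤ ‖m f‖ ^ 2 := by
        rw [show (1 : ℝ) / R ^ 2 = (1 / R) ^ 2 by rw [div_pow, one_pow]]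
        exact pow_le_pow_left₀ (by positivity) h 2
      have h16 : (((4 * R ^ 2 : ℕ) : ℝ)) ^ 2 * (1 / R ^ 2) = 16 * (R : ℝ) ^ 2 := by
        push_cast; field_simp; ring
      have h17 : (((4 * R ^ 2 : ℕ) : ℝ)) ^ 2 * (1 / R ^ 2) ≤
          (((4 * R ^ 2 : ℕ) : ℝ)) ^ 2 * ‖m f‖ ^ 2 := by gcongr
      have : (0 : ℝ) < R ^ 2 := by positivity
      linarith
    set θ' : ℕ → Torus1 := fun j =>
      shiftCoeff (D + 1 + 1) θ a j - shiftCoeff (D + 1 + 1) θ b j with hθ'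
    have hdiff : (fun n => f (n + a) * conj (f (n + b))) =
        fun n => expT (polyT (D + 1) θ' n) := by
      funext n
      simp only [hf]
      rw [← expT_sub, polyT_add, polyT_add, polyT, polyT, Finset.sum_range_succ,
        Finset.sum_range_succ _ (D + 1 + 1), shiftCoeff_top, shiftCoeff_top, polyT,
        add_sub_add_right_eq_sub, ← Finset.sum_sub_distrib]
      simp only [hθ', smul_sub]
    rw [hdiff] at hlarge
    obtain ⟨q', hq', hq'le, hkill⟩ := ih θ' (2 * R ^ 2) (by positivity) hlarge
    have hk1 := hkill (D + 1) (by omega) le_rfl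
    set q₀ := q' * (D + 2) * ((a : ℤ) - b).natAbs with hq₀
    have hab' : (a : ℤ) - b ≠ 0 := sub_ne_zero.mpr (by exact_mod_cast hab)
    have hq₀pos : 0 < q₀ := by
      have := Int.natAbs_pos.mpr hab'
      positivity
    have hq₀kill : q₀ • θ (D + 1 + 1) = 0 := by
      have h1 : ((q' : ℤ) * (D + 2) * ((a : ℤ) - b)) • θ (D + 1 + 1) = 0 := by
        rw [← hk1, hθ']
        simp only [shiftCoeff_succ, add_sub_add_left_eq_sub]
        rw [← natCast_zsmul, ← natCast_zsmul, ← natCast_zsmul, ← sub_smul, smul_smul]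
        congr 1
        push_cast
        ring
      rw [← natCast_zsmul, hq₀]
      push_cast
      rcases abs_choice ((a : ℤ) - b) with h2 | h2
      · rw [h2]; exact h1
      · rw [h2, mul_neg, neg_smul, h1, neg_zero]
    have hq₀le : q₀ ≤ c₀ * R ^ k₀ := by
      have h1 : ((a : ℤ) - b).natAbs ≤ 4 * R ^ 2 := by omega
      calc q₀ ≤ (c * (2 * R ^ 2) ^ k) * (D + 2) * (4 * R ^ 2) := by
            rw [hq₀]; gcongr
        _ = c₀ * R ^ k₀ := by rw [hc₀, hk₀]; ring
    -- remove the leading coefficient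
    have hsplit : f = fun n => expT ((n ^ (D + 1 + 1)) • θ (D + 1 + 1)) *
        expT (polyT (D + 1) θ n) := by
      funext n
      rw [hf, ← expT_add]
      simp only
      rw [polyT, Finset.sum_range_succ, add_comm, polyT]
    have hper : ∀ n : ℕ, expT ((n ^ (D + 1 + 1)) • θ (D + 1 + 1)) =
        expT (((n % q₀) ^ (D + 1 + 1)) • θ (D + 1 + 1)) := by
      intro n
      congr 1
      have hmod : ∀ x : ℕ, x • θ (D + 1 + 1) = (x % q₀) • θ (D + 1 + 1) := by
        intro x
        conv_lhs => rw [← Nat.mod_add_div x q₀]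
        rw [add_smul, mul_comm, mul_smul, hq₀kill, smul_zero, add_zero]
      rw [hmod, Nat.pow_mod, ← hmod]
    obtain ⟨ζ, hζ, htw⟩ := exists_twist (m := m) hq₀pos
      (f := fun n => expT ((n ^ (D + 1 + 1)) • θ (D + 1 + 1))) (fun n => by simp) hper
      (fun n => expT (polyT (D + 1) θ n))
    set θ'' : ℕ → Torus1 := Function.update θ 1 (θ 1 + ζ) with hθ''
    have htw' : (fun n : ℕ => expT (n • ζ) * expT (polyT (D + 1) θ n)) =
        fun n => expT (polyT (D + 1) θ'' n) := by
      funext n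
      rw [← expT_add]
      congr 1
      have h1 : ∀ d, (n ^ d) • θ'' d = (n ^ d) • θ d + if d = 1 then n • ζ else 0 := by
        intro d
        by_cases hd : d = 1
        · subst hd; simp [hθ'']
        · simp [hθ'', hd]
      simp only [polyT, h1, Finset.sum_add_distrib, Finset.sum_ite_eq', Finset.mem_range]
      rw [if_pos (by omega), add_comm]
    rw [htw', ← hsplit] at htw
    have hlarge2 : 1 / ((R * q₀ : ℕ) : ℝ) ≤ ‖m fun n => expT (polyT (D + 1) θ'' n)‖ := by
      have hq₀R : (0 : ℝ) < q₀ := by exact_mod_cast hq₀pos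
      push_cast
      rw [div_mul_eq_div_div, div_le_iff₀ hq₀R, mul_comm]
      exact h.trans htw
    obtain ⟨q'', hq'', hq''le, hkill2⟩ := ih θ'' (R * q₀) (by positivity) hlarge2
    refine ⟨q₀ * q'', by positivity, ?_, ?_⟩
    · calc q₀ * q'' ≤ (c₀ * R ^ k₀) * (c * (R * (c₀ * R ^ k₀)) ^ k) := by
            refine Nat.mul_le_mul hq₀le (hq''le.trans ?_)
            gcongr
        _ = c₀ * (c * c₀ ^ k) * R ^ (k₀ + (1 + k₀) * k) := by
            clear_value c₀ k₀; simp only [mul_pow, pow_add, add_mul, one_mul, pow_mul]; ring1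
    · intro d hd1 hd2
      rcases eq_or_lt_of_le hd2 with rfl | hd3
      · rw [mul_comm, mul_smul, hq₀kill, smul_zero]
      · have h1 := hkill2 d hd1 (by omega)
        by_cases hd : d = 1
        · subst hd
          rw [hθ'', Function.update_self, smul_add] at h1
          rw [mul_smul, eq_neg_of_add_eq_zero_left h1, smul_neg, smul_comm, hζ, smul_zero,
            neg_zero]
        · rw [hθ'', Function.update_of_ne hd] at h1
          rw [mul_smul, h1, smul_zero]

end IsMean

/-- The pairing of an integer vector with a point of the torus. -/
noncomputable def pairT {L : ℕ} (v : Fin L → ℤ) (t : Fin L → Torus1) : Torus1 :=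
  ∑ i, v i • t i

/-- The squared cosine `cos² (πx)` on the circle. -/
noncomputable def cosSq (x : Torus1) : ℝ := (1 + (expT x).re) / 2

lemma cosSq_nonneg (x : Torus1) : 0 ≤ cosSq x := by
  have h := (abs_le.mp (Complex.abs_re_le_norm (expT x))).1
  rw [norm_expT] at h
  unfold cosSq
  linarith

lemma cosSq_le (x : Torus1) : cosSq x ≤ 1 - 4 * ‖x‖ ^ 2 := by
  obtain ⟨y, hy, rfl⟩ : ∃ y : ℝ, |y| ≤ 1 / 2 ∧ (y : Torus1) = x := by
    induction x using QuotientAddGroup.induction_on with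
    | H z =>
      refine ⟨z - round z, abs_sub_round z, ?_⟩
      rw [AddCircle.coe_sub, sub_eq_self]
      rw [AddCircle.coe_eq_zero_iff]
      exact ⟨round z, by simp⟩
  have hn : ‖(y : Torus1)‖ = |y| := by
    rw [AddCircle.norm_coe_eq_abs_iff _ one_ne_zero]; simpa using hy
  have he : (expT (y : Torus1)).re = Real.cos (2 * (Real.pi * |y|)) := by
    rw [expT, AddCircle.toCircle_apply_mk, Circle.coe_exp, Complex.exp_ofReal_mul_I_re]
    rw [← Real.cos_abs, abs_mul, abs_of_pos (by positivity)]
    congr 1; ring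
  have hs := Real.mul_le_sin (x := Real.pi * |y|) (by positivity)
    (by nlinarith [Real.pi_pos])
  have h2 : 2 / Real.pi * (Real.pi * |y|) = 2 * |y| := by
    field_simp
  rw [h2] at hs
  rw [cosSq, he, hn, Real.cos_two_mul, Real.cos_sq']
  nlinarith [abs_nonneg y]

lemma cosSq_pow_eq (M : ℕ) (x : Torus1) :
    ∑ k ∈ Finset.Icc (-(M : ℤ)) M,
      (((2 * M).choose (k + M).toNat / 4 ^ M : ℝ) : ℂ) * expT (k • x) = (cosSq x ^ M : ℝ) := by
  have hz : expT x * conj (expT x) = 1 := by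
    rw [Complex.mul_conj, Complex.normSq_eq_norm_sq]; simp
  have h1 : ∑ k ∈ Finset.Icc (-(M : ℤ)) M,
      (((2 * M).choose (k + M).toNat / 4 ^ M : ℝ) : ℂ) * expT (k • x) =
      ∑ j ∈ Finset.range (2 * M + 1),
        (expT x ^ j * 1 ^ (2 * M - j) * (2 * M).choose j) * (conj (expT x) ^ M / 4 ^ M) := by
    refine Finset.sum_nbij' (fun k => (k + M).toNat) (fun j => (j : ℤ) - M) ?_ ?_ ?_ ?_ ?_
    · intro k hk; simp at hk ⊢; omega
    · intro k hk; simp at hk ⊢; omega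
    · intro k hk; simp at hk ⊢; omega
    · intro k hk; simp
    · intro k hk
      simp only [Finset.mem_Icc] at hk
      have hk' : k = ((k + M).toNat : ℤ) - M := by omega
      have he : expT (k • x) = expT x ^ (k + M).toNat * conj (expT x) ^ M := by
        conv_lhs => rw [hk', sub_smul, natCast_zsmul, natCast_zsmul]
        rw [expT_sub, expT_nsmul, expT_nsmul, map_pow]
      rw [he]
      push_cast
      ring
  rw [h1, ← Finset.sum_mul, ← add_pow, pow_mul, ← div_pow, ← mul_pow]
  push_cast
  congr 1
  have h2 : expT x + conj (expT x) = ((2 * (expT x).re : ℝ) : ℂ) := Complex.add_conj _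
  rw [cosSq]
  push_cast at h2 ⊢
  linear_combination (1 / 4 : ℂ) * h2 + (expT x / 4 + 1 / 2 : ℂ) * hz

/-- A nonnegative trigonometric polynomial with nonnegative coefficients that is exponentially
small away from the origin. -/
lemma exists_kernel (L M : ℕ) (hM : 0 < M) :
    ∃ (J : Finset (Fin L → ℤ)) (c : (Fin L → ℤ) → ℝ),
      (∀ v ∈ J, ∀ i, |v i| ≤ (M : ℤ)) ∧ (∀ v ∈ J, 0 ≤ c v) ∧ ∑ v ∈ J, c v = 1 ∧ 0 ∈ J ∧
      1 / (2 * M : ℝ) ^ L ≤ c 0 ∧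
      ∀ t : Fin L → Torus1, ∃ F : ℝ, ∑ v ∈ J, (c v : ℂ) * expT (pairT v t) = F ∧
        ∀ i, F ≤ Real.exp (-(4 * ‖t i‖ ^ 2 * M)) := by
  classical
  let c : (Fin L → ℤ) → ℝ := fun v => ∏ i, ((2 * M).choose (v i + M).toNat / 4 ^ M : ℝ)
  let J : Finset (Fin L → ℤ) := Fintype.piFinset fun _ => Finset.Icc (-(M : ℤ)) M
  have hexp : ∀ t : Fin L → Torus1, ∑ v ∈ J, (c v : ℂ) * expT (pairT v t) =
      ((∏ i, cosSq (t i) ^ M : ℝ) : ℂ) := by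
    intro t
    have hpair : ∀ v : Fin L → ℤ, expT (pairT v t) = ∏ i, expT (v i • t i) := by
      intro v
      unfold pairT
      induction (Finset.univ : Finset (Fin L)) using Finset.induction_on with
      | empty => simp
      | insert a s ha ih => rw [Finset.sum_insert ha, Finset.prod_insert ha, expT_add, ih]
    rw [Complex.ofReal_prod, ← Finset.prod_congr rfl fun i _ => cosSq_pow_eq M (t i),
      Finset.prod_univ_sum]
    refine Finset.sum_congr rfl fun v _ => ?_
    rw [hpair, Finset.prod_mul_distrib, Complex.ofReal_prod]
  refine ⟨J, c, ?_, ?_, ?_, ?_, ?_, ?_⟩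
  · intro v hv i
    have := Fintype.mem_piFinset.mp hv i
    rw [abs_le]
    simpa using this
  · intro v _
    exact Finset.prod_nonneg fun i _ => by positivity
  · have := hexp 0
    have h0 : ∀ v : Fin L → ℤ, pairT v 0 = 0 := fun v => by simp [pairT]
    simp only [h0, expT_zero, mul_one, Pi.zero_apply, cosSq, Complex.one_re] at this
    norm_num at this
    exact_mod_cast this
  · exact Fintype.mem_piFinset.mpr fun i => by simp
  · have h1 : (4 : ℝ) ^ M ≤ 2 * M * M.centralBinom := by
      exact_mod_cast Nat.four_pow_le_two_mul_self_mul_centralBinom M hM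
    have hM' : (0 : ℝ) < M := by exact_mod_cast hM
    simp only [c, Pi.zero_apply, zero_add, Int.toNat_natCast, Finset.prod_const,
      Finset.card_univ, Fintype.card_fin]
    rw [← _root_.one_div_pow]
    refine pow_le_pow_left₀ (by positivity) ?_ L
    rw [div_le_div_iff₀ (by positivity) (by positivity), one_mul, mul_comm]
    exact h1
  · intro t
    refine ⟨_, hexp t, fun i => ?_⟩
    have hle1 : ∀ x, cosSq x ≤ 1 := fun x => (cosSq_le x).trans (by nlinarith [norm_nonneg x])
    calc ∏ i, cosSq (t i) ^ M ≤ cosSq (t i) ^ M := by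
          rw [← Finset.mul_prod_erase _ _ (Finset.mem_univ i)]
          refine mul_le_of_le_one_right (pow_nonneg (cosSq_nonneg _) _) ?_
          exact Finset.prod_le_one (fun j _ => pow_nonneg (cosSq_nonneg _) _)
            fun j _ => pow_le_one₀ (cosSq_nonneg _) (hle1 _)
      _ ≤ Real.exp (-(4 * ‖t i‖ ^ 2)) ^ M := by
          refine pow_le_pow_left₀ (cosSq_nonneg _) ((cosSq_le _).trans ?_) M
          linarith [Real.add_one_le_exp (-(4 * ‖t i‖ ^ 2))]
      _ = _ := by
          rw [← Real.exp_nat_mul]; congr 1; ring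

section Pairing

variable {L N : ℕ}

lemma pairT_sub (v : Fin L → ℤ) (s t : Fin L → Torus1) :
    pairT v (s - t) = pairT v s - pairT v t := by
  simp [pairT, smul_sub]

/-- The pairing as a linear map in the integer vector. -/
noncomputable def pairTLin (t : Fin L → Torus1) : (Fin L → ℤ) →ₗ[ℤ] Torus1 where
  toFun v := pairT v t
  map_add' v w := by simp [pairT, add_smul, Finset.sum_add_distrib]
  map_smul' c v := by simp [pairT, mul_smul, Finset.smul_sum]

/-- The pairing with the image of a matrix, as a homomorphism. -/
noncomputable def pairHom (v : Fin L → ℤ) (A : Matrix (Fin L) (Fin N) ℤ) :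
    (Fin N → Torus1) →+ Torus1 where
  toFun x := pairT v (torusAct A x)
  map_zero' := by simp [pairT, torusAct]
  map_add' x y := by simp [pairT, torusAct, smul_add, Finset.sum_add_distrib]

lemma pairHom_eq (v : Fin L → ℤ) (A : Matrix (Fin L) (Fin N) ℤ) (x : Fin N → Torus1) :
    pairHom v A x = pairT (v ᵥ* A) x := by
  simp only [pairHom, AddMonoidHom.coe_mk, ZeroHom.coe_mk, pairT, torusAct, Finset.smul_sum,
    Matrix.vecMul, dotProduct, Finset.sum_smul, mul_smul]
  exact Finset.sum_comm

lemma pairT_eq_zero_of_mem_span {S : Set (Fin L → ℤ)} {t : Fin L → Torus1}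
    (hS : ∀ s ∈ S, pairT s t = 0) {w : Fin L → ℤ} (hw : w ∈ Submodule.span ℤ S) :
    pairT w t = 0 := by
  have : Submodule.span ℤ S ≤ LinearMap.ker (pairTLin t) := Submodule.span_le.mpr hS
  exact this hw

lemma nsmul_pairT (m : ℕ) (w : Fin L → ℤ) (t : Fin L → Torus1) :
    m • pairT w t = pairT ((m : ℤ) • w) t := by
  have := (pairTLin t).map_smul (m : ℤ) w
  rw [natCast_zsmul] at this
  exact this.symm

/-- The set of `m`-torsion points of the circle. -/
noncomputable def torsionT (m : ℕ) : Finset Torus1 :=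
  open Classical in (Finset.range m).image fun k : ℕ => ((((k : ℝ) / m * 1 : ℝ)) : Torus1)

lemma card_torsionT_le (m : ℕ) : (torsionT m).card ≤ m :=
  Finset.card_image_le.trans (Finset.card_range m).le

lemma mem_torsionT {m : ℕ} (hm : 0 < m) {x : Torus1} (hx : m • x = 0) : x ∈ torsionT m := by
  obtain ⟨k, hk, rfl⟩ := (AddCircle.nsmul_eq_zero_iff hm).mp hx
  exact Finset.mem_image.mpr ⟨k, by simpa using hk, rfl⟩

lemma exists_fiber {α β : Type*} [DecidableEq β] (s : Finset α) (t : Finset β) (f : α → β)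
    (ht : t.Nonempty) (hf : ∀ a ∈ s, f a ∈ t) :
    ∃ b ∈ t, s.card ≤ t.card * {a ∈ s | f a = b}.card := by
  obtain ⟨b, hb, hmax⟩ := Finset.exists_max_image t (fun b => {a ∈ s | f a = b}.card) ht
  refine ⟨b, hb, ?_⟩
  rw [mul_comm]
  exact Finset.card_le_mul_card_image_of_maps_to hf _ hmax

/-- Pigeonhole principle for homomorphisms whose values on differences are torsion. -/
lemma exists_subset_forall_eq_zero {G ι : Type*} [AddCommGroup G] [Fintype ι]
    (f : ι → G →+ Torus1) {m : ℕ} (hm : 0 < m) (X : Finset G)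
    (hX : ∀ x ∈ X, ∀ y ∈ X, ∀ i, m • f i (x - y) = 0) :
    ∃ Y ⊆ X, X.card ≤ m ^ Fintype.card ι * Y.card ∧ ∀ x ∈ Y, ∀ y ∈ Y, ∀ i, f i (x - y) = 0 := by
  classical
  rcases X.eq_empty_or_nonempty with rfl | ⟨x₀, hx₀⟩
  · exact ⟨∅, by simp, by simp, by simp⟩
  have hmaps : ∀ x ∈ X, (fun i => f i (x - x₀)) ∈ Fintype.piFinset fun _ : ι => torsionT m :=
    fun x hx => Fintype.mem_piFinset.mpr fun i => mem_torsionT hm (hX x hx x₀ hx₀ i)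
  obtain ⟨b, -, hb⟩ := exists_fiber X _ (fun x i => f i (x - x₀)) ⟨_, hmaps x₀ hx₀⟩ hmaps
  refine ⟨{x ∈ X | (fun i => f i (x - x₀)) = b}, Finset.filter_subset _ _, hb.trans ?_, ?_⟩
  · refine Nat.mul_le_mul_right _ ?_
    rw [Fintype.card_piFinset, Finset.prod_const, Finset.card_univ]
    exact Nat.pow_le_pow_left (card_torsionT_le m) _
  · intro x hx y hy i
    have h1 := congrFun (Finset.mem_filter.mp hx).2 i
    have h2 := congrFun (Finset.mem_filter.mp hy).2 i
    have : x - y = (x - x₀) - (y - x₀) := by abel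
    rw [this, map_sub, h1, h2, sub_self]

end Pairing

section Saturation

variable {L N D : ℕ}

lemma abs_le_starNorm (A : Fin (D + 1) → Matrix (Fin L) (Fin N) ℤ) {d : Fin (D + 1)}
    (hd : d ≠ 0) (i : Fin L) (j : Fin N) : |A d i j| ≤ (starNorm A : ℤ) := by
  have h1 : (A d i j).natAbs ≤ starNorm A := by
    refine le_trans ?_ (Finset.le_sup (f := fun d => Finset.univ.sup
      fun p : Fin L × Fin N => (A d p.1 p.2).natAbs) (Finset.mem_filter.mpr ⟨Finset.mem_univ d, hd⟩))
    exact Finset.le_sup (f := fun p : Fin L × Fin N => (A d p.1 p.2).natAbs)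
      (Finset.mem_univ (i, j))
  rw [Int.abs_eq_natAbs]
  exact_mod_cast h1

lemma CondA.starNorm_pos {A : Fin (D + 1) → Matrix (Fin L) (Fin N) ℤ} (hA : CondA A)
    (hN : 0 < N) : 0 < starNorm A := by
  by_contra h
  have h0 : starNorm A = 0 := by omega
  have h1 := hA (fun _ => 1) fun d hd => by
    have : A d = 0 := by
      ext i j
      have := abs_le_starNorm A hd i j
      rw [h0] at this
      simpa using this
    rw [this]
    funext i
    simp [Matrix.mulVec, dotProduct]
  have := congrFun h1 ⟨0, hN⟩
  simp at this

/-- All integer vectors in the rational span of `S` annihilate the images of differences of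
points of `Y` under every coefficient matrix. -/
def Annihilates (A : Fin (D + 1) → Matrix (Fin L) (Fin N) ℤ) (S : Set (Fin L → ℤ))
    (Y : Finset (Fin N → Torus1)) : Prop :=
  ∀ w : Fin L → ℤ, ratVec w ∈ Submodule.span ℚ (ratVec '' S) →
    ∀ d, ∀ x ∈ Y, ∀ y ∈ Y, pairHom w (A d) (x - y) = 0

lemma CondB.ratVec_vecMul_mem_span {A : Fin (D + 1) → Matrix (Fin L) (Fin N) ℤ} (hB : CondB A)
    (v : Fin L → ℤ) : ratVec (v ᵥ* A 0) ∈
      Submodule.span ℚ (ratVec '' Set.range fun d : Fin D => v ᵥ* A d.succ) := by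
  refine mem_span_of_forall_dotProduct _ _ fun w hw => ?_
  rw [ratVec_vecMul, ← Matrix.dotProduct_mulVec]
  refine hB (ratVec v) w fun d hd => ?_
  obtain ⟨e, rfl⟩ := Fin.exists_succ_eq.mpr hd
  rw [Matrix.dotProduct_mulVec, ← ratVec_vecMul]
  exact hw _ ⟨_, ⟨e, rfl⟩, rfl⟩

/-- Adjoining a vector to the annihilating set, at the cost of passing to a subset. -/
lemma Annihilates.insert {A : Fin (D + 1) → Matrix (Fin L) (Fin N) ℤ} (hB : CondB A)
    (hL : 0 < L) (ha : 0 < starNorm A) {M : ℕ} (hM : 0 < M) {S : Set (Fin L → ℤ)}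
    (hS : ∀ s ∈ S, ∀ i, |s i| ≤ (M : ℤ)) {Y Y₁ : Finset (Fin N → Torus1)} (hY : Annihilates A S Y)
    (hY₁ : Y₁ ⊆ Y) {v : Fin L → ℤ} (hv : ∀ i, |v i| ≤ (M : ℤ)) {q : ℕ} (hq : 0 < q)
    (hqv : ∀ d : Fin D, ∀ x ∈ Y₁, ∀ y ∈ Y₁, q • pairHom v (A d.succ) (x - y) = 0) :
    ∃ Y₂ ⊆ Y₁, Annihilates A (Insert.insert v S) Y₂ ∧
      Y₁.card ≤ q ^ D * (N.factorial * (L * (M * starNorm A)) ^ N) *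
        (L.factorial * M ^ L) ^ (L * (D + 1)) * Y₂.card := by
  obtain ⟨Z₁, hZ₁, hZ₁c, hZ₁v⟩ :=
    exists_subset_forall_eq_zero (fun d : Fin D => pairHom v (A d.succ)) hq Y₁
      fun x hx y hy d => hqv d x hx y hy
  rw [Fintype.card_fin] at hZ₁c
  -- the constant term
  obtain ⟨m₁, hm₁, hm₁le, hm₁s⟩ := exists_smul_mem_span
    (Set.range fun d : Fin D => v ᵥ* A d.succ) (L * (M * starNorm A))
    (Nat.mul_pos hL (Nat.mul_pos hM ha)) (by
      rintro _ ⟨d, rfl⟩ j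
      have hle : ∑ i, |v i * A d.succ i j| ≤ ∑ _i : Fin L, (M : ℤ) * (starNorm A : ℤ) :=
        Finset.sum_le_sum fun i _ => by
          rw [abs_mul]
          exact mul_le_mul (hv i) (abs_le_starNorm A (Fin.succ_ne_zero d) i j) (abs_nonneg _)
            (by positivity)
      refine (Finset.abs_sum_le_sum_abs (fun i => v i * A d.succ i j) Finset.univ).trans
        (hle.trans ?_)
      simp)
  obtain ⟨Z₂, hZ₂, hZ₂c, hZ₂v⟩ :=
    exists_subset_forall_eq_zero (fun _ : Unit => pairHom v (A 0)) hm₁ Z₁ (by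
      intro x hx y hy _
      rw [pairHom_eq, nsmul_pairT]
      refine pairT_eq_zero_of_mem_span ?_ (hm₁s _ (hB.ratVec_vecMul_mem_span v))
      rintro _ ⟨d, rfl⟩
      rw [← pairHom_eq]
      exact hZ₁v x hx y hy d)
  rw [Fintype.card_unit, pow_one] at hZ₂c
  have hv0 : ∀ d, ∀ x ∈ Z₂, ∀ y ∈ Z₂, pairHom v (A d) (x - y) = 0 := by
    intro d x hx y hy
    refine Fin.cases ?_ (fun d => ?_) d
    · exact hZ₂v x hx y hy ()
    · exact hZ₁v x (hZ₂ hx) y (hZ₂ hy) d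
  -- saturation
  obtain ⟨m₂, hm₂, hm₂le, hm₂s⟩ := exists_smul_mem_span (Insert.insert v S) M hM (by
    rintro s (rfl | hs)
    · exact hv
    · exact hS s hs)
  let ratLin : (Fin L → ℤ) →ₗ[ℤ] (Fin L → ℚ) :=
    { toFun := ratVec
      map_add' := fun x y => by funext i; simp [ratVec]
      map_smul' := fun x y => by funext i; simp [ratVec] }
  let Λ : Submodule ℤ (Fin L → ℤ) :=
    ((Submodule.span ℚ (ratVec '' (Insert.insert v S))).restrictScalars ℤ).comap ratLin
  have hΛ : ∀ w, w ∈ Λ ↔ ratVec w ∈ Submodule.span ℚ (ratVec '' (Insert.insert v S)) :=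
    fun w => Iff.rfl
  let b := Module.finBasis ℤ Λ
  have hr : Module.finrank ℤ Λ ≤ L := (Submodule.finrank_le Λ).trans (by simp)
  obtain ⟨Z₃, hZ₃, hZ₃c, hZ₃v⟩ := exists_subset_forall_eq_zero
    (fun p : Fin (Module.finrank ℤ Λ) × Fin (D + 1) => pairHom (b p.1 : Fin L → ℤ) (A p.2))
    hm₂ Z₂ (by
      intro x hx y hy p
      have hgen : ∀ s ∈ Insert.insert v S, pairT s (torusAct (A p.2) (x - y)) = 0 := by
        rintro s (rfl | hs)
        · exact hv0 p.2 x hx y hy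
        · exact hY s (Submodule.subset_span ⟨s, hs, rfl⟩) p.2 x (hY₁ (hZ₁ (hZ₂ hx))) y
            (hY₁ (hZ₁ (hZ₂ hy)))
      change m₂ • pairT _ (torusAct (A p.2) (x - y)) = 0
      rw [nsmul_pairT]
      exact pairT_eq_zero_of_mem_span hgen (hm₂s _ ((hΛ _).mp (b p.1).2)))
  rw [Fintype.card_prod, Fintype.card_fin, Fintype.card_fin] at hZ₃c
  refine ⟨Z₃, hZ₃.trans (hZ₂.trans hZ₁), ?_, ?_⟩
  · intro w hw d x hx y hy
    have hsum := b.sum_repr ⟨w, (hΛ w).mpr hw⟩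
    have hsum' : ∑ i, (b.repr ⟨w, (hΛ w).mpr hw⟩ i) • (b i : Fin L → ℤ) = w := by
      have := congrArg Λ.subtype hsum
      rw [map_sum] at this
      exact this
    change pairTLin (torusAct (A d) (x - y)) w = 0
    rw [← hsum', map_sum]
    refine Finset.sum_eq_zero fun i _ => ?_
    rw [map_smul]
    have : pairTLin (torusAct (A d) (x - y)) (b i : Fin L → ℤ) = 0 := hZ₃v x hx y hy (i, d)
    rw [this, smul_zero]
  · have h3 : m₂ ^ (Module.finrank ℤ Λ * (D + 1)) ≤ (L.factorial * M ^ L) ^ (L * (D + 1)) :=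
      (Nat.pow_le_pow_left hm₂le _).trans
        (Nat.pow_le_pow_right (hm₂.trans_le hm₂le) (Nat.mul_le_mul_right _ hr))
    calc Y₁.card ≤ q ^ D * (m₁ * (m₂ ^ (Module.finrank ℤ Λ * (D + 1)) * Z₃.card)) :=
          hZ₁c.trans (Nat.mul_le_mul_left _ (hZ₂c.trans (Nat.mul_le_mul_left _ hZ₃c)))
      _ ≤ q ^ D * ((N.factorial * (L * (M * starNorm A)) ^ N) *
          ((L.factorial * M ^ L) ^ (L * (D + 1)) * Z₃.card)) := by gcongr
      _ = _ := by ring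

/-- When the annihilating set spans, the point set is small. -/
lemma Annihilates.card_le {A : Fin (D + 1) → Matrix (Fin L) (Fin N) ℤ} (hA : CondA A)
    (ha : 0 < starNorm A) {S : Set (Fin L → ℤ)} {Y : Finset (Fin N → Torus1)}
    (hY : Annihilates A S Y) (hS : Submodule.span ℚ (ratVec '' S) = ⊤) :
    Y.card ≤ (N.factorial * starNorm A ^ N) ^ N := by
  classical
  set W : Set (Fin N → ℤ) := Set.range fun p : Fin D × Fin L => A p.1.succ p.2 with hW
  obtain ⟨m, hm, hmle, hms⟩ := exists_smul_mem_span W (starNorm A) ha (by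
    rintro _ ⟨p, rfl⟩ j
    exact abs_le_starNorm A (Fin.succ_ne_zero _) _ _)
  have hspan : ∀ w : Fin N → ℚ, w ∈ Submodule.span ℚ (ratVec '' W) := by
    intro w
    refine mem_span_of_forall_dotProduct _ _ fun u hu => ?_
    have : u = 0 := by
      refine hA u fun d hd => ?_
      obtain ⟨e, rfl⟩ := Fin.exists_succ_eq.mpr hd
      funext i
      exact hu _ ⟨_, ⟨(e, i), rfl⟩, rfl⟩
    rw [this, dotProduct_zero]
  have hsingle : ∀ (n : ℕ) (j : Fin n) (t : Fin n → Torus1), pairT (Pi.single j 1) t = t j := by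
    intro n j t
    rw [pairT, Finset.sum_eq_single j]
    · simp
    · intro b _ hb; simp [hb]
    · simp
  obtain ⟨Z, hZ, hZc, hZ0⟩ := exists_subset_forall_eq_zero
    (fun j : Fin N => Pi.evalAddMonoidHom (fun _ : Fin N => Torus1) j) hm Y (by
      intro x hx y hy j
      change m • (x - y) j = 0
      rw [← hsingle N j (x - y), nsmul_pairT]
      refine pairT_eq_zero_of_mem_span ?_ (hms _ (hspan _))
      rintro _ ⟨p, rfl⟩
      have := hY (Pi.single p.2 1) (by rw [hS]; trivial) p.1.succ x hx y hy
      change pairT _ (torusAct (A p.1.succ) (x - y)) = 0 at this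
      rw [hsingle] at this
      exact this)
  have hZ1 : Z.card ≤ 1 := Finset.card_le_one.mpr fun x hx y hy => by
    funext j
    exact sub_eq_zero.mp (hZ0 x hx y hy j)
  rw [Fintype.card_fin] at hZc
  calc Y.card ≤ m ^ N * Z.card := hZc
    _ ≤ (N.factorial * starNorm A ^ N) ^ N * 1 := by gcongr
    _ = _ := mul_one _

/-- A proper rational subspace is annihilated by a subtorus. -/
lemma exists_isSubtorus {S : Set (Fin L → ℤ)} (hS : Submodule.span ℚ (ratVec '' S) ≠ ⊤) :
    ∃ T : AddSubgroup (Fin L → Torus1), IsSubtorus T ∧ ∀ t ∈ T, ∀ w : Fin L → ℤ,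
      ratVec w ∈ Submodule.span ℚ (ratVec '' S) → pairT w t = 0 := by
  obtain ⟨u, hu0, hu⟩ : ∃ u : Fin L → ℚ, u ≠ 0 ∧
      ∀ w ∈ Submodule.span ℚ (ratVec '' S), w ⬝ᵥ u = 0 := by
    by_contra! hcon
    refine hS (eq_top_iff.mpr fun w _ => mem_span_of_forall_dotProduct _ _ fun u hu => ?_)
    by_cases h0 : u = 0
    · rw [h0, dotProduct_zero]
    · obtain ⟨w', hw', hne⟩ := hcon u h0
      suffices h : w' ⬝ᵥ u = 0 from absurd h hne
      clear hne
      induction hw' using Submodule.span_induction with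
      | mem x hx => exact hu x hx
      | zero => exact zero_dotProduct _
      | add x y _ _ hx hy => rw [add_dotProduct, hx, hy, add_zero]
      | smul c x _ hx => rw [smul_dotProduct, hx, smul_zero]
  let G : Set (Fin L → Torus1) := {t | ∀ w : Fin L → ℤ,
      ratVec w ∈ Submodule.span ℚ (ratVec '' S) → pairT w t = 0}
  have hcont : ∀ w : Fin L → ℤ, Continuous fun t : Fin L → Torus1 => pairT w t := by
    intro w
    unfold pairT
    fun_prop
  have hG : IsClosed G := by
    have : G = ⋂ w : Fin L → ℤ, ⋂ _ : ratVec w ∈ Submodule.span ℚ (ratVec '' S),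
        {t | pairT w t = 0} := by ext t; simp [G]
    rw [this]
    exact isClosed_iInter fun w => isClosed_iInter fun _ =>
      isClosed_eq (hcont w) continuous_const
  let H : AddSubgroup (Fin L → Torus1) :=
    { carrier := G
      add_mem' := fun {s t} hs ht w hw => by
        have : pairT w (s + t) = pairT w s + pairT w t := by
          simp [pairT, Finset.sum_add_distrib]
        rw [this, hs w hw, ht w hw, add_zero]
      zero_mem' := fun w _ => by simp [pairT]
      neg_mem' := fun {t} ht w hw => by
        have : pairT w (-t) = -pairT w t := by simp [pairT]
        rw [this, ht w hw, neg_zero] }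
  let T : AddSubgroup (Fin L → Torus1) := (AddSubgroup.connectedComponentOfZero H).map H.subtype
  have hTset : (T : Set (Fin L → Torus1)) = Subtype.val '' (connectedComponent (0 : H)) := rfl
  refine ⟨T, ⟨?_, ?_, ?_⟩, ?_⟩
  · rw [hTset]
    exact hG.isClosedEmbedding_subtypeVal.isClosedMap _
      isClosed_connectedComponent
  · rw [hTset]
    exact isConnected_connectedComponent.image _ continuous_subtype_val.continuousOn
  · obtain ⟨i, hi⟩ := Function.ne_iff.mp hu0
    let γ : ℝ → (Fin L → Torus1) := fun r j => ((r * (u j : ℝ) : ℝ) : Torus1)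
    have hγG : ∀ r, γ r ∈ H := by
      intro r w hw
      have h1 := hu _ hw
      have h2 : pairT w (γ r) = ((r * ((ratVec w ⬝ᵥ u : ℚ) : ℝ) : ℝ) : Torus1) := by
        have h3 : (r * ((ratVec w ⬝ᵥ u : ℚ) : ℝ) : ℝ) = ∑ j, w j • (r * (u j : ℝ)) := by
          simp only [dotProduct, ratVec, zsmul_eq_mul]
          push_cast
          rw [Finset.mul_sum]
          exact Finset.sum_congr rfl fun j _ => by ring
        rw [h3]
        exact (map_sum (QuotientAddGroup.mk' (AddSubgroup.zmultiples (1 : ℝ))) _ _).symm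
      rw [h2, h1]
      simp
    let γ' : ℝ → H := fun r => ⟨γ r, hγG r⟩
    have hγ' : Continuous γ' := by
      refine Continuous.subtype_mk (continuous_pi fun j => ?_) _
      exact (AddCircle.continuous_mk' 1).comp (by fun_prop)
    have h0 : γ' 0 = 0 := by
      ext j
      simp [γ', γ]
    have hsub : Set.range γ' ⊆ connectedComponent (0 : H) :=
      (isPreconnected_range hγ').subset_connectedComponent ⟨0, h0⟩
    intro hbot
    have hmem : γ (1 / (2 * u i)) ∈ T := ⟨γ' _, hsub ⟨_, rfl⟩, rfl⟩
    rw [hbot, AddSubgroup.mem_bot] at hmem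
    have h1 := congrFun hmem i
    have hui : (u i : ℝ) ≠ 0 := by exact_mod_cast hi
    have h2 : (1 / (2 * (u i : ℝ)) * u i : ℝ) = 1 / 2 := by field_simp
    have h3 : ‖((1 / 2 : ℝ) : Torus1)‖ = |(1 : ℝ)| / 2 := AddCircle.norm_half_period_eq 1
    have h4 : ((1 / 2 : ℝ) : Torus1) = 0 := by rw [← h2]; exact h1
    rw [h4] at h3
    norm_num at h3
  · rintro _ ⟨t, -, rfl⟩
    exact t.2

end Saturation

section Analytic

variable {L N D : ℕ}

lemma evalMat_eq (A : Fin (D + 1) → Matrix (Fin L) (Fin N) ℤ) (v : Fin L → ℤ) (n : ℕ)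
    (x : Fin N → Torus1) :
    pairHom v (evalMat A n) x = ∑ d : Fin (D + 1), n ^ (d : ℕ) • pairHom v (A d) x := by
  rw [pairHom_eq, evalMat, Matrix.vecMul_sum]
  change pairTLin x _ = _
  rw [map_sum]
  refine Finset.sum_congr rfl fun d _ => ?_
  rw [Matrix.vecMul_smul, pairHom_eq, nsmul_pairT, Nat.cast_pow]
  rfl

lemma sq_norm_sum_expT {G : Type*} [AddCommGroup G] (h : G →+ Torus1) (Y : Finset G) :
    ((‖∑ x ∈ Y, expT (h x)‖ ^ 2 : ℝ) : ℂ) = ∑ x ∈ Y, ∑ y ∈ Y, expT (h (x - y)) := by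
  push_cast
  rw [← Complex.mul_conj', map_sum, Finset.sum_mul_sum]
  simp only [map_sub, expT_sub]

/-- A point set avoiding a translate has a large exponential sum. -/
lemma exists_large_exponential_sums {α : Type*} {J : Finset (Fin L → ℤ)} {c : (Fin L → ℤ) → ℝ}
    (hc : ∀ v ∈ J, 0 ≤ c v) (hc1 : ∑ v ∈ J, c v = 1) (h0 : 0 ∈ J) {B : ℝ} (hB : B ≤ c 0 / 2)
    (Y : Finset α) (g : α → Fin L → Torus1)
    (hF : ∀ x ∈ Y, ∃ F : ℝ, ∑ v ∈ J, (c v : ℂ) * expT (pairT v (g x)) = F ∧ F ≤ B)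
    (P : (Fin L → ℤ) → Prop) [DecidablePred P] (hP0 : P 0)
    (hP : ∀ v, P v → ∀ x ∈ Y, pairT v (g x) = 0) :
    (c 0 / 2 * Y.card) ^ 2 ≤
      ∑ v ∈ J with ¬P v, c v * ‖∑ x ∈ Y, expT (pairT v (g x))‖ ^ 2 := by
  set S : (Fin L → ℤ) → ℂ := fun v => ∑ x ∈ Y, expT (pairT v (g x)) with hS
  set a : ℝ := c 0 / 2 * Y.card with ha
  have ha0 : 0 ≤ a := by have := hc 0 h0; positivity
  have hc' : ∀ v ∈ J.filter (¬P ·), 0 ≤ c v := fun v hv => hc v (Finset.mem_filter.mp hv).1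
  have hsum : ∑ v ∈ J, c v * (S v).re ≤ a := by
    have h1 : ∑ v ∈ J, c v * (S v).re = ∑ x ∈ Y, (∑ v ∈ J, (c v : ℂ) * expT (pairT v (g x))).re := by
      simp only [hS, Complex.re_sum, Complex.re_ofReal_mul, Finset.mul_sum]
      exact Finset.sum_comm
    rw [h1, ha, mul_comm]
    refine (Finset.sum_le_card_nsmul _ _ (c 0 / 2) fun x hx => ?_).trans (by simp)
    obtain ⟨F, hF1, hF2⟩ := hF x hx
    rw [hF1, Complex.ofReal_re]
    exact hF2.trans hB
  have hPsum : c 0 * Y.card ≤ ∑ v ∈ J with P v, c v * (S v).re := by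
    have hSP : ∀ v, P v → (S v).re = Y.card := fun v hv => by
      have : S v = Y.card := by
        rw [hS]
        dsimp only
        rw [Finset.sum_congr rfl fun x hx => by rw [hP v hv x hx, expT_zero]]
        simp
      rw [this, Complex.natCast_re]
    rw [← hSP 0 hP0]
    refine Finset.single_le_sum (f := fun v => c v * (S v).re) (fun v hv => ?_)
      (Finset.mem_filter.mpr ⟨h0, hP0⟩)
    rw [hSP v (Finset.mem_filter.mp hv).2]
    exact mul_nonneg (hc v (Finset.mem_filter.mp hv).1) (Nat.cast_nonneg _)
  have hsplit := Finset.sum_filter_add_sum_filter_not J P fun v => c v * (S v).re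
  have hlow : a ≤ ∑ v ∈ J with ¬P v, c v * ‖S v‖ := by
    have h2 : -∑ v ∈ J with ¬P v, c v * (S v).re ≤ ∑ v ∈ J with ¬P v, c v * ‖S v‖ := by
      rw [← Finset.sum_neg_distrib]
      refine Finset.sum_le_sum fun v hv => ?_
      rw [← mul_neg]
      exact mul_le_mul_of_nonneg_left
        ((neg_le_abs _).trans (Complex.abs_re_le_norm _)) (hc' v hv)
    linarith
  have hone : ∑ v ∈ J with ¬P v, c v ≤ 1 := by
    rw [← hc1]
    exact Finset.sum_le_sum_of_subset_of_nonneg (Finset.filter_subset _ _)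
      fun v hv _ => hc v hv
  have hexp : ∑ v ∈ J with ¬P v, c v * (2 * a * ‖S v‖ - a ^ 2) ≤
      ∑ v ∈ J with ¬P v, c v * ‖S v‖ ^ 2 :=
    Finset.sum_le_sum fun v hv => mul_le_mul_of_nonneg_left
      (by nlinarith [sq_nonneg (‖S v‖ - a)]) (hc' v hv)
  refine le_trans ?_ hexp
  have h3 : ∑ v ∈ J with ¬P v, c v * (2 * a * ‖S v‖ - a ^ 2) =
      2 * a * ∑ v ∈ J with ¬P v, c v * ‖S v‖ - a ^ 2 * ∑ v ∈ J with ¬P v, c v := by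
    rw [Finset.mul_sum, Finset.mul_sum, ← Finset.sum_sub_distrib]
    exact Finset.sum_congr rfl fun v _ => by ring
  rw [h3]
  nlinarith [mul_le_mul_of_nonneg_left hlow ha0, mul_le_mul_of_nonneg_left hone (sq_nonneg a)]

lemma IsMean.exists_large_correlation {m : (ℕ → ℂ) →ₗ[ℂ] ℂ} (hm : IsMean m) {ι G : Type*}
    [AddCommGroup G] (J : Finset ι) {c : ι → ℝ} (hc : ∀ v ∈ J, 0 ≤ c v) (hc1 : ∑ v ∈ J, c v ≤ 1)
    (φ : ι → ℕ → G →+ Torus1) (Y : Finset G) {a : ℝ} (ha : 0 < a)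
    (h : ∀ n, 0 < n → a ≤ ∑ v ∈ J, c v * ‖∑ x ∈ Y, expT (φ v n x)‖ ^ 2) :
    ∃ v ∈ J, a ≤ ∑ y ∈ Y, ∑ x ∈ Y, ‖m fun n => expT (φ v n (x - y))‖ := by
  have hJ : J.Nonempty := by
    rw [Finset.nonempty_iff_ne_empty]
    rintro rfl
    have := h 1 one_pos
    simp at this
    linarith
  set W : ι → ℝ := fun v => ∑ y ∈ Y, ∑ x ∈ Y, ‖m fun n => expT (φ v n (x - y))‖ with hW
  have hW0 : ∀ v, 0 ≤ W v := fun v => by positivity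
  obtain ⟨v, hv, hmax⟩ := Finset.exists_max_image J W hJ
  refine ⟨v, hv, ?_⟩
  set f : ℕ → ℂ := fun n => ∑ v ∈ J, (c v : ℂ) * ∑ x ∈ Y, ∑ y ∈ Y, expT (φ v n (x - y)) with hf
  have hfre : ∀ n, (f n).re = ∑ v ∈ J, c v * ‖∑ x ∈ Y, expT (φ v n x)‖ ^ 2 := fun n => by
    simp only [hf, ← sq_norm_sum_expT, Complex.re_sum, Complex.re_ofReal_mul, Complex.ofReal_re]
  obtain ⟨C, hC⟩ : ∃ C : ℝ, ∀ n, ‖f n‖ ≤ C := by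
    refine ⟨∑ v ∈ J, ‖(c v : ℂ)‖ * ∑ _x ∈ Y, ∑ _y ∈ Y, 1, fun n => ?_⟩
    refine (norm_sum_le _ _).trans (Finset.sum_le_sum fun v _ => ?_)
    rw [norm_mul]
    refine mul_le_mul_of_nonneg_left ?_ (norm_nonneg _)
    refine (norm_sum_le _ _).trans (Finset.sum_le_sum fun x _ => ?_)
    refine (norm_sum_le _ _).trans (Finset.sum_le_sum fun y _ => ?_)
    rw [norm_expT]
  have hmf : a ≤ (m f).re := by
    have h1 := hm.nonneg (fun n => f (n + 1) - (a : ℂ) * 1) (C + a) (fun n => by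
      refine (norm_sub_le _ _).trans (add_le_add (hC _) ?_)
      rw [mul_one, Complex.norm_real, Real.norm_of_nonneg ha.le]) (fun n => by
      rw [mul_one, Complex.sub_re, Complex.ofReal_re, hfre, sub_nonneg]
      exact h _ n.succ_pos)
    have h2 : m (fun n => f (n + 1) - (a : ℂ) * 1) = m f - a := by
      have : (fun n => f (n + 1) - (a : ℂ) * 1) = (fun n => f (n + 1)) - (a : ℂ) • fun _ => 1 := rfl
      rw [this, map_sub, map_smul, hm.map_one, hm.shift f C hC, smul_eq_mul, mul_one]
    rw [h2, Complex.sub_re, Complex.ofReal_re] at h1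
    linarith
  have hmf' : m f = ∑ v ∈ J, (c v : ℂ) *
      ∑ x ∈ Y, ∑ y ∈ Y, m fun n => expT (φ v n (x - y)) := by
    simp only [hf, IsMean.map_sum_fun, IsMean.map_const_mul]
  have hle : ∀ v ∈ J, ((c v : ℂ) * ∑ x ∈ Y, ∑ y ∈ Y, m fun n => expT (φ v n (x - y))).re ≤
      c v * W v := fun v hv => by
    rw [Complex.re_ofReal_mul]
    refine mul_le_mul_of_nonneg_left ((Complex.re_le_norm _).trans ?_) (hc v hv)
    rw [Finset.sum_comm]
    exact (norm_sum_le _ _).trans (Finset.sum_le_sum fun x _ => norm_sum_le _ _)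
  rw [hmf', Complex.re_sum] at hmf
  calc a ≤ ∑ v ∈ J, c v * W v := hmf.trans (Finset.sum_le_sum hle)
    _ ≤ ∑ u ∈ J, c u * W v :=
        Finset.sum_le_sum fun u hu => mul_le_mul_of_nonneg_left (hmax u hu) (hc u hu)
    _ = (∑ u ∈ J, c u) * W v := (Finset.sum_mul _ _ _).symm
    _ ≤ W v := mul_le_of_le_one_left (hW0 v) hc1

/-- If the total of a bounded kernel is large then some row has many large entries. -/
lemma exists_row_card_le {α : Type*} {Y : Finset α} (hY : Y.Nonempty) (w : α → α → ℝ)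
    (hw : ∀ x y, w x y ≤ 1) {R : ℕ} (hR : 0 < R)
    (h : 2 / (R : ℝ) * Y.card ^ 2 ≤ ∑ y ∈ Y, ∑ x ∈ Y, w y x) :
    ∃ y ∈ Y, Y.card ≤ R * {x ∈ Y | 1 / (R : ℝ) ≤ w y x}.card := by
  have hR' : (0 : ℝ) < R := by exact_mod_cast hR
  obtain ⟨y, hy, hyle⟩ : ∃ y ∈ Y, 2 / (R : ℝ) * Y.card ≤ ∑ x ∈ Y, w y x := by
    refine Finset.exists_le_of_sum_le hY (le_trans (le_of_eq ?_) h)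
    rw [Finset.sum_const, nsmul_eq_mul]
    ring
  refine ⟨y, hy, ?_⟩
  have hle : ∑ x ∈ Y, w y x ≤
      ∑ x ∈ Y, ((if 1 / (R : ℝ) ≤ w y x then 1 else 0) + 1 / (R : ℝ)) := by
    refine Finset.sum_le_sum fun x _ => ?_
    split_ifs with hx
    · have : 0 < 1 / (R : ℝ) := by positivity
      linarith [hw y x]
    · linarith
  rw [Finset.sum_add_distrib, Finset.sum_boole, Finset.sum_const, nsmul_eq_mul] at hle
  have key : 1 / (R : ℝ) * Y.card ≤ ({x ∈ Y | 1 / (R : ℝ) ≤ w y x}.card : ℝ) := by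
    have : 2 / (R : ℝ) * Y.card = 1 / (R : ℝ) * Y.card + Y.card * (1 / (R : ℝ)) := by ring
    linarith
  have : (Y.card : ℝ) ≤ R * ({x ∈ Y | 1 / (R : ℝ) ≤ w y x}.card : ℝ) := by
    rwa [div_mul_eq_mul_div, one_mul, div_le_iff₀' hR'] at key
  exact_mod_cast this

lemma exists_dist_gt_of_not_epsDenseIn {Y T : Set (Fin L → Torus1)} {ε : ℝ}
    (h : ¬EpsDenseIn Y T ε) : ∃ s ∈ T, ∀ y ∈ Y, ∃ i, ε < ‖y i - s i‖ := by
  unfold EpsDenseIn at h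
  push Not at h
  simpa only [dist_eq_norm] using h

/-- If no image of `Y` is `ε`-dense in a translate of a subtorus, then some new small vector
almost annihilates a large part of `Y`. -/
lemma Annihilates.exists_new_vector {m : (ℕ → ℂ) →ₗ[ℂ] ℂ} (hm : IsMean m) {c k : ℕ}
    (hden : ∀ (θ : ℕ → Torus1) (R : ℕ), 0 < R → 1 / (R : ℝ) ≤ ‖m fun n => expT (polyT D θ n)‖ →
      ∃ q, 0 < q ∧ q ≤ c * R ^ k ∧ ∀ d, 1 ≤ d → d ≤ D → q • θ d = 0)
    {A : Fin (D + 1) → Matrix (Fin L) (Fin N) ℤ} {S : Set (Fin L → ℤ)}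
    (hS : Submodule.span ℚ (ratVec '' S) ≠ ⊤) {Y : Finset (Fin N → Torus1)}
    (hY : Annihilates A S Y) (hne : Y.Nonempty) {M : ℕ} (hM : 0 < M) {ε : ℝ} (hε : 0 < ε)
    (hMε : Real.exp (-(4 * ε ^ 2 * M)) ≤ 1 / (2 * M : ℝ) ^ L / 2)
    (hfail : ∀ n : ℕ, 0 < n → ∀ T : AddSubgroup (Fin L → Torus1), IsSubtorus T →
      ∀ t, ¬EpsDenseIn (torusAct (evalMat A n) '' (Y : Set (Fin N → Torus1)))
        (translateOf t T) ε)
    {R : ℕ} (hR : R = 8 * (2 * M) ^ (2 * L)) :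
    ∃ v : Fin L → ℤ, (∀ i, |v i| ≤ (M : ℤ)) ∧ ratVec v ∉ Submodule.span ℚ (ratVec '' S) ∧
      ∃ q, 0 < q ∧ q ≤ c * R ^ k ∧ ∃ Y₁ ⊆ Y, Y.card ≤ R * (c * R ^ k) * Y₁.card ∧
        ∀ d : Fin D, ∀ x ∈ Y₁, ∀ y ∈ Y₁, q • pairHom v (A d.succ) (x - y) = 0 := by
  classical
  obtain ⟨T, hT, hTS⟩ := exists_isSubtorus hS
  obtain ⟨x₀, hx₀⟩ := hne
  obtain ⟨J, b, hJ, hb, hb1, hJ0, hb0, hF⟩ := exists_kernel L M hM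
  have hsep : ∀ n : ℕ, 0 < n → ∃ s ∈ T, ∀ x ∈ Y, ∃ i,
      ε < ‖(torusAct (evalMat A n) x - (torusAct (evalMat A n) x₀ + s)) i‖ := by
    intro n hn
    obtain ⟨_, ⟨s, hs, rfl⟩, h⟩ := exists_dist_gt_of_not_epsDenseIn
      (hfail n hn T hT (torusAct (evalMat A n) x₀))
    exact ⟨s, hs, fun x hx => h _ ⟨x, hx, rfl⟩⟩
  have hMpos : (0 : ℝ) < 2 * M := by positivity
  have hcpos : 0 < b 0 := lt_of_lt_of_le (by positivity) hb0
  have hYpos : (0 : ℝ) < Y.card := by exact_mod_cast Finset.card_pos.mpr ⟨x₀, hx₀⟩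
  set P : (Fin L → ℤ) → Prop := fun v => ratVec v ∈ Submodule.span ℚ (ratVec '' S) with hPdef
  have hlarge : ∀ n : ℕ, 0 < n → (b 0 / 2 * Y.card) ^ 2 ≤
      ∑ v ∈ J with ¬P v, b v * ‖∑ x ∈ Y, expT (pairHom v (evalMat A n) x)‖ ^ 2 := by
    intro n hn
    obtain ⟨s, hs, hsx⟩ := hsep n hn
    set t := torusAct (evalMat A n) x₀ + s with ht
    have h := exists_large_exponential_sums hb hb1 hJ0
      (hMε.trans (div_le_div_of_nonneg_right hb0 zero_le_two)) Y
      (fun x => torusAct (evalMat A n) x - t) (fun x hx => by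
        obtain ⟨i, hi⟩ := hsx x hx
        obtain ⟨F, hF1, hF2⟩ := hF (torusAct (evalMat A n) x - t)
        refine ⟨F, hF1, (hF2 i).trans (Real.exp_le_exp.mpr (neg_le_neg ?_))⟩
        gcongr) P (by
          have : ratVec (0 : Fin L → ℤ) = 0 := by funext i; simp [ratVec]
          rw [hPdef]
          dsimp only
          rw [this]
          exact Submodule.zero_mem _) (by
        intro v hv x hx
        have h1 : pairT v (torusAct (evalMat A n) x - t) =
            pairHom v (evalMat A n) (x - x₀) - pairT v s := by
          rw [map_sub, pairT_sub, ht]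
          have : pairT v (torusAct (evalMat A n) x₀ + s) =
              pairHom v (evalMat A n) x₀ + pairT v s := by
            rw [← sub_neg_eq_add, pairT_sub, sub_eq_add_neg]
            simp [pairHom, pairT]
          rw [this, sub_add_eq_sub_sub]
          rfl
        rw [h1, hTS s hs v hv, sub_zero, evalMat_eq]
        exact Finset.sum_eq_zero fun d _ => by rw [hY v hv d x hx x₀ hx₀, smul_zero])
    refine h.trans_eq (Finset.sum_congr rfl fun v _ => ?_)
    have h2 : ∑ x ∈ Y, expT (pairT v (torusAct (evalMat A n) x - t)) =
        (∑ x ∈ Y, expT (pairHom v (evalMat A n) x)) * conj (expT (pairT v t)) := by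
      rw [Finset.sum_mul]
      exact Finset.sum_congr rfl fun x _ => by rw [pairT_sub, expT_sub]; rfl
    rw [h2, norm_mul, RCLike.norm_conj, norm_expT, mul_one]
  have hnorm : ∀ (h : ℕ → Torus1), ‖m fun n => expT (h n)‖ ≤ 1 :=
    fun h => hm.norm_le _ 1 fun n => (norm_expT _).le
  obtain ⟨v, hv, hcorr⟩ := hm.exists_large_correlation (J.filter (¬P ·)) (c := b)
    (fun v hv => hb v (Finset.mem_filter.mp hv).1)
    ((Finset.sum_le_sum_of_subset_of_nonneg (Finset.filter_subset _ _)
      fun v hv _ => hb v hv).trans hb1.le)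
    (fun v n => pairHom v (evalMat A n)) Y (a := (b 0 / 2 * Y.card) ^ 2) (by positivity) hlarge
  obtain ⟨hvJ, hvP⟩ := Finset.mem_filter.mp hv
  have hR0 : 0 < R := by rw [hR]; positivity
  obtain ⟨y, hy, hycard⟩ := exists_row_card_le ⟨x₀, hx₀⟩
    (fun y x => ‖m fun n => expT (pairHom v (evalMat A n) (x - y))‖)
    (fun _ _ => hnorm _) hR0 (le_trans (by
      have h1 : (2 : ℝ) / R = (1 / (2 * M : ℝ) ^ L / 2) ^ 2 := by
        rw [hR]
        push_cast
        field_simp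
        ring
      rw [h1, ← mul_pow]
      gcongr) hcorr)
  refine ⟨v, hJ v hvJ, hvP, ?_⟩
  have hq : ∀ x, 1 / (R : ℝ) ≤ ‖m fun n => expT (pairHom v (evalMat A n) (x - y))‖ →
      ∃ q, (0 < q ∧ q ≤ c * R ^ k) ∧
        ∀ d : Fin D, q • pairHom v (A d.succ) (x - y) = 0 := by
    intro x hx
    set θ : ℕ → Torus1 := fun d =>
      if h : d < D + 1 then pairHom v (A ⟨d, h⟩) (x - y) else 0
    have hθd : ∀ d : Fin (D + 1), θ d = pairHom v (A d) (x - y) := fun d => dif_pos d.isLt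
    have hθ' : ∀ n, polyT D θ n = pairHom v (evalMat A n) (x - y) := fun n => by
      rw [evalMat_eq, polyT, Finset.sum_range]
      exact Finset.sum_congr rfl fun d _ => by rw [hθd]
    obtain ⟨q, hq0, hqle, hqd⟩ := hden θ R hR0 (by simpa only [hθ'] using hx)
    refine ⟨q, ⟨hq0, hqle⟩, fun d => ?_⟩
    rw [← hθd d.succ]
    exact hqd _ (by simp) (by simp)
  choose! Q hQ hQd using hq
  set Z := {x ∈ Y | 1 / (R : ℝ) ≤ ‖m fun n => expT (pairHom v (evalMat A n) (x - y))‖} with hZ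
  have hmaps : ∀ x ∈ Z, Q x ∈ Finset.Icc 1 (c * R ^ k) := fun x hx =>
    Finset.mem_Icc.mpr (hQ x (Finset.mem_filter.mp hx).2)
  have hZne : Z.Nonempty := by
    rw [Finset.nonempty_iff_ne_empty]
    intro h
    rw [h, Finset.card_empty, mul_zero] at hycard
    exact absurd (Finset.card_pos.mpr ⟨x₀, hx₀⟩) (by omega)
  obtain ⟨z, hz⟩ := hZne
  obtain ⟨q, hq, hqcard⟩ := exists_fiber Z _ Q ⟨_, hmaps z hz⟩ hmaps
  rw [Nat.card_Icc, Nat.add_sub_cancel] at hqcard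
  obtain ⟨hq0, hqle⟩ := Finset.mem_Icc.mp hq
  refine ⟨q, hq0, hqle, {x ∈ Z | Q x = q},
    (Finset.filter_subset _ _).trans (Finset.filter_subset _ _), ?_, ?_⟩
  · rw [mul_assoc]
    exact hycard.trans (Nat.mul_le_mul_left _ hqcard)
  · intro d x hx x' hx'
    obtain ⟨hxZ, hxq⟩ := Finset.mem_filter.mp hx
    obtain ⟨hxZ', hxq'⟩ := Finset.mem_filter.mp hx'
    have h1 := hQd x (Finset.mem_filter.mp hxZ).2 d
    have h2 := hQd x' (Finset.mem_filter.mp hxZ').2 d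
    rw [hxq] at h1
    rw [hxq'] at h2
    have : x - x' = (x - y) - (x' - y) := by abel
    rw [this, map_sub, smul_sub, h1, h2, sub_zero]

end Analytic

section Iteration

variable {L N D : ℕ}

lemma EpsDenseIn.mono {Y Z T : Set (Fin L → Torus1)} {ε : ℝ} (h : EpsDenseIn Y T ε)
    (hYZ : Y ⊆ Z) : EpsDenseIn Z T ε := fun s hs =>
  let ⟨y, hy, hys⟩ := h s hs
  ⟨y, hYZ hy, hys⟩

/-- The loss in cardinality caused by adjoining one vector, in terms of the size `M` of the vectors
and of `a = ‖A_*‖_∞`. -/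
def stepLoss (L N D c k M a : ℕ) : ℕ :=
  8 * (2 * M) ^ (2 * L) * (c * (8 * (2 * M) ^ (2 * L)) ^ k) *
    ((c * (8 * (2 * M) ^ (2 * L)) ^ k) ^ D * (N.factorial * (L * (M * a)) ^ N) *
      (L.factorial * M ^ L) ^ (L * (D + 1)))

lemma stepLoss_pos {c k M a : ℕ} (hL : 0 < L) (hc : 0 < c) (hM : 0 < M) (ha : 0 < a) :
    0 < stepLoss L N D c k M a := by
  unfold stepLoss
  positivity

/-- The bound for the cardinality of a point set without dense images. -/
def cardBound (L N D c k M a : ℕ) : ℕ :=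
  stepLoss L N D c k M a ^ L * (N.factorial * a ^ N) ^ N

lemma card_le_cardBound {m : (ℕ → ℂ) →ₗ[ℂ] ℂ} (hm : IsMean m) {c k : ℕ} (hc : 0 < c)
    (hden : ∀ (θ : ℕ → Torus1) (R : ℕ), 0 < R → 1 / (R : ℝ) ≤ ‖m fun n => expT (polyT D θ n)‖ →
      ∃ q, 0 < q ∧ q ≤ c * R ^ k ∧ ∀ d, 1 ≤ d → d ≤ D → q • θ d = 0)
    (hL : 0 < L) (hN : 0 < N)
    {A : Fin (D + 1) → Matrix (Fin L) (Fin N) ℤ} (hA : CondA A) (hB : CondB A)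
    (X : Finset (Fin N → Torus1)) {M : ℕ} (hM : 0 < M) {ε : ℝ} (hε : 0 < ε)
    (hMε : Real.exp (-(4 * ε ^ 2 * M)) ≤ 1 / (2 * M : ℝ) ^ L / 2)
    (hfail : ∀ n : ℕ, 0 < n → ∀ T : AddSubgroup (Fin L → Torus1), IsSubtorus T →
      ∀ t, ¬EpsDenseIn (torusAct (evalMat A n) '' (X : Set (Fin N → Torus1)))
        (translateOf t T) ε) :
    X.card ≤ cardBound L N D c k M (starNorm A) := by
  have ha := hA.starNorm_pos hN
  set K := stepLoss L N D c k M (starNorm A) with hK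
  have hK0 : 0 < K := stepLoss_pos hL hc hM ha
  by_contra! hX
  have key : ∀ r ≤ L, ∃ (S : Set (Fin L → ℤ)) (Y : Finset (Fin N → Torus1)), Y ⊆ X ∧
      (∀ s ∈ S, ∀ i, |s i| ≤ (M : ℤ)) ∧ Annihilates A S Y ∧ X.card ≤ K ^ r * Y.card ∧
      r ≤ Module.finrank ℚ (Submodule.span ℚ (ratVec '' S)) := by
    intro r hr
    induction r with
    | zero =>
      refine ⟨∅, X, subset_rfl, by simp, ?_, by simp, Nat.zero_le _⟩
      intro w hw d x _ y _
      rw [Set.image_empty, Submodule.span_empty, Submodule.mem_bot] at hw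
      have : w = 0 := ratVec_injective (hw.trans (by funext i; simp [ratVec]))
      rw [this, pairHom_eq]
      simp [pairT]
    | succ r ih =>
      obtain ⟨S, Y, hYX, hSM, hY, hcard, hrank⟩ := ih (by omega)
      have hS : Submodule.span ℚ (ratVec '' S) ≠ ⊤ := fun htop => by
        refine hX.not_ge (hcard.trans ?_)
        exact Nat.mul_le_mul (Nat.pow_le_pow_right hK0 (by omega)) (hY.card_le hA ha htop)
      have hne : Y.Nonempty := by
        rw [Finset.nonempty_iff_ne_empty]
        rintro rfl
        rw [Finset.card_empty, mul_zero] at hcard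
        omega
      obtain ⟨v, hv, hvS, q, hq, hqle, Y₁, hY₁, hY₁card, hqv⟩ :=
        hY.exists_new_vector hm hden hS hne hM hε hMε
          (fun n hn T hT t h => hfail n hn T hT t (h.mono (Set.image_mono hYX))) rfl
      obtain ⟨Y₂, hY₂, hY₂S, hY₂card⟩ := hY.insert hB hL ha hM hSM hY₁ hv hq hqv
      refine ⟨insert v S, Y₂, hY₂.trans (hY₁.trans hYX), ?_, hY₂S, ?_, ?_⟩
      · rintro s (rfl | hs)
        · exact hv
        · exact hSM s hs
      · have hstep : Y.card ≤ K * Y₂.card := by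
          refine hY₁card.trans ((Nat.mul_le_mul_left _ hY₂card).trans ?_)
          rw [← mul_assoc, hK, stepLoss]
          gcongr
        rw [pow_succ, mul_assoc]
        exact hcard.trans (Nat.mul_le_mul_left _ hstep)
      · refine Nat.succ_le_of_lt (hrank.trans_lt (Submodule.finrank_lt_finrank_of_lt ?_))
        refine lt_of_le_of_ne (Submodule.span_mono (Set.image_mono (Set.subset_insert v S)))
          fun h => hvS ?_
        rw [h]
        exact Submodule.subset_span ⟨v, Set.mem_insert v S, rfl⟩
  obtain ⟨S, Y, -, -, hY, hcard, hrank⟩ := key L le_rfl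
  have htop : Submodule.span ℚ (ratVec '' S) = ⊤ := by
    refine Submodule.eq_top_of_finrank_eq (le_antisymm (Submodule.finrank_le _) ?_)
    rwa [Module.finrank_fin_fun]
  exact hX.not_ge (hcard.trans (Nat.mul_le_mul_left _ (hY.card_le hA ha htop)))

end Iteration

section Constants

/-- Functions of two natural numbers that are monomials. -/
def IsMonomial (f : ℕ → ℕ → ℕ) : Prop :=
  ∃ C p q : ℕ, ∀ x y, f x y = C * x ^ p * y ^ q

namespace IsMonomial

lemma const (C : ℕ) : IsMonomial fun _ _ => C := ⟨C, 0, 0, by simp⟩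

lemma left : IsMonomial fun x _ => x := ⟨1, 1, 0, by simp⟩

lemma right : IsMonomial fun _ y => y := ⟨1, 0, 1, by simp⟩

lemma mul {f g : ℕ → ℕ → ℕ} (hf : IsMonomial f) (hg : IsMonomial g) :
    IsMonomial fun x y => f x y * g x y := by
  obtain ⟨C, p, q, hf⟩ := hf
  obtain ⟨C', p', q', hg⟩ := hg
  exact ⟨C * C', p + p', q + q', fun x y => by simp only [hf, hg]; ring⟩

lemma pow {f : ℕ → ℕ → ℕ} (hf : IsMonomial f) (n : ℕ) : IsMonomial fun x y => f x y ^ n := by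
  obtain ⟨C, p, q, hf⟩ := hf
  exact ⟨C ^ n, p * n, q * n, fun x y => by simp only [hf]; ring⟩

end IsMonomial

lemma isMonomial_cardBound (L N D c k : ℕ) : IsMonomial (cardBound L N D c k) := by
  have hR := (IsMonomial.const 8).mul (((IsMonomial.const 2).mul IsMonomial.left).pow (2 * L))
  have hQ := (IsMonomial.const c).mul (hR.pow k)
  have hstep : IsMonomial (stepLoss L N D c k) :=
    (hR.mul hQ).mul (((hQ.pow D).mul ((IsMonomial.const _).mul
      (((IsMonomial.const L).mul (IsMonomial.left.mul IsMonomial.right)).pow N))).mul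
      (((IsMonomial.const _).mul (IsMonomial.left.pow L)).pow _))
  exact (hstep.pow L).mul (((IsMonomial.const _).mul (IsMonomial.right.pow N)).pow N)

lemma exp_neg_le {L M : ℕ} (hL : 0 < L) {ε : ℝ} (hM : ((2 * L).factorial : ℝ) ≤ ε ^ 4 * M) :
    Real.exp (-(4 * ε ^ 2 * M)) ≤ 1 / (2 * M : ℝ) ^ L / 2 := by
  have hF : (1 : ℝ) ≤ (2 * L).factorial := by exact_mod_cast (2 * L).factorial_pos
  have hM0 : (0 : ℝ) < M := by
    refine lt_of_le_of_ne (Nat.cast_nonneg M) fun h => ?_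
    rw [← h, mul_zero] at hM
    linarith
  have h1 : 2 * (2 * M : ℝ) ^ L ≤ Real.exp (4 * ε ^ 2 * M) := by
    refine le_trans ?_ (Real.pow_div_factorial_le_exp _ (by positivity) (2 * L))
    rw [le_div_iff₀ (by positivity)]
    calc 2 * (2 * M : ℝ) ^ L * (2 * L).factorial
        ≤ (2 * M : ℝ) ^ L * (8 * (2 * L).factorial) := by
          have : (0 : ℝ) ≤ (2 * M : ℝ) ^ L * (2 * L).factorial := by positivity
          linarith
      _ ≤ (2 * M : ℝ) ^ L * (8 * (2 * L).factorial) ^ L := by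
          gcongr
          exact le_self_pow₀ (by linarith) hL.ne'
      _ = (16 * ((2 * L).factorial * M)) ^ L := by rw [← mul_pow]; ring
      _ ≤ (16 * (ε ^ 4 * M * M)) ^ L := by gcongr
      _ = (4 * ε ^ 2 * M) ^ (2 * L) := by rw [pow_mul]; ring
  rw [Real.exp_neg, div_div, one_div]
  refine inv_anti₀ (by positivity) ?_
  linarith

lemma isSubtorus_top {L : ℕ} (hL : 0 < L) : IsSubtorus (⊤ : AddSubgroup (Fin L → Torus1)) := by
  have : Nonempty (Fin L) := ⟨⟨0, hL⟩⟩
  refine ⟨isClosed_univ, isConnected_univ, ?_⟩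
  have : Nontrivial Torus1 := ⟨((1 / 2 : ℝ) : Torus1), 0, fun h => by
    have h3 : ‖((1 / 2 : ℝ) : Torus1)‖ = |(1 : ℝ)| / 2 := AddCircle.norm_half_period_eq 1
    rw [h] at h3
    norm_num at h3⟩
  exact top_ne_bot

end Constants

end

/-- **Theorem 4 (effective version).** If `A(x)` satisfies conditions (a) and (b), then
there are positive constants `C, c₁, c₂` depending only on `N, L, D` such that every set
`X` of `k` distinct points of `𝕋^N` with `k > C ‖A_*‖_∞^{c₁} (1/ε)^{c₂}` admits a
positive integer `n`, a subtorus `𝒯` of `𝕋^L` and a translate of `𝒯` in which `A(n) X`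
is `ε`-dense. -/
theorem statement5 (L N D : ℕ) (hL : 0 < L) (hN : 0 < N) (hD : 0 < D) :
    ∃ C c₁ c₂ : ℝ, 0 < C ∧ 0 < c₁ ∧ 0 < c₂ ∧
      ∀ A : Fin (D + 1) → Matrix (Fin L) (Fin N) ℤ, CondA A → CondB A →
        ∀ ε : ℝ, 0 < ε →
          ∀ X : Finset (Fin N → Torus1),
            C * (starNorm A : ℝ) ^ c₁ * (1 / ε) ^ c₂ < (X.card : ℝ) →
            ∃ n : ℕ, 0 < n ∧
              ∃ T : AddSubgroup (Fin L → Torus1), IsSubtorus T ∧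
                ∃ t : Fin L → Torus1,
                  EpsDenseIn (torusAct (evalMat A n) '' (X : Set (Fin N → Torus1)))
                    (translateOf t T) ε := by
  obtain ⟨m, hm⟩ := exists_isMean
  obtain ⟨D, rfl⟩ := Nat.exists_eq_succ_of_ne_zero hD.ne'
  obtain ⟨c, k, hc, hden⟩ := hm.exists_denominator D
  obtain ⟨C, p, q, hbound⟩ := isMonomial_cardBound L N (D + 1) c k
  obtain ⟨F, hF⟩ : ∃ F : ℝ, F = ((2 * L).factorial : ℝ) := ⟨_, rfl⟩
  have hF1 : 1 ≤ F := by
    rw [hF]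
    exact_mod_cast (2 * L).factorial_pos
  refine ⟨C * (2 * F) ^ p + 1, (q + 1 : ℕ), (4 * p + 1 : ℕ), by positivity, by positivity,
    by positivity, fun A hA hB ε hε X hX => ?_⟩
  rw [Real.rpow_natCast, Real.rpow_natCast] at hX
  have ha : (1 : ℝ) ≤ starNorm A := by exact_mod_cast hA.starNorm_pos hN
  have hXpos : 0 < X.card := by
    have : (0 : ℝ) < X.card := lt_of_le_of_lt (by positivity) hX
    exact_mod_cast this
  rcases le_or_gt (1 / 2) ε with h | h
  · obtain ⟨x, hx⟩ := Finset.card_pos.mp hXpos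
    refine ⟨1, one_pos, ⊤, isSubtorus_top hL, 0, fun s _ => ⟨_, ⟨x, hx, rfl⟩, fun i => ?_⟩⟩
    rw [dist_eq_norm]
    refine (AddCircle.norm_le_half_period 1 one_ne_zero).trans ?_
    simpa using h
  · by_contra! hfail
    set M : ℕ := ⌈F / ε ^ 4⌉₊ with hMdef
    have hFM : F ≤ ε ^ 4 * M := (div_le_iff₀' (by positivity)).mp (Nat.le_ceil _)
    have hM : 0 < M := Nat.ceil_pos.mpr (by positivity)
    have hε1 : 1 ≤ 1 / ε := by rw [le_div_iff₀ hε]; linarith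
    have hMle : (M : ℝ) ≤ 2 * F * (1 / ε) ^ 4 := by
      have h1 : F / ε ^ 4 = F * (1 / ε) ^ 4 := by rw [div_pow, one_pow, mul_one_div]
      have h2 : 1 ≤ F * (1 / ε) ^ 4 := one_le_mul_of_one_le_of_one_le hF1 (one_le_pow₀ hε1)
      have h3 := (Nat.ceil_lt_add_one (a := F / ε ^ 4) (by positivity)).le
      rw [← hMdef] at h3
      linarith
    have hcard := card_le_cardBound hm hc hden hL hN hA hB X hM hε (exp_neg_le hL (hF ▸ hFM)) hfail
    rw [hbound] at hcard
    have hcard' : (X.card : ℝ) ≤ C * M ^ p * starNorm A ^ q := by exact_mod_cast hcard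
    refine absurd hX (not_lt.mpr (hcard'.trans ?_))
    calc (C : ℝ) * M ^ p * starNorm A ^ q
        ≤ C * (2 * F * (1 / ε) ^ 4) ^ p * starNorm A ^ q := by gcongr
      _ = C * (2 * F) ^ p * starNorm A ^ q * (1 / ε) ^ (4 * p) := by
          rw [mul_pow, ← pow_mul]; ring
      _ ≤ (C * (2 * F) ^ p + 1) * starNorm A ^ (q + 1) * (1 / ε) ^ (4 * p + 1) := by
          gcongr
          · linarith
          · exact Nat.le_succ _
          · exact Nat.le_succ _
end
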